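/- Theorem 2.7(ii): Let δ ∈ (0,1] and p ∈ (d,∞) satisfy γ := δ − d/p > 0. Suppose the measurable coefficients a^{ij} satisfy ν|ξ|² ≤ a^{ij}(x)ξ^iξ^j and Σ_{i,j}|a^{ij}(x)|² ≤ ν^{−2} for all x, ξ, are uniformly continuous in (x^1,…,x^{d−1}) with modulus ω_a, merely measurable in x^d, and satisfy [a]_{x',δ;B_1} := max_{i,j}[a^{ij}]_{x',δ;B_1} < ∞. Then there is a constant N depending only on d, q, ν, p, δ and ω_a such that: if u is a weak solution of D_i(a^{ij}D_j u) = div f⃗ in B_1 with ‖Du‖_{L_p(B_1)} < ∞ and [f⃗]_{x',γ;B_1} := max_i [f^i]_{x',γ;B_1} < ∞, then for all 1 ≤ i ≤ q, [D_i u]_{γ;B_{1/2}} ≤ N ( [f⃗]_{x',γ;B_1} + (1 + [a]_{x',δ;B_1}) ‖Du‖_{L_p(B_1)} ). -/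

import Mathlib

open MeasureTheory Metric Set Filter

noncomputable section

/-- First-order partial derivative `D_i`. -/
def pd {d : ℕ} (i : Fin d) (v : EuclideanSpace ℝ (Fin d) → ℝ)
    (x : EuclideanSpace ℝ (Fin d)) : ℝ :=
  fderiv ℝ v x (EuclideanSpace.single i 1)

/-- Second-order partial derivative `D_i D_j`. -/
def pd2 {d : ℕ} (i j : Fin d) (v : EuclideanSpace ℝ (Fin d) → ℝ)
    (x : EuclideanSpace ℝ (Fin d)) : ℝ :=
  pd i (fun y => pd j v y) x

/-- Partial Hölder bound with respect to the first `q` coordinates: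
`|g x - g y| ≤ K |x' - y'|^δ` whenever `x'' = y''` (note `dist x y = |x' - y'|` then). -/
def PHolderX (d q : ℕ) (δ : ℝ) (Ω : Set (EuclideanSpace ℝ (Fin d)))
    (g : EuclideanSpace ℝ (Fin d) → ℝ) (K : ℝ) : Prop :=
  ∀ x ∈ Ω, ∀ y ∈ Ω, (∀ i : Fin d, q ≤ (i : ℕ) → x i = y i) →
    |g x - g y| ≤ K * dist x y ^ δ

/-- Full Hölder bound. -/
def HolderB {d : ℕ} (δ : ℝ) (Ω : Set (EuclideanSpace ℝ (Fin d)))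
    (g : EuclideanSpace ℝ (Fin d) → ℝ) (K : ℝ) : Prop :=
  ∀ x ∈ Ω, ∀ y ∈ Ω, |g x - g y| ≤ K * dist x y ^ δ

/-- Uniform ellipticity with constant `ν` (two-sided bound). -/
def UnifElliptic (d : ℕ) (ν : ℝ)
    (a : Fin d → Fin d → EuclideanSpace ℝ (Fin d) → ℝ) : Prop :=
  ∀ (x : EuclideanSpace ℝ (Fin d)) (ξ : Fin d → ℝ),
    ν * ∑ i, ξ i ^ 2 ≤ ∑ i, ∑ j, a i j x * ξ i * ξ j ∧
      ∑ i, ∑ j, a i j x * ξ i * ξ j ≤ ν⁻¹ * ∑ i, ξ i ^ 2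

/-- Hilbert–Schmidt norm of the Hessian. -/
def hessNorm {d : ℕ} (v : EuclideanSpace ℝ (Fin d) → ℝ)
    (x : EuclideanSpace ℝ (Fin d)) : ℝ :=
  Real.sqrt (∑ i, ∑ j, pd2 i j v x ^ 2)

/-- Euclidean norm of the gradient. -/
def gradNorm {d : ℕ} (v : EuclideanSpace ℝ (Fin d) → ℝ)
    (x : EuclideanSpace ℝ (Fin d)) : ℝ :=
  Real.sqrt (∑ i, pd i v x ^ 2)

namespace PSch

abbrev Eu (d : ℕ) := EuclideanSpace ℝ (Fin d)

/-- Standard basis vector. -/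
def eb {d : ℕ} (i : Fin d) : Eu d := EuclideanSpace.single i (1 : ℝ)

variable {d : ℕ}

lemma norm_eb (i : Fin d) : ‖eb i‖ = 1 := by simp [eb]

lemma eb_same (i : Fin d) : (eb i : Eu d) i = 1 := by simp [eb]

lemma eb_ne {i j : Fin d} (h : j ≠ i) : (eb i : Eu d) j = 0 := by
  simp [eb, h]

lemma pd_def (i : Fin d) (g : Eu d → ℝ) (x : Eu d) : pd i g x = fderiv ℝ g x (eb i) := rfl

lemma pd_comp_add (g : Eu d → ℝ) (v x : Eu d) (i : Fin d) :
    pd i (fun y => g (y + v)) x = pd i g (x + v) := by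
  rw [pd_def, pd_def, fderiv_comp_add_right]

lemma pd_sub {f g : Eu d → ℝ} (x : Eu d) (hf : DifferentiableAt ℝ f x)
    (hg : DifferentiableAt ℝ g x) (i : Fin d) :
    pd i (fun y => f y - g y) x = pd i f x - pd i g x := by
  rw [pd_def, pd_def, pd_def, fderiv_fun_sub hf hg]; rfl

lemma pd_mul {f g : Eu d → ℝ} (x : Eu d) (hf : DifferentiableAt ℝ f x)
    (hg : DifferentiableAt ℝ g x) (i : Fin d) :
    pd i (fun y => f y * g y) x = f x * pd i g x + g x * pd i f x := by
  rw [pd_def, pd_def, pd_def, fderiv_fun_mul hf hg]; rfl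

lemma pd_const_mul {g : Eu d → ℝ} (c : ℝ) (x : Eu d)
    (hg : DifferentiableAt ℝ g x) (i : Fin d) :
    pd i (fun y => c * g y) x = c * pd i g x := by
  rw [pd_def, pd_def, fderiv_const_mul hg]; rfl

lemma pd_sub_const (g : Eu d → ℝ) (c : ℝ) (x : Eu d) (i : Fin d) :
    pd i (fun y => g y - c) x = pd i g x := by
  rw [pd_def, pd_def, fderiv_sub_const]

lemma differentiableAt_of_cd {g : Eu d → ℝ} (h : ContDiff ℝ 1 g) (x : Eu d) :
    DifferentiableAt ℝ g x := (h.differentiable (by norm_num)) x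

lemma continuous_pd {g : Eu d → ℝ} (h : ContDiff ℝ 1 g) (i : Fin d) :
    Continuous (pd i g) := by
  have := h.continuous_fderiv (by norm_num)
  exact this.clm_apply continuous_const

lemma pd_compact {g : Eu d → ℝ} (h : HasCompactSupport g) (i : Fin d) :
    HasCompactSupport (pd i g) := h.fderiv_apply (𝕜 := ℝ) (eb i)

lemma pd_tsupport (g : Eu d → ℝ) (i : Fin d) : tsupport (pd i g) ⊆ tsupport g :=
  tsupport_fderiv_apply_subset ℝ (eb i)

lemma pd_zero_of_notMem {g : Eu d → ℝ} {i : Fin d} {x : Eu d} (h : x ∉ tsupport g) :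
    pd i g x = 0 := image_eq_zero_of_notMem_tsupport (fun h' => h (pd_tsupport g i h'))

lemma vec_eq_sum (v : Eu d) : v = ∑ i, v i • eb i := by
  ext j
  simp [eb, Finset.sum_apply, Pi.single_apply]

lemma fderiv_eq_sum (g : Eu d → ℝ) (x v : Eu d) :
    fderiv ℝ g x v = ∑ i, v i * pd i g x := by
  conv_lhs => rw [vec_eq_sum v]
  simp [pd_def]

lemma sq_fderiv_le (g : Eu d → ℝ) (x v : Eu d) :
    (fderiv ℝ g x v) ^ 2 ≤ ‖v‖ ^ 2 * ∑ i, pd i g x ^ 2 := by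
  rw [fderiv_eq_sum, EuclideanSpace.norm_sq_eq]
  have := Finset.sum_mul_sq_le_sq_mul_sq Finset.univ (fun i => v i) (fun i => pd i g x)
  simpa using this

lemma abs_coord_le (v : Eu d) (i : Fin d) : |v i| ≤ ‖v‖ := by
  have := PiLp.norm_apply_le v i
  simpa using this

/-- Divergence-free vector field, weak sense with `C^1` test functions. -/
def DivFree (V : Fin d → Eu d → ℝ) (Ω : Set (Eu d)) : Prop :=
  ∀ φ : Eu d → ℝ, ContDiff ℝ 1 φ → HasCompactSupport φ → tsupport φ ⊆ Ω →
    ∫ x, ∑ i, V i x * pd i φ x = 0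

/-- The flux `a ∇g - G`. -/
def flux (a : Fin d → Fin d → Eu d → ℝ) (g : Eu d → ℝ) (G : Fin d → Eu d → ℝ)
    (i : Fin d) (x : Eu d) : ℝ := ∑ j, a i j x * pd j g x - G i x

structure Coef (ν : ℝ) (a : Fin d → Fin d → Eu d → ℝ) : Prop where
  meas : ∀ i j, Measurable (a i j)
  ell : ∀ (x : Eu d) (ξ : Fin d → ℝ), ν * ∑ i, ξ i ^ 2 ≤ ∑ i, ∑ j, a i j x * ξ i * ξ j
  bdd : ∀ x : Eu d, ∑ i, ∑ j, a i j x ^ 2 ≤ ν⁻¹ ^ 2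

structure Sol (a : Fin d → Fin d → Eu d → ℝ) (g : Eu d → ℝ) (G : Fin d → Eu d → ℝ)
    (r : ℝ) : Prop where
  cd : ContDiff ℝ 1 g
  cs : HasCompactSupport g
  gm : ∀ i, MemLp (G i) 2 (volume : Measure (Eu d))
  df : DivFree (flux a g G) (ball 0 r)

/-- Dirichlet energy on a ball. -/
def EN (g : Eu d → ℝ) (r : ℝ) : ℝ := ∫ x in ball (0 : Eu d) r, ∑ i, pd i g x ^ 2

/-- Total `L^2` norm squared. -/
def GN (G : Fin d → Eu d → ℝ) : ℝ := ∫ x, ∑ i, G i x ^ 2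

/-- Undivided translation difference. -/
def df (v : Eu d) (g : Eu d → ℝ) (x : Eu d) : ℝ := g (x + v) - g x

lemma EN_nonneg (g : Eu d → ℝ) (r : ℝ) : 0 ≤ EN g r :=
  integral_nonneg fun _ => Finset.sum_nonneg fun _ _ => sq_nonneg _

lemma GN_nonneg (G : Fin d → Eu d → ℝ) : 0 ≤ GN G :=
  integral_nonneg fun _ => Finset.sum_nonneg fun _ _ => sq_nonneg _

lemma intB {f : Eu d → ℝ} (hf : Continuous f) (x : Eu d) (r : ℝ) : IntegrableOn f (ball x r) :=
  (hf.continuousOn.integrableOn_compact (isCompact_closedBall x r)).mono_set ball_subset_closedBall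

lemma EN_int {g : Eu d → ℝ} (h : ContDiff ℝ 1 g) (r : ℝ) :
    IntegrableOn (fun x => ∑ i, pd i g x ^ 2) (ball (0 : Eu d) r) :=
  intB (continuous_finsetSum _ fun i _ => (continuous_pd h i).pow 2) _ _

lemma EN_mono {g : Eu d → ℝ} (h : ContDiff ℝ 1 g) {r r' : ℝ} (hr : r ≤ r') : EN g r ≤ EN g r' :=
  setIntegral_mono_set (EN_int h r')
    (Eventually.of_forall fun _ => Finset.sum_nonneg fun _ _ => sq_nonneg _)
    (ball_subset_ball hr).eventuallyLE

lemma GN_int {G : Fin d → Eu d → ℝ} (h : ∀ i, MemLp (G i) 2 (volume : Measure (Eu d))) :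
    Integrable (fun x => ∑ i, G i x ^ 2) :=
  integrable_finsetSum _ fun i _ => (h i).integrable_sq

lemma memLp_pd {g : Eu d → ℝ} (h : ContDiff ℝ 1 g) (hc : HasCompactSupport g) (i : Fin d) :
    MemLp (pd i g) 2 (volume : Measure (Eu d)) :=
  (continuous_pd h i).memLp_of_hasCompactSupport (pd_compact hc i)

lemma df_cd {g : Eu d → ℝ} (h : ContDiff ℝ 1 g) (v : Eu d) : ContDiff ℝ 1 (df v g) :=
  (h.comp (contDiff_id.add contDiff_const)).sub h

lemma comp_add_cs {g : Eu d → ℝ} (h : HasCompactSupport g) (v : Eu d) :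
    HasCompactSupport (fun x => g (x + v)) :=
  h.comp_homeomorph (Homeomorph.addRight v)

lemma df_cs {g : Eu d → ℝ} (h : HasCompactSupport g) (v : Eu d) : HasCompactSupport (df v g) :=
  (comp_add_cs h v).sub h

lemma pd_df {g : Eu d → ℝ} (h : ContDiff ℝ 1 g) (v x : Eu d) (i : Fin d) :
    pd i (df v g) x = pd i g (x + v) - pd i g x := by
  have h1 : DifferentiableAt ℝ (fun y => g (y + v)) x :=
    differentiableAt_of_cd (h.comp (contDiff_id.add contDiff_const)) x
  have := pd_sub x h1 (differentiableAt_of_cd h x) i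
  rw [pd_comp_add] at this
  exact this

lemma memLp_shift {G : Eu d → ℝ} (h : MemLp G 2 (volume : Measure (Eu d))) (v : Eu d) :
    MemLp (fun x => G (x + v)) 2 (volume : Measure (Eu d)) :=
  h.comp_measurePreserving (measurePreserving_add_right volume v)

lemma coef_le {ν : ℝ} (hν : 0 < ν) {a : Fin d → Fin d → Eu d → ℝ} (ha : Coef ν a) (i j : Fin d)
    (x : Eu d) : |a i j x| ≤ ν⁻¹ := by
  apply abs_le_of_sq_le_sq _ (by positivity)
  refine le_trans ?_ (ha.bdd x)
  refine le_trans ?_ (Finset.single_le_sum (f := fun i => ∑ j, a i j x ^ 2)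
    (fun i _ => Finset.sum_nonneg fun _ _ => sq_nonneg _) (Finset.mem_univ i))
  exact Finset.single_le_sum (f := fun j => a i j x ^ 2)
    (fun i _ => sq_nonneg _) (Finset.mem_univ j)

lemma memLp_flux {ν : ℝ} (hν : 0 < ν) {a : Fin d → Fin d → Eu d → ℝ} (ha : Coef ν a)
    {g : Eu d → ℝ} {G : Fin d → Eu d → ℝ} {r : ℝ} (h : Sol a g G r) (i : Fin d) :
    MemLp (flux a g G i) 2 (volume : Measure (Eu d)) := by
  unfold flux
  refine MemLp.sub ?_ (h.gm i)
  refine memLp_finsetSum _ fun j _ => ?_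
  refine ((memLp_pd h.cd h.cs j).const_mul ν⁻¹).mono
    ((ha.meas i j).aestronglyMeasurable.mul (continuous_pd h.cd j).aestronglyMeasurable) ?_
  refine Eventually.of_forall fun x => ?_
  simp only [norm_mul, Real.norm_eq_abs]
  rw [abs_of_pos (by positivity : 0 < ν⁻¹)]
  exact mul_le_mul_of_nonneg_right (coef_le hν ha i j x) (abs_nonneg _)

end PSch

namespace PSch
variable {d : ℕ}

lemma jensen_sq {f : ℝ → ℝ} (hf : Continuous f) :
    (∫ t in (0:ℝ)..1, f t) ^ 2 ≤ ∫ t in (0:ℝ)..1, f t ^ 2 := by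
  set m := ∫ t in (0:ℝ)..1, f t with hm
  have h0 : 0 ≤ ∫ t in (0:ℝ)..1, (f t - m) ^ 2 :=
    intervalIntegral.integral_nonneg (by norm_num) fun _ _ => sq_nonneg _
  have h1 : ∫ t in (0:ℝ)..1, (f t - m) ^ 2
      = (∫ t in (0:ℝ)..1, f t ^ 2) - m ^ 2 := by
    have : ∀ t, (f t - m) ^ 2 = f t ^ 2 - (2 * m) * f t + m ^ 2 := fun t => by ring
    simp only [this]
    rw [intervalIntegral.integral_add, intervalIntegral.integral_sub,
      intervalIntegral.integral_const_mul, ← hm]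
    · simp; ring
    all_goals exact Continuous.intervalIntegrable (by fun_prop) _ _
  linarith

lemma L0 {K : Eu d → ℝ → ℝ} (hK : Continuous (Function.uncurry K)) {r M : ℝ}
    (h : ∀ t ∈ Icc (0:ℝ) 1, ∫ x in ball (0 : Eu d) r, K x t ^ 2 ≤ M) :
    ∫ x in ball (0 : Eu d) r, (∫ t in (0:ℝ)..1, K x t) ^ 2 ≤ M := by
  have hKx : ∀ x, Continuous (K x) := fun x => hK.comp (by fun_prop : Continuous fun t => (x, t))
  have hcont : Continuous fun x => ∫ t in (0:ℝ)..1, K x t :=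
    intervalIntegral.continuous_parametric_intervalIntegral_of_continuous' hK 0 1
  have hK2 : Continuous (Function.uncurry fun x t => K x t ^ 2) := by
    have : (Function.uncurry fun x t => K x t ^ 2) = fun z => (Function.uncurry K z) ^ 2 := by
      ext ⟨x, t⟩; rfl
    rw [this]; exact hK.pow 2
  have hcont2 : Continuous fun x => ∫ t in (0:ℝ)..1, K x t ^ 2 :=
    intervalIntegral.continuous_parametric_intervalIntegral_of_continuous' hK2 0 1
  have h1 : ∫ x in ball (0 : Eu d) r, (∫ t in (0:ℝ)..1, K x t) ^ 2
      ≤ ∫ x in ball (0 : Eu d) r, ∫ t in (0:ℝ)..1, K x t ^ 2 :=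
    integral_mono (intB (hcont.pow 2) _ _) (intB hcont2 _ _) fun x => jensen_sq (hKx x)
  refine h1.trans ?_
  simp only [intervalIntegral.integral_of_le (zero_le_one : (0:ℝ) ≤ 1)]
  have hint : Integrable (Function.uncurry fun x t => K x t ^ 2)
      ((volume.restrict (ball (0 : Eu d) r)).prod (volume.restrict (Ioc (0:ℝ) 1))) := by
    rw [Measure.prod_restrict]
    exact (hK2.continuousOn.integrableOn_compact
      ((isCompact_closedBall (0 : Eu d) r).prod (isCompact_Icc (a := (0:ℝ)) (b := 1)))).mono_set
      (prod_mono ball_subset_closedBall Ioc_subset_Icc_self)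
  rw [integral_integral_swap hint]
  have h2 : ∫ t in Ioc (0:ℝ) 1, ∫ x in ball (0 : Eu d) r, K x t ^ 2
      ≤ ∫ t in Ioc (0:ℝ) 1, M := by
    refine setIntegral_mono_on hint.swap.integral_prod_left (by simp) measurableSet_Ioc ?_
    intro t ht
    exact h t (Ioc_subset_Icc_self ht)
  refine h2.trans (by simp)

lemma ftc {g : Eu d → ℝ} (h : ContDiff ℝ 1 g) (x v : Eu d) :
    g (x + v) - g x = ∫ t in (0:ℝ)..1, fderiv ℝ g (x + t • v) v := by
  have h1 : ∀ t ∈ uIcc (0:ℝ) 1, HasDerivAt (fun t : ℝ => g (x + t • v))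
      (fderiv ℝ g (x + t • v) v) t := by
    intro t _
    have h2 : HasDerivAt (fun t : ℝ => x + t • v) v t := by
      simpa using ((hasDerivAt_id t).smul_const v).const_add x
    exact (differentiableAt_of_cd h (x + t • v)).hasFDerivAt.comp_hasDerivAt t h2
  have hc : Continuous fun t : ℝ => fderiv ℝ g (x + t • v) v :=
    ((h.continuous_fderiv (by norm_num)).comp (by fun_prop)).clm_apply continuous_const
  rw [intervalIntegral.integral_eq_sub_of_hasDerivAt h1 (hc.intervalIntegrable _ _)]
  simp

lemma shift_le {f : Eu d → ℝ} {r r' : ℝ} {v : Eu d} (hv : r + ‖v‖ ≤ r')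
    (hf : IntegrableOn f (ball 0 r')) (h0 : ∀ x, 0 ≤ f x) :
    ∫ x in ball (0 : Eu d) r, f (x + v) ≤ ∫ x in ball (0 : Eu d) r', f x := by
  have h1 : ∫ x in ball (0 : Eu d) r, f (x + v) = ∫ x in ball v r, f x := by
    have := (measurePreserving_add_right volume v).setIntegral_preimage_emb
      (measurableEmbedding_addRight v) f (ball v r)
    rw [← this]
    congr 2
    ext x; simp [dist_eq_norm]
  rw [h1]
  refine setIntegral_mono_set hf (Eventually.of_forall h0) (LE.le.eventuallyLE ?_)
  intro x hx
  simp only [mem_ball, dist_eq_norm, sub_zero] at hx ⊢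
  calc ‖x‖ = ‖(x - v) + v‖ := by simp
    _ ≤ ‖x - v‖ + ‖v‖ := norm_add_le _ _
    _ < r' := by linarith

lemma shift_int {f : Eu d → ℝ} {r r' : ℝ} {v : Eu d} (hv : r + ‖v‖ ≤ r')
    (hf : IntegrableOn f (ball 0 r')) :
    IntegrableOn (fun x => f (x + v)) (ball 0 r) := by
  have h2 : IntegrableOn f (ball v r) := by
    refine hf.mono_set ?_
    intro x hx
    simp only [mem_ball, dist_eq_norm, sub_zero] at hx ⊢
    calc ‖x‖ = ‖(x - v) + v‖ := by simp
      _ ≤ ‖x - v‖ + ‖v‖ := norm_add_le _ _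
      _ < r' := by linarith
  have := ((measurePreserving_add_right volume v).integrableOn_comp_preimage
      (measurableEmbedding_addRight v) (f := f) (s := ball v r)).2 h2
  have e : ball (0 : Eu d) r = (fun x => x + v) ⁻¹' ball v r := by
    ext x; simp [dist_eq_norm]
  rw [e]; exact this

lemma L1 {g : Eu d → ℝ} (h : ContDiff ℝ 1 g) (r : ℝ) (v : Eu d) :
    ∫ x in ball (0 : Eu d) r, (df v g x) ^ 2 ≤ ‖v‖ ^ 2 * EN g (r + ‖v‖) := by
  have hc := h.continuous_fderiv (by norm_num)
  simp only [df, ftc h]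
  refine L0 ?_ ?_
  · exact (hc.comp (by fun_prop : Continuous fun z : Eu d × ℝ => z.1 + z.2 • v)).clm_apply
      continuous_const
  · intro t ht
    have hn : ‖t • v‖ ≤ ‖v‖ := by
      rw [norm_smul, Real.norm_of_nonneg ht.1]
      exact mul_le_of_le_one_left (norm_nonneg _) ht.2
    calc ∫ x in ball (0 : Eu d) r, (fderiv ℝ g (x + t • v) v) ^ 2
        ≤ ∫ x in ball (0 : Eu d) r, ‖v‖ ^ 2 * ∑ i, pd i g (x + t • v) ^ 2 := by
          refine integral_mono (intB ?_ _ _) (intB ?_ _ _) fun x => sq_fderiv_le _ _ _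
          · exact ((hc.comp (by fun_prop)).clm_apply continuous_const).pow 2
          · exact continuous_const.mul (continuous_finsetSum _ fun i _ =>
              ((continuous_pd h i).comp (by fun_prop)).pow 2)
      _ = ‖v‖ ^ 2 * ∫ x in ball (0 : Eu d) r, ∑ i, pd i g (x + t • v) ^ 2 := by
          rw [integral_const_mul]
      _ ≤ ‖v‖ ^ 2 * EN g (r + ‖v‖) := by
          refine mul_le_mul_of_nonneg_left ?_ (sq_nonneg _)
          exact shift_le (f := fun x => ∑ i, pd i g x ^ 2) (by linarith) (EN_int h _)
            fun _ => Finset.sum_nonneg fun _ _ => sq_nonneg _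

lemma L1k {g : Eu d → ℝ} (h : ContDiff ℝ 1 g) (r s c : ℝ) (k : Fin d) :
    ∫ x in ball (0 : Eu d) r, (df (s • eb k) g x - s * c) ^ 2
      ≤ s ^ 2 * ∫ x in ball (0 : Eu d) (r + |s|), (pd k g x - c) ^ 2 := by
  have hc := continuous_pd h k
  have h1 : ∀ x, df (s • eb k) g x - s * c
      = ∫ t in (0:ℝ)..1, s * (pd k g (x + t • s • eb k) - c) := by
    intro x
    rw [df, ftc h, intervalIntegral.integral_const_mul, intervalIntegral.integral_sub]
    · simp [pd_def, mul_sub]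
    · exact Continuous.intervalIntegrable (hc.comp (by fun_prop)) _ _
    · simp
  simp only [h1]
  refine L0 ?_ ?_
  · exact continuous_const.mul ((hc.comp
      (by fun_prop : Continuous fun z : Eu d × ℝ => z.1 + z.2 • s • eb k)).sub continuous_const)
  · intro t ht
    have hn : ‖t • s • eb k‖ ≤ |s| := by
      rw [norm_smul, Real.norm_of_nonneg ht.1, norm_smul, norm_eb, mul_one, Real.norm_eq_abs]
      exact mul_le_of_le_one_left (abs_nonneg _) ht.2
    simp only [mul_pow]
    rw [integral_const_mul]
    refine mul_le_mul_of_nonneg_left ?_ (sq_nonneg _)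
    exact shift_le (f := fun x => (pd k g x - c) ^ 2) (by linarith)
      (intB ((hc.sub continuous_const).pow 2) _ _) fun _ => sq_nonneg _

lemma L1d {g : Eu d → ℝ} (h : ContDiff ℝ 1 g) {r s M : ℝ} (hs : 0 ≤ s) (i : Fin d)
    (hM : ∀ t ∈ Icc (0:ℝ) s, ∫ x in ball (0 : Eu d) r, (pd i (df (t • eb i) g) x) ^ 2 ≤ M) :
    ∫ x in ball (0 : Eu d) r, (df (s • eb i) g x - s * pd i g x) ^ 2 ≤ s ^ 2 * M := by
  have hc := continuous_pd h i
  have h1 : ∀ x, df (s • eb i) g x - s * pd i g x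
      = ∫ t in (0:ℝ)..1, s * (pd i g (x + t • s • eb i) - pd i g x) := by
    intro x
    rw [df, ftc h, intervalIntegral.integral_const_mul, intervalIntegral.integral_sub]
    · simp [pd_def, mul_sub]
    · exact Continuous.intervalIntegrable (hc.comp (by fun_prop)) _ _
    · simp
  simp only [h1]
  refine L0 ?_ ?_
  · exact continuous_const.mul ((hc.comp
      (by fun_prop : Continuous fun z : Eu d × ℝ => z.1 + z.2 • s • eb i)).sub
      (hc.comp continuous_fst))
  · intro t ht
    simp only [mul_pow]
    rw [integral_const_mul]
    refine mul_le_mul_of_nonneg_left ?_ (sq_nonneg _)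
    have := hM (t * s) ⟨mul_nonneg ht.1 hs, mul_le_of_le_one_left hs ht.2⟩
    simpa only [pd_df h, mul_smul] using this

end PSch

namespace PSch
variable {d : ℕ}

lemma bump {r r' : ℝ} (hr : 0 < r) (hrr : r < r') : ∃ ζ : Eu d → ℝ,
    ContDiff ℝ (⊤ : ℕ∞) ζ ∧ HasCompactSupport ζ ∧ tsupport ζ ⊆ ball 0 r' ∧
    (∀ x ∈ ball (0 : Eu d) r, ζ x = 1) ∧ (∀ x, 0 ≤ ζ x) ∧ ∀ x, ζ x ≤ 1 := by
  let b : ContDiffBump (0 : Eu d) := ⟨r, (r + r') / 2, hr, by linarith⟩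
  refine ⟨b, b.contDiff, b.hasCompactSupport, ?_, ?_, fun x => b.nonneg, fun x => b.le_one⟩
  · rw [b.tsupport_eq]
    exact closedBall_subset_ball (by show (r + r') / 2 < r'; linarith)
  · intro x hx
    exact b.one_of_mem_closedBall (ball_subset_closedBall hx)

lemma sum_b_le {ν : ℝ} {a : Fin d → Fin d → Eu d → ℝ} (ha : Coef ν a) (x : Eu d)
    (ξ : Fin d → ℝ) : ∑ i, (∑ j, a i j x * ξ j) ^ 2 ≤ ν⁻¹ ^ 2 * ∑ j, ξ j ^ 2 := by
  calc ∑ i, (∑ j, a i j x * ξ j) ^ 2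
      ≤ ∑ i, (∑ j, a i j x ^ 2) * ∑ j, ξ j ^ 2 :=
        Finset.sum_le_sum fun i _ => Finset.sum_mul_sq_le_sq_mul_sq _ _ _
    _ = (∑ i, ∑ j, a i j x ^ 2) * ∑ j, ξ j ^ 2 := by rw [Finset.sum_mul]
    _ ≤ _ := mul_le_mul_of_nonneg_right (ha.bdd x) (Finset.sum_nonneg fun _ _ => sq_nonneg _)

lemma cacc_pt {ν : ℝ} (hν : 0 < ν) {a : Fin d → Fin d → Eu d → ℝ} (ha : Coef ν a) (x : Eu d)
    (ξ G z : Fin d → ℝ) (ζ m : ℝ) :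
    ν / 2 * (ζ ^ 2 * ∑ i, ξ i ^ 2) - (ν⁻¹ + 1) * (ζ ^ 2 * ∑ i, G i ^ 2)
      - (4 / ν ^ 3 + 1) * (m ^ 2 * ∑ i, z i ^ 2) ≤
    ∑ i, (∑ j, a i j x * ξ j - G i) * (ζ ^ 2 * ξ i + m * (2 * ζ * z i)) := by
  set b : Fin d → ℝ := fun i => ∑ j, a i j x * ξ j with hb
  have h1 : ν * ∑ i, ξ i ^ 2 ≤ ∑ i, b i * ξ i := by
    refine (ha.ell x ξ).trans (le_of_eq ?_)
    refine Finset.sum_congr rfl fun i _ => ?_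
    rw [hb, Finset.sum_mul]
    exact Finset.sum_congr rfl fun j _ => by ring
  have h2 := sum_b_le ha x ξ
  have h3 : ∀ i, ζ ^ 2 * (b i * ξ i) - (ν / 4 * ζ ^ 2 * ξ i ^ 2 + (ν⁻¹ + 1) * ζ ^ 2 * G i ^ 2)
      - (ν ^ 3 / 4 * ζ ^ 2 * b i ^ 2 + (4 / ν ^ 3 + 1) * m ^ 2 * z i ^ 2)
      ≤ (b i - G i) * (ζ ^ 2 * ξ i + m * (2 * ζ * z i)) := by
    intro i
    have e1 : 0 ≤ ν / 4 * ζ ^ 2 * ξ i ^ 2 + ν⁻¹ * ζ ^ 2 * G i ^ 2 - ζ ^ 2 * (G i * ξ i) := by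
      have : ν / 4 * ζ ^ 2 * ξ i ^ 2 + ν⁻¹ * ζ ^ 2 * G i ^ 2 - ζ ^ 2 * (G i * ξ i)
        = ν⁻¹ * (ν / 2 * ζ * ξ i - ζ * G i) ^ 2 := by field_simp; ring
      rw [this]; positivity
    have e2 : 0 ≤ ν ^ 3 / 4 * ζ ^ 2 * b i ^ 2 + 4 / ν ^ 3 * m ^ 2 * z i ^ 2
        + b i * (m * (2 * ζ * z i)) := by
      have : ν ^ 3 / 4 * ζ ^ 2 * b i ^ 2 + 4 / ν ^ 3 * m ^ 2 * z i ^ 2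
        + b i * (m * (2 * ζ * z i)) = 4 / ν ^ 3 * (ν ^ 3 / 4 * ζ * b i + m * z i) ^ 2 := by
        field_simp; ring
      rw [this]; positivity
    have e3 : 0 ≤ (ζ * G i - m * z i) ^ 2 := sq_nonneg _
    nlinarith
  have h4 := Finset.sum_le_sum fun i (_ : i ∈ Finset.univ) => h3 i
  simp only [Finset.sum_sub_distrib, Finset.sum_add_distrib, ← Finset.mul_sum] at h4
  refine le_trans ?_ h4
  have h5 : ν ^ 3 / 4 * ζ ^ 2 * ∑ i, b i ^ 2 ≤ ν ^ 3 / 4 * ζ ^ 2 * (ν⁻¹ ^ 2 * ∑ j, ξ j ^ 2) :=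
    mul_le_mul_of_nonneg_left h2 (by positivity)
  have h6 : ν ^ 3 / 4 * ζ ^ 2 * (ν⁻¹ ^ 2 * ∑ j, ξ j ^ 2) = ν / 4 * ζ ^ 2 * ∑ j, ξ j ^ 2 := by
    field_simp
  have h7 := mul_le_mul_of_nonneg_left h1 (sq_nonneg ζ)
  nlinarith

lemma integrable_VD {V : Fin d → Eu d → ℝ} (hV : ∀ i, MemLp (V i) 2 (volume : Measure (Eu d)))
    {φ : Eu d → ℝ} (h : ContDiff ℝ 1 φ) (hc : HasCompactSupport φ) :
    Integrable fun x => ∑ i, V i x * pd i φ x :=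
  integrable_finsetSum _ fun i _ => (hV i).integrable_mul (memLp_pd h hc i)

lemma bound_cs {f : Eu d → ℝ} (hf : Continuous f) (hc : HasCompactSupport f) :
    ∃ L, 0 < L ∧ ∀ x, |f x| ≤ L := by
  obtain ⟨C, hC⟩ := hf.bounded_above_of_compact_support hc
  exact ⟨|C| + 1, by positivity, fun x => (hC x).trans ((le_abs_self C).trans (by linarith))⟩

lemma cacc {ν : ℝ} (hν : 0 < ν) {r r' : ℝ} (hr : 0 < r) (hrr : r < r') :
    ∃ C, 0 < C ∧ ∀ a : Fin d → Fin d → Eu d → ℝ, Coef ν a → ∀ g G, Sol a g G r' → ∀ c : ℝ,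
      EN g r ≤ C * ((∫ x in ball (0 : Eu d) r', (g x - c) ^ 2) + GN G) := by
  obtain ⟨ζ, hζ, hζc, hζs, hζ1, hζ0, hζl⟩ := bump (d := d) hr hrr
  have hζ' : ContDiff ℝ 1 ζ := hζ.of_le (by exact_mod_cast le_top)
  obtain ⟨L, hL0, hL⟩ : ∃ L, 0 < L ∧ ∀ x, |∑ i, pd i ζ x ^ 2| ≤ L := by
    refine bound_cs (continuous_finsetSum _ fun i _ => (continuous_pd hζ' i).pow 2) ?_
    refine HasCompactSupport.intro hζc fun x hx => ?_
    simp [pd_zero_of_notMem hx]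
  set C1 := ν⁻¹ + 1
  set C2 := 4 / ν ^ 3 + 1
  have hC1 : 0 < C1 := by positivity
  have hC2 : 0 < C2 := by positivity
  refine ⟨2 / ν * (C1 + C2 * L), by positivity, ?_⟩
  intro a ha g G hS c
  set φ : Eu d → ℝ := fun y => ζ y * ζ y * (g y - c)
  have hgc : ContDiff ℝ 1 (fun y => g y - c) := hS.cd.sub contDiff_const
  have hφ : ContDiff ℝ 1 φ := (hζ'.mul hζ').mul hgc
  have hφt : tsupport φ ⊆ tsupport ζ := by
    refine closure_mono fun x hx => ?_
    simp only [Function.mem_support, φ] at hx ⊢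
    intro h; simp [h] at hx
  have hφc : HasCompactSupport φ := hζc.of_isClosed_subset (isClosed_tsupport _) hφt
  have hD := hS.df φ hφ hφc (hφt.trans hζs)
  have hpd : ∀ i x, pd i φ x = ζ x ^ 2 * pd i g x + (g x - c) * (2 * ζ x * pd i ζ x) := by
    intro i x
    have := pd_mul x (differentiableAt_of_cd (hζ'.mul hζ') x) (differentiableAt_of_cd hgc x) i
    rw [pd_sub_const, pd_mul x (differentiableAt_of_cd hζ' x) (differentiableAt_of_cd hζ' x)]
      at this
    rw [this]; ring
  have hVi := integrable_VD (memLp_flux hν ha hS) hφ hφc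
  have hQ := GN_int hS.gm
  have hm : Integrable ((ball (0 : Eu d) r').indicator fun x => (g x - c) ^ 2) :=
    (intB (hgc.continuous.pow 2) 0 r').integrable_indicator measurableSet_ball
  have hP : Integrable ((ball (0 : Eu d) r).indicator fun x => ∑ i, pd i g x ^ 2) :=
    (EN_int hS.cd r).integrable_indicator measurableSet_ball
  have key : ∫ x, ν / 2 * (ball (0 : Eu d) r).indicator (fun x => ∑ i, pd i g x ^ 2) x ≤
      ∫ x, ((∑ i, flux a g G i x * pd i φ x) + (C1 * ∑ i, G i x ^ 2 +
        C2 * L * (ball (0 : Eu d) r').indicator (fun x => (g x - c) ^ 2) x)) := by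
    refine integral_mono (hP.const_mul _) (hVi.add ((hQ.const_mul _).add (hm.const_mul _))) ?_
    intro x
    have hp := cacc_pt hν ha x (fun i => pd i g x) (fun i => G i x) (fun i => pd i ζ x) (ζ x)
      (g x - c)
    have e : ∑ i, flux a g G i x * pd i φ x = ∑ i, (∑ j, a i j x * pd j g x - G i x) *
        (ζ x ^ 2 * pd i g x + (g x - c) * (2 * ζ x * pd i ζ x)) :=
      Finset.sum_congr rfl fun i _ => by rw [hpd]; rfl
    show ν / 2 * _ ≤ (∑ i, flux a g G i x * pd i φ x) + (C1 * ∑ i, G i x ^ 2 +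
        C2 * L * (ball (0 : Eu d) r').indicator (fun x => (g x - c) ^ 2) x)
    rw [e]
    set R := ∑ i, (∑ j, a i j x * pd j g x - G i x) *
        (ζ x ^ 2 * pd i g x + (g x - c) * (2 * ζ x * pd i ζ x))
    set P := ∑ i, pd i g x ^ 2
    set Q := ∑ i, G i x ^ 2
    have hP0 : 0 ≤ P := Finset.sum_nonneg fun _ _ => sq_nonneg _
    have hQ0 : 0 ≤ Q := Finset.sum_nonneg fun _ _ => sq_nonneg _
    have i1 : (ball (0 : Eu d) r).indicator (fun x => ∑ i, pd i g x ^ 2) x ≤ ζ x ^ 2 * P := by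
      by_cases hx : x ∈ ball (0 : Eu d) r
      · rw [indicator_of_mem hx, hζ1 x hx]; simp [P]
      · rw [indicator_of_notMem hx]; positivity
    have i2 : ζ x ^ 2 * Q ≤ Q :=
      mul_le_of_le_one_left hQ0 (pow_le_one₀ (hζ0 x) (hζl x))
    have i3 : (g x - c) ^ 2 * ∑ i, pd i ζ x ^ 2 ≤
        L * (ball (0 : Eu d) r').indicator (fun x => (g x - c) ^ 2) x := by
      by_cases hx : x ∈ ball (0 : Eu d) r'
      · rw [indicator_of_mem hx, mul_comm]
        exact mul_le_mul_of_nonneg_right ((le_abs_self _).trans (hL x)) (sq_nonneg _)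
      · rw [indicator_of_notMem hx]
        have : ∀ i, pd i ζ x = 0 := fun i => pd_zero_of_notMem fun h => hx (hζs h)
        simp [this]
    have j1 := mul_le_mul_of_nonneg_left i1 (by positivity : 0 ≤ ν / 2)
    have j2 := mul_le_mul_of_nonneg_left i2 hC1.le
    have j3 := mul_le_mul_of_nonneg_left i3 hC2.le
    simp only [C1, C2] at *
    linarith
  have hadd : Integrable fun x => C1 * ∑ i, G i x ^ 2 +
        C2 * L * (ball (0 : Eu d) r').indicator (fun x => (g x - c) ^ 2) x :=
    (hQ.const_mul _).add (hm.const_mul _)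
  rw [integral_const_mul, integral_indicator measurableSet_ball, integral_add hVi hadd, hD, integral_add (hQ.const_mul _) (hm.const_mul _),
    integral_const_mul, integral_const_mul, integral_indicator measurableSet_ball] at key
  change ν / 2 * EN g r ≤ 0 + (C1 * GN G + _) at key
  have hm0 : 0 ≤ ∫ x in ball (0 : Eu d) r', (g x - c) ^ 2 := integral_nonneg fun _ => sq_nonneg _
  have hG0 := GN_nonneg G
  set I := ∫ x in ball (0 : Eu d) r', (g x - c) ^ 2
  have : ν / 2 * EN g r ≤ (C1 + C2 * L) * (I + GN G) := by
    have : 0 ≤ C1 * I := by positivity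
    have : 0 ≤ C2 * L * GN G := by positivity
    nlinarith
  calc EN g r = 2 / ν * (ν / 2 * EN g r) := by field_simp
    _ ≤ 2 / ν * ((C1 + C2 * L) * (I + GN G)) := mul_le_mul_of_nonneg_left this (by positivity)
    _ = _ := by ring

end PSch

namespace PSch
variable {d : ℕ}

/-- Coefficients depending only on the `l`-th coordinate. -/
def Inv (l : Fin d) (A : Fin d → Fin d → Eu d → ℝ) : Prop :=
  ∀ i j (x y : Eu d), x l = y l → A i j x = A i j y

lemma tsupport_shift (φ : Eu d → ℝ) (v : Eu d) {r r' : ℝ} (hv : r + ‖v‖ ≤ r')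
    (h : tsupport φ ⊆ ball 0 r) : tsupport (fun x => φ (x + v)) ⊆ ball 0 r' := by
  intro x hx
  have e : tsupport (fun x => φ (x + v)) = (fun x => x + v) ⁻¹' tsupport φ :=
    tsupport_comp_eq_preimage φ (Homeomorph.addRight v)
  rw [e] at hx
  have := h hx
  simp only [mem_ball, dist_eq_norm, sub_zero] at this ⊢
  calc ‖x‖ = ‖(x + v) - v‖ := by simp
    _ ≤ ‖x + v‖ + ‖v‖ := norm_sub_le _ _
    _ < r' := by linarith

lemma divFree_shift {V : Fin d → Eu d → ℝ} {r r' : ℝ} (h : DivFree V (ball 0 r')) {v : Eu d}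
    (hv : r + ‖v‖ ≤ r') : DivFree (fun i x => V i (x + v)) (ball 0 r) := by
  intro φ hφ hc hs
  have h1 := h (fun x => φ (x + (-v))) (hφ.comp (contDiff_id.add contDiff_const))
    (comp_add_cs hc (-v)) (tsupport_shift φ (-v) (by rw [norm_neg]; exact hv) hs)
  rw [← integral_add_right_eq_self _ v] at h1
  simpa only [pd_comp_add, add_neg_cancel_right] using h1

lemma divFree_mono {V : Fin d → Eu d → ℝ} {s t : Set (Eu d)} (h : DivFree V t) (hst : s ⊆ t) :
    DivFree V s := fun φ h1 h2 h3 => h φ h1 h2 (h3.trans hst)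

lemma divFree_sub {V W : Fin d → Eu d → ℝ} {s : Set (Eu d)}
    (hV : ∀ i, MemLp (V i) 2 (volume : Measure (Eu d)))
    (hW : ∀ i, MemLp (W i) 2 (volume : Measure (Eu d)))
    (h1 : DivFree V s) (h2 : DivFree W s) : DivFree (fun i x => V i x - W i x) s := by
  intro φ hφ hc hs
  simp only [sub_mul, Finset.sum_sub_distrib]
  rw [integral_sub (integrable_VD hV hφ hc) (integrable_VD hW hφ hc), h1 φ hφ hc hs,
    h2 φ hφ hc hs, sub_zero]

lemma Sol.mono {a : Fin d → Fin d → Eu d → ℝ} {g G} {r r' : ℝ} (h : Sol a g G r') (hr : r ≤ r') :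
    Sol a g G r := ⟨h.cd, h.cs, h.gm, divFree_mono h.df (ball_subset_ball hr)⟩

lemma flux_df {l : Fin d} {A : Fin d → Fin d → Eu d → ℝ} (hI : Inv l A) {g : Eu d → ℝ}
    (G : Fin d → Eu d → ℝ) (hg : ContDiff ℝ 1 g) {v : Eu d} (hv : v l = 0) (i : Fin d) (x : Eu d) :
    flux A (df v g) (fun i => df v (G i)) i x = df v (flux A g G i) x := by
  have e : ∀ i j, A i j (x + v) = A i j x := fun i j => hI i j _ _ (by simp [hv])
  simp only [flux, df, e]
  have : ∀ j, pd j (df v g) x = pd j g (x + v) - pd j g x := pd_df hg v x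
  change ∑ j, A i j x * pd j (df v g) x - (G i (x + v) - G i x) = _
  simp only [this, mul_sub, Finset.sum_sub_distrib]
  ring

lemma memLp_df {F : Eu d → ℝ} (h : MemLp F 2 (volume : Measure (Eu d))) (v : Eu d) :
    MemLp (df v F) 2 (volume : Measure (Eu d)) := (memLp_shift h v).sub h

lemma Sol.df' {ν : ℝ} (hν : 0 < ν) {l : Fin d} {A : Fin d → Fin d → Eu d → ℝ} (hA : Coef ν A)
    (hI : Inv l A) {g : Eu d → ℝ} {G : Fin d → Eu d → ℝ} {r r' : ℝ} (hS : Sol A g G r')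
    {v : Eu d} (hv : v l = 0) (hr : r + ‖v‖ ≤ r') :
    Sol A (PSch.df v g) (fun i => PSch.df v (G i)) r where
  cd := df_cd hS.cd v
  cs := df_cs hS.cs v
  gm := fun i => memLp_df (hS.gm i) v
  df := by
    have e : flux A (PSch.df v g) (fun i => PSch.df v (G i))
        = fun i x => flux A g G i (x + v) - flux A g G i x := by
      ext i x; exact flux_df hI G hS.cd hv i x
    rw [e]
    have hm := memLp_flux hν hA hS
    refine divFree_sub (fun i => memLp_shift (hm i) v) hm (divFree_shift hS.df hr)
      (divFree_mono hS.df (ball_subset_ball (by linarith [norm_nonneg v])))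

lemma GN_df {G : Fin d → Eu d → ℝ} (h : ∀ i, MemLp (G i) 2 (volume : Measure (Eu d))) (v : Eu d) :
    GN (fun i => df v (G i)) ≤ 4 * GN G := by
  have hi := GN_int h
  have hi2 : Integrable fun x => ∑ i, G i (x + v) ^ 2 :=
    integrable_finsetSum _ fun i _ => (memLp_shift (h i) v).integrable_sq
  have e : GN (fun i => df v (G i)) ≤ ∫ x, (2 * ∑ i, G i (x + v) ^ 2 + 2 * ∑ i, G i x ^ 2) := by
    refine integral_mono (GN_int fun i => memLp_df (h i) v)
      ((hi2.const_mul 2).add (hi.const_mul 2)) fun x => ?_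
    show ∑ i, (df v (G i) x) ^ 2 ≤ 2 * ∑ i, G i (x + v) ^ 2 + 2 * ∑ i, G i x ^ 2
    rw [Finset.mul_sum, Finset.mul_sum, ← Finset.sum_add_distrib]
    refine Finset.sum_le_sum fun i _ => ?_
    simp only [df]
    nlinarith [sq_nonneg (G i (x + v) + G i x)]
  rw [integral_add (hi2.const_mul 2) (hi.const_mul 2), integral_const_mul, integral_const_mul,
    integral_add_right_eq_self (fun x => ∑ i, G i x ^ 2) v] at e
  change _ ≤ 2 * GN G + 2 * GN G at e
  linarith

lemma den {ν : ℝ} (hν : 0 < ν) (l : Fin d) {r r' : ℝ} (hr : 0 < r) (hrr : r < r') :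
    ∃ C, 0 < C ∧ ∀ A : Fin d → Fin d → Eu d → ℝ, Coef ν A → Inv l A → ∀ g G, Sol A g G r' →
      ∀ v : Eu d, v l = 0 → ‖v‖ ≤ (r' - r) / 2 →
      EN (df v g) r ≤ C * (‖v‖ ^ 2 * EN g r' + GN G) := by
  obtain ⟨C, hC, h⟩ := cacc (d := d) hν hr (show r < (r + r') / 2 by linarith)
  refine ⟨4 * C, by positivity, ?_⟩
  intro A hA hI g G hS v hv hvn
  have h1 := h A hA _ _ (hS.df' hν hA hI hv (by linarith : (r + r') / 2 + ‖v‖ ≤ r')) 0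
  simp only [sub_zero] at h1
  have h2 := L1 hS.cd ((r + r') / 2) v
  have h3 := GN_df hS.gm v
  have h4 := mul_le_mul_of_nonneg_left
    (EN_mono hS.cd (by linarith : (r + r') / 2 + ‖v‖ ≤ r')) (sq_nonneg ‖v‖)
  have h5 : 0 ≤ ‖v‖ ^ 2 * EN g r' := mul_nonneg (sq_nonneg _) (EN_nonneg _ _)
  calc _ ≤ _ := h1
    _ ≤ C * (‖v‖ ^ 2 * EN g r' + 4 * GN G) := by gcongr; linarith
    _ ≤ _ := by nlinarith

lemma flux_sq_le {ν : ℝ} {a : Fin d → Fin d → Eu d → ℝ} (ha : Coef ν a) (g : Eu d → ℝ)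
    (G : Fin d → Eu d → ℝ) (i : Fin d) (x : Eu d) :
    (flux a g G i x) ^ 2 ≤ 2 * ν⁻¹ ^ 2 * ∑ i, pd i g x ^ 2 + 2 * ∑ i, G i x ^ 2 := by
  have h1 := sum_b_le ha x (fun j => pd j g x)
  have h2 : (∑ j, a i j x * pd j g x) ^ 2 ≤ ∑ i, (∑ j, a i j x * pd j g x) ^ 2 :=
    Finset.single_le_sum (f := fun i => (∑ j, a i j x * pd j g x) ^ 2)
      (fun _ _ => sq_nonneg _) (Finset.mem_univ i)
  have h3 : G i x ^ 2 ≤ ∑ i, G i x ^ 2 :=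
    Finset.single_le_sum (f := fun i => G i x ^ 2) (fun _ _ => sq_nonneg _) (Finset.mem_univ i)
  unfold flux
  nlinarith [sq_nonneg (∑ j, a i j x * pd j g x + G i x)]

lemma setInt_le_GN {G : Fin d → Eu d → ℝ} (h : ∀ i, MemLp (G i) 2 (volume : Measure (Eu d)))
    (s : Set (Eu d)) : ∫ x in s, ∑ i, G i x ^ 2 ≤ GN G :=
  setIntegral_le_integral (GN_int h)
    (Eventually.of_forall fun _ => Finset.sum_nonneg fun _ _ => sq_nonneg _)

lemma flux_l2 {ν : ℝ} (hν : 0 < ν) {a : Fin d → Fin d → Eu d → ℝ} (ha : Coef ν a) {g : Eu d → ℝ}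
    {G : Fin d → Eu d → ℝ} {r' : ℝ} (hS : Sol a g G r') (r : ℝ) (i : Fin d) :
    ∫ x in ball (0 : Eu d) r, (flux a g G i x) ^ 2 ≤ 2 * ν⁻¹ ^ 2 * EN g r + 2 * GN G := by
  have h1 := EN_int hS.cd r
  have h2 := (GN_int hS.gm).integrableOn (s := ball 0 r)
  calc ∫ x in ball (0 : Eu d) r, (flux a g G i x) ^ 2
      ≤ ∫ x in ball (0 : Eu d) r, (2 * ν⁻¹ ^ 2 * ∑ i, pd i g x ^ 2 + 2 * ∑ i, G i x ^ 2) := by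
        refine integral_mono ((memLp_flux hν ha hS i).integrable_sq.integrableOn)
          ((h1.const_mul _).add (h2.const_mul _)) fun x => flux_sq_le ha g G i x
    _ = 2 * ν⁻¹ ^ 2 * EN g r + 2 * ∫ x in ball (0 : Eu d) r, ∑ i, G i x ^ 2 := by
        rw [integral_add (h1.const_mul _) (h2.const_mul _), integral_const_mul, integral_const_mul]
        rfl
    _ ≤ _ := by linarith [setInt_le_GN hS.gm (ball 0 r)]

lemma flux_df_l2 {ν : ℝ} (hν : 0 < ν) (l : Fin d) {r r' : ℝ} (hr : 0 < r) (hrr : r < r') :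
    ∃ C, 0 < C ∧ ∀ A : Fin d → Fin d → Eu d → ℝ, Coef ν A → Inv l A → ∀ g G, Sol A g G r' →
      ∀ v : Eu d, v l = 0 → ‖v‖ ≤ (r' - r) / 2 → ∀ i,
      ∫ x in ball (0 : Eu d) r, (df v (flux A g G i) x) ^ 2 ≤ C * (‖v‖ ^ 2 * EN g r' + GN G) := by
  obtain ⟨C, hC, h⟩ := den hν l hr hrr
  refine ⟨2 * ν⁻¹ ^ 2 * C + 8, by positivity, ?_⟩
  intro A hA hI g G hS v hv hvn i
  have h0 := h A hA hI g G hS v hv hvn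
  have h1 := flux_l2 hν hA (hS.df' hν hA hI hv (by linarith : r + ‖v‖ ≤ r')) r i
  simp only [flux_df hI G hS.cd hv] at h1
  have h3 := GN_df hS.gm v
  have h4 := mul_le_mul_of_nonneg_left h0 (by positivity : 0 ≤ 2 * ν⁻¹ ^ 2)
  have h5 : 0 ≤ ‖v‖ ^ 2 * EN g r' := mul_nonneg (sq_nonneg _) (EN_nonneg _ _)
  nlinarith

end PSch

namespace PSch
variable {d : ℕ}

lemma cs {α : Type*} [MeasurableSpace α] {μ : Measure α} {f g : α → ℝ} (hf : MemLp f 2 μ)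
    (hg : MemLp g 2 μ) : (∫ x, f x * g x ∂μ) ^ 2 ≤ (∫ x, f x ^ 2 ∂μ) * ∫ x, g x ^ 2 ∂μ := by
  have h : ∀ t : ℝ, 0 ≤ (∫ x, f x ^ 2 ∂μ) * (t * t) + (2 * ∫ x, f x * g x ∂μ) * t
      + ∫ x, g x ^ 2 ∂μ := by
    intro t
    have e : ∫ x, (t * f x + g x) ^ 2 ∂μ = (∫ x, f x ^ 2 ∂μ) * (t * t)
        + (2 * ∫ x, f x * g x ∂μ) * t + ∫ x, g x ^ 2 ∂μ := by
      have e1 : ∀ x, (t * f x + g x) ^ 2 = t * t * f x ^ 2 + 2 * t * (f x * g x) + g x ^ 2 :=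
        fun x => by ring
      simp only [e1]
      have i1 := hf.integrable_sq.const_mul (t * t)
      have i2 : Integrable (fun x => 2 * t * (f x * g x)) μ := (hf.integrable_mul hg).const_mul _
      have i3 := hg.integrable_sq
      have i12 : Integrable (fun x => t * t * f x ^ 2 + 2 * t * (f x * g x)) μ := i1.add i2
      rw [integral_add i12 i3, integral_add i1 i2, integral_const_mul, integral_const_mul]
      ring
    rw [← e]; exact integral_nonneg fun _ => sq_nonneg _
  have := discrim_le_zero h
  unfold discrim at this
  nlinarith

lemma cs_abs {α : Type*} [MeasurableSpace α] {μ : Measure α} {f g : α → ℝ} (hf : MemLp f 2 μ)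
    (hg : MemLp g 2 μ) {K L : ℝ} (hK : 0 ≤ K) (hL : 0 ≤ L) (h1 : ∫ x, f x ^ 2 ∂μ ≤ K ^ 2)
    (h2 : ∫ x, g x ^ 2 ∂μ ≤ L ^ 2) : |∫ x, f x * g x ∂μ| ≤ K * L := by
  apply abs_le_of_sq_le_sq _ (by positivity)
  refine (cs hf hg).trans ?_
  rw [mul_pow]
  exact mul_le_mul h1 h2 (integral_nonneg fun _ => sq_nonneg _) (by positivity)

/-- Duality. -/
lemma duality {W : Eu d → ℝ} (hW : MemLp W 2 (volume : Measure (Eu d))) {r r1 K : ℝ} (hr1 : 0 < r1)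
    (hr : r1 < r) (hK : 0 ≤ K)
    (h : ∀ ψ : Eu d → ℝ, ContDiff ℝ 1 ψ → HasCompactSupport ψ → tsupport ψ ⊆ ball 0 r →
      |∫ x, W x * ψ x| ≤ K * √(∫ x, ψ x ^ 2)) :
    ∫ x in ball (0 : Eu d) r1, W x ^ 2 ≤ K ^ 2 := by
  obtain ⟨ζ, hζ, hζc, hζs, hζ1, hζ0, hζl⟩ := bump (d := d) hr1 hr
  have hζ' : ContDiff ℝ 1 ζ := hζ.of_le (by exact_mod_cast le_top)
  set w : Eu d → ℝ := (ball (0 : Eu d) r1).indicator W with hw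
  have hwm : MemLp w 2 volume := hW.indicator measurableSet_ball
  have hww : ∫ x, w x ^ 2 = ∫ x in ball (0 : Eu d) r1, W x ^ 2 := by
    rw [← integral_indicator measurableSet_ball]
    congr 1; ext x
    by_cases hx : x ∈ ball (0 : Eu d) r1 <;> simp [hw, hx]
  rw [← hww]
  set n := √(∫ x, w x ^ 2) with hn
  have hn2 : n ^ 2 = ∫ x, w x ^ 2 := Real.sq_sqrt (integral_nonneg fun _ => sq_nonneg _)
  set m := √(∫ x, W x ^ 2) with hm
  have hm2 : m ^ 2 = ∫ x, W x ^ 2 := Real.sq_sqrt (integral_nonneg fun _ => sq_nonneg _)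
  have hn0 : 0 ≤ n := Real.sqrt_nonneg _
  have hm0 : 0 ≤ m := Real.sqrt_nonneg _
  have main : ∀ ε > 0, n ^ 2 ≤ K * n + ε * (K + m) := by
    intro ε hε
    obtain ⟨ψ, hψc, hψ, hψe⟩ := hwm.exist_eLpNorm_sub_le (by norm_num) (by norm_num) hε
    have hψ' : ContDiff ℝ 1 ψ := hψ.of_le (by exact_mod_cast le_top)
    have hψm : MemLp ψ 2 volume := hψ'.continuous.memLp_of_hasCompactSupport hψc
    have hd : MemLp (fun x => w x - ψ x) 2 volume := hwm.sub hψm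
    have hd2 : ∫ x, (w x - ψ x) ^ 2 ≤ ε ^ 2 := by
      have e := MemLp.eLpNorm_eq_integral_rpow_norm (by norm_num) (by norm_num) hd
      have e' : eLpNorm (fun x => w x - ψ x) 2 volume ≤ ENNReal.ofReal ε := hψe
      rw [e, ENNReal.ofReal_le_ofReal_iff hε.le] at e'
      have e3 : ∀ x, ‖w x - ψ x‖ ^ (2 : ENNReal).toReal = (w x - ψ x) ^ 2 := by
        intro x
        simp
      simp only [e3] at e'
      have e4 : (∫ x, (w x - ψ x) ^ 2) ^ ((2 : ENNReal).toReal)⁻¹ = √(∫ x, (w x - ψ x) ^ 2) := by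
        rw [Real.sqrt_eq_rpow]; norm_num
      rw [e4] at e'
      calc _ = (√(∫ x, (w x - ψ x) ^ 2)) ^ 2 :=
            (Real.sq_sqrt (integral_nonneg fun _ => sq_nonneg _)).symm
        _ ≤ _ := pow_le_pow_left₀ (Real.sqrt_nonneg _) e' 2
    set ψ1 : Eu d → ℝ := fun x => ζ x * ψ x
    have hψ1 : ContDiff ℝ 1 ψ1 := hζ'.mul hψ'
    have hψ1t : tsupport ψ1 ⊆ tsupport ζ := by
      refine closure_mono fun x hx => ?_
      simp only [Function.mem_support, ψ1] at hx ⊢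
      intro h; simp [h] at hx
    have hψ1c : HasCompactSupport ψ1 := hζc.of_isClosed_subset (isClosed_tsupport _) hψ1t
    have hψ1m : MemLp ψ1 2 volume := hψ1.continuous.memLp_of_hasCompactSupport hψ1c
    have hA := h ψ1 hψ1 hψ1c (hψ1t.trans hζs)
    have hp : √(∫ x, ψ1 x ^ 2) ≤ n + ε := by
      have s1 : ∫ x, ψ1 x ^ 2 ≤ ∫ x, ψ x ^ 2 := by
        refine integral_mono hψ1m.integrable_sq hψm.integrable_sq fun x => ?_
        simp only [ψ1, mul_pow]
        exact mul_le_of_le_one_left (sq_nonneg _) (pow_le_one₀ (hζ0 x) (hζl x))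
      have s2 : ∫ x, ψ x ^ 2 ≤ (n + ε) ^ 2 := by
        have e1 : ∀ x, ψ x ^ 2 = w x ^ 2 + (-2) * (w x * (w x - ψ x)) + (w x - ψ x) ^ 2 :=
          fun x => by ring
        simp only [e1]
        have i1 := hwm.integrable_sq
        have i2 : Integrable (fun x => (-2) * (w x * (w x - ψ x))) :=
          (hwm.integrable_mul hd).const_mul _
        have i3 := hd.integrable_sq
        have i12 : Integrable (fun x => w x ^ 2 + (-2) * (w x * (w x - ψ x))) := i1.add i2
        rw [integral_add i12 i3, integral_add i1 i2, integral_const_mul, ← hn2]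
        have := neg_le_of_abs_le (cs_abs hwm hd hn0 hε.le hn2.symm.le hd2)
        nlinarith
      exact Real.sqrt_le_iff.2 ⟨by positivity, s1.trans s2⟩
    have hB : ∫ x, w x ^ 2 = (∫ x, W x * ψ1 x) + ∫ x, W x * (ζ x * (w x - ψ x)) := by
      have hz : MemLp (fun x => ζ x * (w x - ψ x)) 2 volume := by
        refine hd.mono (hζ'.continuous.aestronglyMeasurable.mul hd.1) ?_
        refine Eventually.of_forall fun x => ?_
        rw [norm_mul, Real.norm_of_nonneg (hζ0 x)]
        exact mul_le_of_le_one_left (norm_nonneg _) (hζl x)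
      have j1 : Integrable (fun x => W x * ψ1 x) := hW.integrable_mul hψ1m
      have j2 : Integrable (fun x => W x * (ζ x * (w x - ψ x))) := hW.integrable_mul hz
      rw [← integral_add j1 j2]
      congr 1; ext x
      by_cases hx : x ∈ ball (0 : Eu d) r1
      · simp only [hw, indicator_of_mem hx, ψ1, hζ1 x hx]; ring
      · simp only [hw, indicator_of_notMem hx, ψ1]; ring
    have hC : |∫ x, W x * (ζ x * (w x - ψ x))| ≤ m * ε := by
      have hz : MemLp (fun x => ζ x * (w x - ψ x)) 2 volume := by
        refine hd.mono (hζ'.continuous.aestronglyMeasurable.mul hd.1) ?_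
        refine Eventually.of_forall fun x => ?_
        rw [norm_mul, Real.norm_of_nonneg (hζ0 x)]
        exact mul_le_of_le_one_left (norm_nonneg _) (hζl x)
      refine cs_abs hW hz hm0 hε.le hm2.symm.le (le_trans ?_ hd2)
      refine integral_mono hz.integrable_sq hd.integrable_sq fun x => ?_
      simp only [mul_pow]
      exact mul_le_of_le_one_left (sq_nonneg _) (pow_le_one₀ (hζ0 x) (hζl x))
    have t1 := (le_abs_self _).trans hA
    have t2 := (le_abs_self _).trans hC
    have t3 := mul_le_mul_of_nonneg_left hp hK
    rw [hn2, hB]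
    nlinarith
  have lim : n ^ 2 ≤ K * n := by
    refine le_of_forall_pos_le_add fun ε hε => ?_
    have := main (ε / (K + m + 1)) (by positivity)
    refine this.trans ?_
    have : ε / (K + m + 1) * (K + m) ≤ ε := by
      rw [div_mul_eq_mul_div, div_le_iff₀ (by positivity)]
      nlinarith
    linarith
  rw [← hn2]
  have : n ≤ K := by
    by_contra hc
    push Not at hc
    nlinarith
  exact pow_le_pow_left₀ hn0 this 2

/-- Cross-correlation. -/
def Pf (V ψ : Eu d → ℝ) (w : Eu d) : ℝ := ∫ x, V x * ψ (x + w)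

lemma Pf_conv (V ψ : Eu d → ℝ) :
    Pf V ψ = convolution (fun t => V (-t)) ψ (ContinuousLinearMap.lsmul ℝ ℝ) volume := by
  ext w
  rw [convolution_def, Pf, ← integral_neg_eq_self]
  congr 1; ext x
  simp only [ContinuousLinearMap.lsmul_apply, smul_eq_mul]
  congr 2; abel

lemma Pf_li {V : Eu d → ℝ} (hV : MemLp V 2 (volume : Measure (Eu d))) :
    LocallyIntegrable (fun t => V (-t)) (volume : Measure (Eu d)) :=
  (hV.comp_measurePreserving (Measure.measurePreserving_neg volume)).locallyIntegrable
    (by norm_num)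

lemma Pf_cd {V ψ : Eu d → ℝ} (hV : MemLp V 2 (volume : Measure (Eu d))) (hψ : ContDiff ℝ 1 ψ)
    (hc : HasCompactSupport ψ) : ContDiff ℝ 1 (Pf V ψ) := by
  rw [Pf_conv]
  exact hc.contDiff_convolution_right _ (Pf_li hV) (n := 1) hψ

lemma Pf_pd {V ψ : Eu d → ℝ} (hV : MemLp V 2 (volume : Measure (Eu d))) (hψ : ContDiff ℝ 1 ψ)
    (hc : HasCompactSupport ψ) (i : Fin d) (w : Eu d) :
    pd i (Pf V ψ) w = Pf V (pd i ψ) w := by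
  rw [pd_def, Pf_conv, Pf_conv,
    (hc.hasFDerivAt_convolution_right (ContinuousLinearMap.lsmul ℝ ℝ) (Pf_li hV) hψ w).fderiv,
    convolution_precompR_apply _ (Pf_li hV) (hc.fderiv ℝ) (hψ.continuous_fderiv (by norm_num))]
  rfl

end PSch

namespace PSch
variable {d : ℕ}

/-- Projection killing the `l` coordinate. -/
def prj (l : Fin d) (z : Eu d) : Eu d := z - z l • eb l

lemma prj_cont (l : Fin d) : Continuous (prj l) := by unfold prj; fun_prop

lemma prj_l (l : Fin d) (z : Eu d) : prj l z l = 0 := by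
  simp [prj, eb_same]

lemma prj_norm (l : Fin d) (z : Eu d) : ‖prj l z‖ ≤ ‖z‖ := by
  rw [← sq_le_sq₀ (norm_nonneg _) (norm_nonneg _), EuclideanSpace.norm_sq_eq,
    EuclideanSpace.norm_sq_eq]
  refine Finset.sum_le_sum fun i _ => ?_
  by_cases h : i = l
  · subst h; simp only [prj_l]; simp [sq_nonneg]
  · have : prj l z i = z i := by simp [prj, eb_ne h]
    rw [this]

lemma prj_pd {P : Eu d → ℝ} (hP : ContDiff ℝ 1 P) {l i : Fin d} (hi : i ≠ l) (b z : Eu d) :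
    pd i (fun z => P (prj l z + b)) z = pd i P (prj l z + b) := by
  have h1 : HasFDerivAt (fun z : Eu d => prj l z + b)
      (ContinuousLinearMap.id ℝ (Eu d) - (EuclideanSpace.proj l : Eu d →L[ℝ] ℝ).smulRight (eb l)) z := by
    refine HasFDerivAt.add_const b ?_
    exact (hasFDerivAt_id z).sub
      (((EuclideanSpace.proj l : Eu d →L[ℝ] ℝ).smulRight (eb l)).hasFDerivAt)
  have h2 := (differentiableAt_of_cd hP (prj l z + b)).hasFDerivAt.comp z h1
  rw [pd_def, pd_def]
  have h3 : fderiv ℝ (fun z => P (prj l z + b)) z = _ := h2.fderiv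
  rw [h3]
  simp [eb_ne (Ne.symm hi)]

lemma prj_cd {P : Eu d → ℝ} (hP : ContDiff ℝ 1 P) (l : Fin d) (b : Eu d) :
    ContDiff ℝ 1 (fun z => P (prj l z + b)) := by
  refine hP.comp ?_
  unfold prj
  refine (contDiff_id.sub ?_).add contDiff_const
  exact ((EuclideanSpace.proj l : Eu d →L[ℝ] ℝ).smulRight (eb l)).contDiff

lemma box (l : Fin d) : ∃ C, 0 < C ∧ ∀ P : Fin d → Eu d → ℝ, (∀ i, ContDiff ℝ 1 (P i)) →
    ∀ κ : ℝ, (∀ w, ‖w‖ ≤ 2 → ∑ i, pd i (P i) w = 0) →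
    (∀ i, ∀ t ∈ Icc (0:ℝ) 1, ∀ v : Eu d, v l = 0 → ‖v‖ ≤ 1 →
      |P i (v + (-t) • eb l) - P i ((-t) • eb l)| ≤ κ) →
    |P l ((-1 : ℝ) • eb l) - P l 0| ≤ C * κ := by
  obtain ⟨χ, hχ, hχc, hχs, hχ1, hχ0, hχl⟩ := bump (d := d) (r := 1/2) (r' := 1)
    (by norm_num) (by norm_num)
  have hχ' : ContDiff ℝ 1 χ := hχ.of_le (by exact_mod_cast le_top)
  have hχi : Integrable χ := hχ'.continuous.integrable_of_hasCompactSupport hχc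
  set c0 := ∫ z, χ z with hc0
  have hc0p : 0 < c0 := by
    have h1 : ∫ z in ball (0 : Eu d) (1/2), (1:ℝ) ≤ c0 := by
      rw [hc0, ← integral_indicator measurableSet_ball]
      refine integral_mono ((integrable_indicator_iff measurableSet_ball).2
        (by simpa using measure_ball_lt_top)) hχi
        fun z => ?_
      by_cases hz : z ∈ ball (0 : Eu d) (1/2)
      · rw [indicator_of_mem hz, hχ1 z hz]
      · rw [indicator_of_notMem hz]; exact hχ0 z
    refine lt_of_lt_of_le ?_ h1
    simp only [integral_const, smul_eq_mul, mul_one, measureReal_restrict_apply_univ]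
    exact ENNReal.toReal_pos (measure_ball_pos _ _ (by norm_num)).ne' measure_ball_lt_top.ne
  set D := ∑ i, ∫ z, |pd i χ z| with hD
  have hD0 : 0 ≤ D := Finset.sum_nonneg fun i _ => integral_nonneg fun _ => abs_nonneg _
  refine ⟨(D + 2 * c0) / c0, by positivity, ?_⟩
  intro P hP κ hdiv hosc
  have hκ : 0 ≤ κ := (abs_nonneg _).trans (hosc l 0 ⟨le_rfl, zero_le_one⟩ 0 (by simp) (by simp))
  have supp : ∀ z, χ z ≠ 0 → ‖z‖ ≤ 1 := by
    intro z hz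
    have := hχs (subset_tsupport _ hz)
    simp at this
    exact this.le
  have supp' : ∀ i z, pd i χ z ≠ 0 → ‖z‖ ≤ 1 := by
    intro i z hz
    have := hχs (pd_tsupport χ i (subset_tsupport _ hz))
    simp at this
    exact this.le
  have s2 : ∀ i, i ≠ l → ∀ t ∈ Icc (0:ℝ) 1,
      |∫ z, χ z * pd i (P i) (prj l z + (-t) • eb l)| ≤ κ * ∫ z, |pd i χ z| := by
    intro i hi t ht
    set f : Eu d → ℝ := fun z => P i (prj l z + (-t) • eb l) - P i ((-t) • eb l) with hf
    have hf1 : ContDiff ℝ 1 f := (prj_cd (hP i) l _).sub contDiff_const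
    have hfd : ∀ z, fderiv ℝ f z (eb i) = pd i (P i) (prj l z + (-t) • eb l) := by
      intro z
      rw [← prj_pd (hP i) hi, ← pd_def, hf, pd_sub_const]
    have ibp := integral_mul_fderiv_eq_neg_fderiv_mul_of_integrable (μ := volume)
      (f := χ) (g := f) (v := eb i)
      (((continuous_pd hχ' i).mul hf1.continuous).integrable_of_hasCompactSupport
        (pd_compact hχc i).mul_right)
      ((hχ'.continuous.mul (continuous_pd hf1 i)).integrable_of_hasCompactSupport
        hχc.mul_right)
      ((hχ'.continuous.mul hf1.continuous).integrable_of_hasCompactSupport hχc.mul_right)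
      (fun x _ => differentiableAt_of_cd hχ' x) (fun x _ => differentiableAt_of_cd hf1 x)
    simp only [hfd] at ibp
    rw [ibp, abs_neg, ← integral_const_mul]
    refine (abs_integral_le_integral_abs).trans ?_
    refine integral_mono ?_ ?_ ?_
    · exact (((continuous_pd hχ' i).mul hf1.continuous).integrable_of_hasCompactSupport
        (pd_compact hχc i).mul_right).abs
    · exact (((continuous_pd hχ' i).integrable_of_hasCompactSupport (pd_compact hχc i)).abs).const_mul _
    · intro z
      show |pd i χ z * f z| ≤ κ * |pd i χ z|
      rw [abs_mul, mul_comm κ]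
      by_cases hz : pd i χ z = 0
      · simp [hz]
      · exact mul_le_mul_of_nonneg_left (hosc i t ht _ (prj_l l z)
          ((prj_norm l z).trans (supp' i z hz))) (abs_nonneg _)
  have hcl : Continuous (Function.uncurry fun (z : Eu d) (t : ℝ) =>
      χ z * pd l (P l) (prj l z + (-t) • eb l)) := by
    refine (hχ'.continuous.comp continuous_fst).mul ((continuous_pd (hP l) l).comp ?_)
    exact ((prj_cont l).comp continuous_fst).add
      (by fun_prop : Continuous fun z : Eu d × ℝ => (-z.2) • eb l)
  have s3 : |∫ z, χ z * (P l (prj l z + (-1 : ℝ) • eb l) - P l (prj l z))| ≤ κ * D := by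
    have e1 : ∀ z, χ z * (P l (prj l z + (-1 : ℝ) • eb l) - P l (prj l z))
        = - ∫ t in Ioc (0:ℝ) 1, χ z * pd l (P l) (prj l z + (-t) • eb l) := by
      intro z
      rw [ftc (hP l), intervalIntegral.integral_of_le zero_le_one, integral_const_mul,
        ← mul_neg, ← integral_neg]
      congr 2; ext t
      simp [pd_def]
    simp only [e1]
    rw [integral_neg, abs_neg]
    have hint : Integrable (Function.uncurry fun (z : Eu d) (t : ℝ) =>
        χ z * pd l (P l) (prj l z + (-t) • eb l))
        ((volume : Measure (Eu d)).prod (volume.restrict (Ioc (0:ℝ) 1))) := by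
      have : IntegrableOn (Function.uncurry fun (z : Eu d) (t : ℝ) =>
        χ z * pd l (P l) (prj l z + (-t) • eb l)) (univ ×ˢ Ioc (0:ℝ) 1)
        ((volume : Measure (Eu d)).prod volume) := by
        have hk := hcl.continuousOn.integrableOn_compact (μ := (volume : Measure (Eu d)).prod volume)
          ((isCompact_closedBall (0 : Eu d) 1).prod (isCompact_Icc (a := (0:ℝ)) (b := 1)))
        refine (hk.of_forall_sdiff_eq_zero (MeasurableSet.univ.prod measurableSet_Ioc) ?_)
        rintro ⟨z, t⟩ ⟨⟨_, h2⟩, h3⟩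
        have : χ z = 0 := by
          by_contra hz
          exact h3 ⟨by simpa using supp z hz, Ioc_subset_Icc_self h2⟩
        simp [this]
      rw [IntegrableOn, ← Measure.prod_restrict, Measure.restrict_univ] at this
      exact this
    rw [integral_integral_swap hint]
    have e2 : ∀ t ∈ Ioc (0:ℝ) 1,
        ‖∫ z, χ z * pd l (P l) (prj l z + (-t) • eb l)‖ ≤ κ * D := by
      intro t ht
      have ht' := Ioc_subset_Icc_self ht
      have hii : ∀ i, Integrable fun z => χ z * pd i (P i) (prj l z + (-t) • eb l) := fun i =>
        (hχ'.continuous.mul ((continuous_pd (hP i) i).comp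
          ((prj_cont l).add continuous_const))).integrable_of_hasCompactSupport hχc.mul_right
      have e3 : ∫ z, χ z * pd l (P l) (prj l z + (-t) • eb l)
          = - ∑ i ∈ Finset.univ.erase l, ∫ z, χ z * pd i (P i) (prj l z + (-t) • eb l) := by
        rw [← integral_finsetSum _ fun i _ => hii i, ← integral_neg]
        congr 1; ext z
        by_cases hz : χ z = 0
        · simp [hz]
        have hn : ‖prj l z + (-t) • eb l‖ ≤ 2 := by
          refine (norm_add_le _ _).trans ?_
          rw [norm_smul, norm_eb, mul_one, norm_neg, Real.norm_of_nonneg ht'.1]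
          linarith [(prj_norm l z).trans (supp z hz), ht'.2]
        have := hdiv _ hn
        rw [← Finset.add_sum_erase _ _ (Finset.mem_univ l)] at this
        rw [← Finset.mul_sum, ← mul_neg]
        congr 1; linarith
      rw [e3, norm_neg, hD, Finset.mul_sum]
      refine (norm_sum_le _ _).trans ?_
      refine (Finset.sum_le_sum fun i hi => s2 i (Finset.ne_of_mem_erase hi) t ht').trans ?_
      exact Finset.sum_le_sum_of_subset_of_nonneg (Finset.erase_subset _ _) fun i _ _ =>
        mul_nonneg hκ (integral_nonneg fun _ => abs_nonneg _)
    have e4 := norm_setIntegral_le_of_norm_le_const (μ := volume) (s := Ioc (0:ℝ) 1) (by simp) e2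
    simpa using e4
  have s4 : ∀ t ∈ Icc (0:ℝ) 1,
      |∫ z, χ z * (P l (prj l z + (-t) • eb l) - P l ((-t) • eb l))| ≤ κ * c0 := by
    intro t ht
    rw [hc0, ← integral_const_mul]
    refine (abs_integral_le_integral_abs).trans ?_
    refine integral_mono ?_ (hχi.const_mul _) ?_
    · exact ((hχ'.continuous.mul (((prj_cd (hP l) l _).sub contDiff_const).continuous)
        ).integrable_of_hasCompactSupport hχc.mul_right).abs
    · intro z
      show |χ z * _| ≤ κ * χ z
      rw [abs_mul, abs_of_nonneg (hχ0 z), mul_comm κ]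
      by_cases hz : χ z = 0
      · simp [hz]
      · exact mul_le_mul_of_nonneg_left (hosc l t ht _ (prj_l l z)
          ((prj_norm l z).trans (supp z hz))) (hχ0 z)
  have a0 := s4 0 ⟨le_rfl, zero_le_one⟩
  have a1 := s4 1 ⟨zero_le_one, le_rfl⟩
  simp only [neg_zero, zero_smul, add_zero] at a0
  have ii : ∀ b : Eu d, ∀ c : ℝ, Integrable fun z => χ z * (P l (prj l z + b) - c) := fun b c =>
    (hχ'.continuous.mul (((prj_cd (hP l) l b).sub contDiff_const).continuous)
        ).integrable_of_hasCompactSupport hχc.mul_right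
  have i0 : Integrable fun z => χ z * (P l (prj l z) - P l 0) := by simpa using ii 0 (P l 0)
  have id1 : Integrable fun z => χ z * (P l (prj l z + (-1 : ℝ) • eb l) - P l (prj l z)) := by
    refine (hχ'.continuous.mul ((prj_cd (hP l) l _).continuous.sub ?_)
        ).integrable_of_hasCompactSupport hχc.mul_right
    exact (hP l).continuous.comp (prj_cont l)
  have fin : c0 * (P l ((-1 : ℝ) • eb l) - P l 0) =
      (∫ z, χ z * (P l (prj l z + (-1 : ℝ) • eb l) - P l (prj l z)))
      + (∫ z, χ z * (P l (prj l z) - P l 0))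
      - ∫ z, χ z * (P l (prj l z + (-1 : ℝ) • eb l) - P l ((-1 : ℝ) • eb l)) := by
    have i01 : Integrable fun z => χ z * (P l (prj l z + (-1 : ℝ) • eb l) - P l (prj l z))
        + χ z * (P l (prj l z) - P l 0) := id1.add i0
    rw [← integral_add id1 i0, ← integral_sub i01 (ii _ _), hc0, ← integral_mul_const]
    congr 1; ext z
    ring
  rw [div_mul_eq_mul_div, le_div_iff₀ hc0p]
  calc |P l ((-1 : ℝ) • eb l) - P l 0| * c0 = |c0 * (P l ((-1 : ℝ) • eb l) - P l 0)| := by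
        rw [abs_mul, abs_of_pos hc0p, mul_comm]
    _ ≤ κ * D + κ * c0 + κ * c0 := by
        rw [fin]
        refine (abs_sub _ _).trans ?_
        refine add_le_add ((abs_add_le _ _).trans (add_le_add s3 a0)) a1
    _ = _ := by ring

end PSch

namespace PSch
variable {d : ℕ}

lemma pd_smul {f : Eu d → ℝ} (hf : ContDiff ℝ 1 f) (θ : ℝ) (i : Fin d) (w : Eu d) :
    pd i (fun w => f (θ • w)) w = θ * pd i f (θ • w) := by
  rw [pd_def, pd_def, fderiv_comp_smul]
  simp

lemma Pf_eq (V ψ : Eu d → ℝ) (w : Eu d) : Pf V ψ w = ∫ x, V (x - w) * ψ x := by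
  rw [Pf, ← integral_add_right_eq_self (fun x => V (x - w) * ψ x) w]
  simp

lemma memLp_on {F : Eu d → ℝ} (h : MemLp F 2 (volume : Measure (Eu d))) (s : Set (Eu d)) :
    MemLp F 2 (volume.restrict s) := h.mono_measure Measure.restrict_le_self

lemma Pf_sub {V ψ : Eu d → ℝ} (hV : MemLp V 2 (volume : Measure (Eu d))) (hψ : ContDiff ℝ 1 ψ)
    (hc : HasCompactSupport ψ) {r r' K : ℝ} (hs : tsupport ψ ⊆ ball 0 r) (w v : Eu d)
    (hw : r + ‖w‖ ≤ r') (hK0 : 0 ≤ K)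
    (hK : ∫ x in ball (0 : Eu d) r', (df (-v) V x) ^ 2 ≤ K ^ 2) :
    |Pf V ψ (v + w) - Pf V ψ w| ≤ K * √(∫ x, ψ x ^ 2) := by
  have hψm : MemLp ψ 2 (volume : Measure (Eu d)) := hψ.continuous.memLp_of_hasCompactSupport hc
  have hVs : ∀ w, MemLp (fun x => V (x - w)) 2 (volume : Measure (Eu d)) := fun w => by
    simpa only [sub_eq_add_neg] using memLp_shift hV (-w)
  have e : Pf V ψ (v + w) - Pf V ψ w
      = ∫ x in ball (0 : Eu d) r, (fun x => df (-v) V (x + (-w))) x * ψ x := by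
    rw [Pf_eq, Pf_eq]
    have j1 : Integrable (fun x => V (x - (v + w)) * ψ x) := (hVs _).integrable_mul hψm
    have j2 : Integrable (fun x => V (x - w) * ψ x) := (hVs _).integrable_mul hψm
    rw [← integral_sub j1 j2, ← integral_indicator measurableSet_ball]
    congr 1; ext x
    by_cases hx : x ∈ ball (0 : Eu d) r
    · rw [indicator_of_mem hx]
      simp only [df]
      rw [show x - (v + w) = x + -w + -v by abel, sub_eq_add_neg x w]
      ring
    · rw [indicator_of_notMem hx,
        image_eq_zero_of_notMem_tsupport (fun h => hx (hs h)) (f := ψ)]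
      simp
  rw [e]
  refine cs_abs (memLp_on (memLp_shift (memLp_df hV (-v)) (-w)) _) (memLp_on hψm _) hK0
    (Real.sqrt_nonneg _) ?_ ?_
  · refine le_trans ?_ hK
    exact shift_le (f := fun x => (df (-v) V x) ^ 2) (by rw [norm_neg]; exact hw)
      (memLp_df hV (-v)).integrable_sq.integrableOn fun _ => sq_nonneg _
  · rw [Real.sq_sqrt (integral_nonneg fun _ => sq_nonneg _)]
    exact setIntegral_le_integral hψm.integrable_sq (Eventually.of_forall fun _ => sq_nonneg _)

lemma dd {ν : ℝ} (hν : 0 < ν) (l : Fin d) {r r' : ℝ} (hr : 0 < r) (hrr : r < r') :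
    ∃ C, 0 < C ∧ ∃ θ0, 0 < θ0 ∧ ∀ A : Fin d → Fin d → Eu d → ℝ, Coef ν A → Inv l A → ∀ g G,
      Sol A g G r' → ∀ θ, 0 < θ → θ ≤ θ0 →
      ∫ x in ball (0 : Eu d) r, (df (θ • eb l) (flux A g G l) x) ^ 2
        ≤ C * (θ ^ 2 * EN g r' + GN G) := by
  set s := (r' - r) / 12 with hs
  have hs0 : 0 < s := by rw [hs]; linarith
  have hr' : r' = r + 12 * s := by rw [hs]; ring
  obtain ⟨C1, hC1, H1⟩ := flux_df_l2 hν l (r := r + 8 * s) (r' := r') (by linarith) (by linarith)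
  obtain ⟨C2, hC2, H2⟩ := box l
  refine ⟨C2 ^ 2 * C1, by positivity, s, hs0, ?_⟩
  intro A hA hI g G hS θ hθ hθs
  have hM0 : 0 ≤ θ ^ 2 * EN g r' + GN G :=
    add_nonneg (mul_nonneg (sq_nonneg _) (EN_nonneg _ _)) (GN_nonneg _)
  set K := √(C1 * (θ ^ 2 * EN g r' + GN G)) with hK
  have hK0 : 0 ≤ K := Real.sqrt_nonneg _
  have hK2 : K ^ 2 = C1 * (θ ^ 2 * EN g r' + GN G) := Real.sq_sqrt (by positivity)
  have hV := memLp_flux hν hA hS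
  have goal : ∫ x in ball (0 : Eu d) r, (df (θ • eb l) (flux A g G l) x) ^ 2 ≤ (C2 * K) ^ 2 := by
    refine duality (memLp_df (hV l) _) hr (show r < r + s by linarith) (by positivity) ?_
    intro ψ hψ hψc hψs
    have hψm : MemLp ψ 2 (volume : Measure (Eu d)) := hψ.continuous.memLp_of_hasCompactSupport hψc
    have hb := H2 (fun i w => Pf (flux A g G i) ψ (θ • w))
      (fun i => (Pf_cd (hV i) hψ hψc).comp (by fun_prop : ContDiff ℝ 1 fun w : Eu d => θ • w))
      (K * √(∫ x, ψ x ^ 2)) ?_ ?_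
    · have e : Pf (flux A g G l) ψ (θ • (-1 : ℝ) • eb l) - Pf (flux A g G l) ψ (θ • 0)
          = ∫ x, df (θ • eb l) (flux A g G l) x * ψ x := by
        rw [Pf_eq, Pf_eq]
        have j1 : Integrable (fun x => flux A g G l (x + θ • eb l) * ψ x) :=
          (memLp_shift (hV l) _).integrable_mul hψm
        have j2 : Integrable (fun x => flux A g G l x * ψ x) := (hV l).integrable_mul hψm
        simp only [neg_smul, one_smul, smul_neg, sub_neg_eq_add, smul_zero, sub_zero]
        rw [← integral_sub j1 j2]
        congr 1; ext x
        simp only [df]; ring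
      rw [← e, mul_assoc]
      exact hb
    · intro w hw
      have e1 : ∀ i, pd i (fun w => Pf (flux A g G i) ψ (θ • w)) w
          = θ * ∫ x, flux A g G i x * pd i (fun y => ψ (y + θ • w)) x := by
        intro i
        rw [pd_smul (Pf_cd (hV i) hψ hψc), Pf_pd (hV i) hψ hψc]
        simp only [Pf, pd_comp_add]
      simp only [e1]
      have hψ2 : ContDiff ℝ 1 (fun y => ψ (y + θ • w)) :=
        hψ.comp (contDiff_id.add contDiff_const)
      rw [← Finset.mul_sum, ← integral_finsetSum]
      · rw [hS.df _ hψ2 (comp_add_cs hψc _) (tsupport_shift ψ _ ?_ hψs), mul_zero]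
        rw [norm_smul, Real.norm_of_nonneg hθ.le]
        nlinarith
      · intro i _
        exact (hV i).integrable_mul (memLp_pd hψ2 (comp_add_cs hψc _) i)
    · intro i t ht v hv hvn
      have hv1 : ‖θ • v‖ ≤ θ := by
        rw [norm_smul, Real.norm_of_nonneg hθ.le]
        exact mul_le_of_le_one_right hθ.le hvn
      have := Pf_sub (hV i) hψ hψc hψs (θ • (-t) • eb l) (θ • v) (r' := r + 8 * s) ?_ hK0 ?_
      · simpa only [smul_add] using this
      · rw [norm_smul, norm_smul, norm_eb, norm_neg, Real.norm_of_nonneg hθ.le,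
          Real.norm_of_nonneg ht.1]
        nlinarith [ht.2]
      · rw [hK2]
        refine (H1 A hA hI g G hS (-(θ • v)) (by simp [hv]) (by rw [norm_neg]; linarith) i).trans ?_
        gcongr
        · exact EN_nonneg _ _
        · rw [norm_neg]; exact hv1
  rw [mul_pow, hK2] at goal
  linarith

lemma EN_single {g : Eu d → ℝ} (h : ContDiff ℝ 1 g) (r : ℝ) (i : Fin d) :
    ∫ x in ball (0 : Eu d) r, pd i g x ^ 2 ≤ EN g r :=
  integral_mono (intB ((continuous_pd h i).pow 2) _ _) (EN_int h r) fun x =>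
    Finset.single_le_sum (f := fun i => pd i g x ^ 2) (fun _ _ => sq_nonneg _) (Finset.mem_univ i)

lemma ddi {ν : ℝ} (hν : 0 < ν) (l : Fin d) {i : Fin d} (hi : i ≠ l) {r r' : ℝ} (hr : 0 < r)
    (hrr : r < r') :
    ∃ C, 0 < C ∧ ∃ θ0, 0 < θ0 ∧ ∀ A : Fin d → Fin d → Eu d → ℝ, Coef ν A → Inv l A → ∀ g G,
      Sol A g G r' → ∀ θ, 0 < θ → θ ≤ θ0 →
      ∫ x in ball (0 : Eu d) r, (df (θ • eb l) (pd i g) x) ^ 2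
        ≤ C * (θ ^ 2 * EN g r' + GN G) := by
  set s := (r' - r) / 12 with hs
  have hs0 : 0 < s := by rw [hs]; linarith
  have hr' : r' = r + 12 * s := by rw [hs]; ring
  obtain ⟨C1, hC1, H1⟩ := den hν l (r := r + 8 * s) (r' := r') (by linarith) (by linarith)
  refine ⟨9 * C1, by positivity, s, hs0, ?_⟩
  intro A hA hI g G hS θ hθ hθs
  set M := θ ^ 2 * EN g r' + GN G with hM
  have hEN := EN_nonneg g r'
  have hE : ∀ t ∈ Icc (0:ℝ) θ, EN (df (t • eb i) g) (r + 8 * s) ≤ C1 * M := by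
    intro t ht
    have hn : ‖t • (eb i : Eu d)‖ = t := by
      rw [norm_smul, norm_eb, mul_one, Real.norm_of_nonneg ht.1]
    have := H1 A hA hI g G hS (t • eb i) (by simp [eb_ne (Ne.symm hi)])
      (by rw [hn]; linarith [ht.2])
    rw [hn] at this
    refine this.trans ?_
    rw [hM]
    gcongr
    · exact ht.1
    · exact ht.2
  set R : Eu d → ℝ := fun x => df (θ • eb i) g x - θ * pd i g x with hR
  have hRc : Continuous R := (df_cd hS.cd _).continuous.sub
    (continuous_const.mul (continuous_pd hS.cd i))
  have hRl : ∫ x in ball (0 : Eu d) (r + 8 * s), R x ^ 2 ≤ θ ^ 2 * (C1 * M) := by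
    refine L1d hS.cd hθ.le i fun t ht => ?_
    exact (EN_single (df_cd hS.cd _) _ i).trans (hE t ht)
  have hnl : ‖θ • (eb l : Eu d)‖ = θ := by
    rw [norm_smul, norm_eb, mul_one, Real.norm_of_nonneg hθ.le]
  have hR1 : ∫ x in ball (0 : Eu d) r, R (x + θ • eb l) ^ 2 ≤ θ ^ 2 * (C1 * M) :=
    (shift_le (f := fun x => R x ^ 2) (by rw [hnl]; linarith) (intB (hRc.pow 2) _ _)
      fun _ => sq_nonneg _).trans hRl
  have hR2 : ∫ x in ball (0 : Eu d) r, R x ^ 2 ≤ θ ^ 2 * (C1 * M) :=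
    (setIntegral_mono_set (intB (hRc.pow 2) _ _) (Eventually.of_forall fun _ => sq_nonneg _)
      (LE.le.eventuallyLE (ball_subset_ball (by linarith)))).trans hRl
  have hR3 : ∫ x in ball (0 : Eu d) r, (df (θ • eb l) (df (θ • eb i) g) x) ^ 2
      ≤ θ ^ 2 * (C1 * M) := by
    refine (L1 (df_cd hS.cd _) r (θ • eb l)).trans ?_
    rw [hnl]
    refine mul_le_mul_of_nonneg_left ?_ (sq_nonneg _)
    exact (EN_mono (df_cd hS.cd _) (by linarith)).trans (hE θ ⟨hθ.le, le_rfl⟩)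
  have hdc : Continuous (df (θ • eb l) (df (θ • eb i) g)) :=
    (df_cd (df_cd hS.cd _) _).continuous
  have hRs : Continuous fun x => R (x + θ • eb l) := hRc.comp (by fun_prop)
  have hpc : Continuous (df (θ • eb l) (pd i g)) := by
    unfold df
    exact ((continuous_pd hS.cd i).comp (by fun_prop)).sub (continuous_pd hS.cd i)
  have i1 : IntegrableOn (fun x => 3 * (df (θ • eb l) (df (θ • eb i) g) x) ^ 2)
      (ball (0 : Eu d) r) := (intB (hdc.pow 2) 0 r).const_mul 3
  have i2 : IntegrableOn (fun x => 3 * R (x + θ • eb l) ^ 2)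
      (ball (0 : Eu d) r) := (intB (hRs.pow 2) 0 r).const_mul 3
  have i3 : IntegrableOn (fun x => 3 * R x ^ 2)
      (ball (0 : Eu d) r) := (intB (hRc.pow 2) 0 r).const_mul 3
  have key : ∫ x in ball (0 : Eu d) r, θ ^ 2 * (df (θ • eb l) (pd i g) x) ^ 2 ≤
      ∫ x in ball (0 : Eu d) r, (3 * (df (θ • eb l) (df (θ • eb i) g) x) ^ 2
        + 3 * R (x + θ • eb l) ^ 2 + 3 * R x ^ 2) := by
    refine integral_mono (intB (continuous_const.mul (hpc.pow 2)) 0 r) ((i1.add i2).add i3) ?_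
    intro x
    have e : θ * df (θ • eb l) (pd i g) x
        = df (θ • eb l) (df (θ • eb i) g) x - R (x + θ • eb l) + R x := by
      simp only [hR, df]; ring
    show θ ^ 2 * (df (θ • eb l) (pd i g) x) ^ 2 ≤ 3 * (df (θ • eb l) (df (θ • eb i) g) x) ^ 2
        + 3 * R (x + θ • eb l) ^ 2 + 3 * R x ^ 2
    rw [← mul_pow, e]
    set p := df (θ • eb l) (df (θ • eb i) g) x
    set q := R (x + θ • eb l)
    nlinarith [sq_nonneg (p + q), sq_nonneg (p - R x), sq_nonneg (q + R x)]
  have i12 : IntegrableOn (fun x => 3 * (df (θ • eb l) (df (θ • eb i) g) x) ^ 2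
        + 3 * R (x + θ • eb l) ^ 2) (ball (0 : Eu d) r) := i1.add i2
  rw [integral_const_mul, integral_add i12 i3, integral_add i1 i2, integral_const_mul,
    integral_const_mul, integral_const_mul] at key
  have hθ2 : 0 < θ ^ 2 := by positivity
  refine le_of_mul_le_mul_left ?_ hθ2
  calc _ ≤ _ := key
    _ ≤ 3 * (θ ^ 2 * (C1 * M)) + 3 * (θ ^ 2 * (C1 * M)) + 3 * (θ ^ 2 * (C1 * M)) := by
        gcongr
    _ = _ := by ring

/-- Fields for which the decay argument runs. -/
structure Good (ν : ℝ) (l : Fin d)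
    (F : (Fin d → Fin d → Eu d → ℝ) → (Eu d → ℝ) → (Fin d → Eu d → ℝ) → Eu d → ℝ) : Prop where
  mem : ∀ A, Coef ν A → ∀ g G r, Sol A g G r → MemLp (F A g G) 2 (volume : Measure (Eu d))
  bd : ∃ C, 0 < C ∧ ∀ A, Coef ν A → ∀ g G r, Sol A g G r →
    ∫ x in ball (0 : Eu d) r, F A g G x ^ 2 ≤ C * (EN g r + GN G)
  dfe : ∀ A, Coef ν A → Inv l A → ∀ g G r, Sol A g G r → ∀ v : Eu d, v l = 0 →
    F A (df v g) (fun i => df v (G i)) = df v (F A g G)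
  bad : ∀ r r' : ℝ, 0 < r → r < r' → ∃ C, 0 < C ∧ ∃ θ0, 0 < θ0 ∧
    ∀ A, Coef ν A → Inv l A → ∀ g G, Sol A g G r' → ∀ θ, 0 < θ → θ ≤ θ0 →
      ∫ x in ball (0 : Eu d) r, (df (θ • eb l) (F A g G) x) ^ 2
        ≤ C * (θ ^ 2 * EN g r' + GN G)

lemma good_pd {ν : ℝ} (hν : 0 < ν) {l i : Fin d} (hi : i ≠ l) :
    Good ν l (fun _ g _ => pd i g) where
  mem := fun A _ g G r hS => memLp_pd hS.cd hS.cs i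
  bd := ⟨1, one_pos, fun A _ g G r hS => by
    have := EN_single hS.cd r i
    have := GN_nonneg G
    linarith⟩
  dfe := fun A _ _ g G r hS v _ => by ext x; exact pd_df hS.cd v x i
  bad := fun r r' hr hrr => ddi hν l hi hr hrr

lemma good_flux {ν : ℝ} (hν : 0 < ν) (l : Fin d) : Good ν l (fun A g G => flux A g G l) where
  mem := fun A hA g G r hS => memLp_flux hν hA hS l
  bd := ⟨2 * ν⁻¹ ^ 2 + 2, by positivity, fun A hA g G r hS => by
    have h := flux_l2 hν hA hS r l
    have h1 := GN_nonneg G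
    have h2 := EN_nonneg g r
    have : 0 ≤ ν⁻¹ ^ 2 * GN G := by positivity
    nlinarith⟩
  dfe := fun A _ hI g G r hS v hv => by ext x; exact flux_df hI G hS.cd hv l x
  bad := fun r r' hr hrr => dd hν l hr hrr

end PSch

namespace PSch
variable {d : ℕ}

/-- Coordinate slab. -/
def slab (ρ : ℝ) (J : Finset (Fin d)) : Set (Eu d) := {x | ∀ j ∈ J, |x j| < ρ}

lemma slab_meas (ρ : ℝ) (J : Finset (Fin d)) : MeasurableSet (slab ρ J) := by
  have : slab ρ J = ⋂ j ∈ J, {x : Eu d | |x j| < ρ} := by ext x; simp [slab]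
  rw [this]
  refine J.measurableSet_biInter fun j _ => ?_
  refine (isOpen_lt ?_ continuous_const).measurableSet
  fun_prop

lemma shift_set (f : Eu d → ℝ) (T : Set (Eu d)) (v : Eu d) :
    ∫ x in T, f (x + v) = ∫ x in (fun x => x - v) ⁻¹' T, f x := by
  have := (measurePreserving_add_right volume v).setIntegral_preimage_emb
    (measurableEmbedding_addRight v) f ((fun x => x - v) ⁻¹' T)
  rw [← this]
  congr 2
  ext x; simp

lemma tile {f : Eu d → ℝ} {T U : Set (Eu d)} (hT : MeasurableSet T) (v : ℕ → Eu d) (N : ℕ)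
    (hf : IntegrableOn f U) (hU : MeasurableSet U) (h0 : ∀ x, 0 ≤ f x)
    (hsub : ∀ m < N, ∀ x ∈ T, x + v m ∈ U)
    (hdis : ∀ m < N, ∀ n < N, m ≠ n → ∀ x ∈ T, ∀ y ∈ T, x + v m ≠ y + v n) :
    ∑ m ∈ Finset.range N, ∫ x in T, f (x + v m) ≤ ∫ x in U, f x := by
  have hTm : ∀ m, MeasurableSet ((fun x => x - v m) ⁻¹' T) := fun m =>
    (measurable_id.sub_const (v m)) hT
  have hTU : ∀ m < N, (fun x => x - v m) ⁻¹' T ⊆ U := by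
    intro m hm x hx
    have := hsub m hm _ hx
    simpa using this
  simp only [shift_set]
  rw [← integral_biUnion_finset (Finset.range N) (fun m _ => hTm m)]
  · refine setIntegral_mono_set hf (Eventually.of_forall h0) (LE.le.eventuallyLE ?_)
    exact iUnion₂_subset fun m hm => hTU m (Finset.mem_range.1 hm)
  · intro m hm n hn hmn
    refine Set.disjoint_left.2 fun x hx hy => ?_
    refine hdis m (by simpa using hm) n (by simpa using hn) hmn _ hx _ hy ?_
    simp
  · intro m hm
    exact hf.mono_set (hTU m (Finset.mem_range.1 hm))

lemma gain_pt (F : Eu d → ℝ) (v x : Eu d) (N : ℕ) :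
    (N : ℝ) * F x ^ 2 ≤ 2 * ∑ m ∈ Finset.range N, F (x + (m : ℝ) • v) ^ 2
      + 2 * N ^ 2 * ∑ n ∈ Finset.range N, (df v F (x + (n : ℝ) • v)) ^ 2 := by
  set S := ∑ n ∈ Finset.range N, (df v F (x + (n : ℝ) • v)) ^ 2 with hS
  have key : ∀ m ∈ Finset.range N, F x ^ 2 ≤ 2 * F (x + (m : ℝ) • v) ^ 2 + 2 * N * S := by
    intro m hm
    have hm' : m < N := Finset.mem_range.1 hm
    have e : F x = F (x + (m : ℝ) • v) - ∑ n ∈ Finset.range m, df v F (x + (n : ℝ) • v) := by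
      have : ∀ n : ℕ, df v F (x + (n : ℝ) • v)
          = F (x + ((n + 1 : ℕ) : ℝ) • v) - F (x + (n : ℝ) • v) := by
        intro n
        simp only [df]
        congr 2
        push_cast
        rw [add_smul, one_smul, add_assoc]
      simp only [this]
      rw [Finset.sum_range_sub (fun n : ℕ => F (x + (n : ℝ) • v))]
      simp
    have h1 : (∑ n ∈ Finset.range m, df v F (x + (n : ℝ) • v)) ^ 2 ≤ N * S := by
      calc _ ≤ ((Finset.range m).card : ℝ) * ∑ n ∈ Finset.range m, (df v F (x + (n : ℝ) • v)) ^ 2 :=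
            sq_sum_le_card_mul_sum_sq
        _ ≤ N * S := by
            rw [Finset.card_range]
            refine mul_le_mul (by exact_mod_cast hm'.le) ?_
              (Finset.sum_nonneg fun _ _ => sq_nonneg _) (by positivity)
            exact Finset.sum_le_sum_of_subset_of_nonneg
              (by intro z; simp only [Finset.mem_range]; omega) (fun _ _ _ => sq_nonneg _)
    rw [e]
    set p := F (x + (m : ℝ) • v)
    set q := ∑ n ∈ Finset.range m, df v F (x + (n : ℝ) • v)
    nlinarith [sq_nonneg (p + q)]
  have := Finset.sum_le_sum key
  rw [Finset.sum_const, Finset.sum_add_distrib, Finset.sum_const, ← Finset.mul_sum,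
    Finset.card_range, nsmul_eq_mul, nsmul_eq_mul] at this
  calc _ ≤ _ := this
    _ = _ := by ring

lemma gain {F : Eu d → ℝ} (hF : MemLp F 2 (volume : Measure (Eu d))) {i : Fin d}
    {J : Finset (Fin d)} (hi : i ∉ J) {r r' ρ : ℝ} (hρ : 0 < ρ) (hρ' : ρ ≤ (r' - r) / 4) :
    ∫ x in ball (0 : Eu d) r ∩ slab ρ (insert i J), F x ^ 2
      ≤ 8 * ρ / (r' - r) * (∫ x in ball (0 : Eu d) r' ∩ slab ρ J, F x ^ 2)
        + (r' - r) / ρ * ∫ x in ball (0 : Eu d) r' ∩ slab ρ J, (df ((2 * ρ) • eb i) F x) ^ 2 := by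
  set D := r' - r with hD
  have hD0 : 0 < D := by linarith
  set v : Eu d := (2 * ρ) • eb i with hv
  have hvn : ‖v‖ = 2 * ρ := by
    rw [hv, norm_smul, norm_eb, mul_one, Real.norm_of_nonneg (by positivity)]
  set T := ball (0 : Eu d) r ∩ slab ρ (insert i J) with hT
  set U := ball (0 : Eu d) r' ∩ slab ρ J with hU
  have hTm : MeasurableSet T := measurableSet_ball.inter (slab_meas _ _)
  have hUm : MeasurableSet U := measurableSet_ball.inter (slab_meas _ _)
  set N := ⌊D / (2 * ρ)⌋₊ with hN
  have hx2 : 2 ≤ D / (2 * ρ) := by rw [le_div_iff₀ (by positivity)]; linarith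
  have hN1 : (N : ℝ) ≤ D / (2 * ρ) := Nat.floor_le (by positivity)
  have hN2 : D / (2 * ρ) / 2 ≤ N := by
    have := Nat.lt_floor_add_one (D / (2 * ρ))
    rw [← hN] at this
    linarith
  have hN0 : (0 : ℝ) < N := by linarith
  have hsub : ∀ m < N, ∀ x ∈ T, x + (m : ℝ) • v ∈ U := by
    intro m hm x hx
    refine ⟨?_, ?_⟩
    · have h1 := hx.1
      simp only [mem_ball, dist_eq_norm, sub_zero] at h1 ⊢
      have h2 : ‖(m : ℝ) • v‖ ≤ D := by
        rw [norm_smul, hvn, Real.norm_of_nonneg (by positivity)]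
        have : (m : ℝ) ≤ D / (2 * ρ) := le_trans (by exact_mod_cast hm.le) hN1
        rwa [le_div_iff₀ (by positivity)] at this
      calc _ ≤ _ := norm_add_le _ _
        _ < r + D := by linarith
        _ = r' := by rw [hD]; ring
    · intro j hj
      have hji : j ≠ i := fun h => hi (h ▸ hj)
      have := hx.2 j (Finset.mem_insert_of_mem hj)
      simpa [hv, eb_ne hji] using this
  have hdis : ∀ m < N, ∀ n < N, m ≠ n → ∀ x ∈ T, ∀ y ∈ T, x + (m : ℝ) • v ≠ y + (n : ℝ) • v := by
    intro m _ n _ hmn x hx y hy h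
    have hx1 := abs_lt.1 (hx.2 i (Finset.mem_insert_self _ _))
    have hy1 := abs_lt.1 (hy.2 i (Finset.mem_insert_self _ _))
    have h' := congrArg (fun z : Eu d => z i) h
    simp [hv, eb_same] at h'
    have h3 : |((m : ℝ) - n) * (2 * ρ)| < 2 * ρ := by
      rw [abs_lt]; constructor <;> nlinarith
    have h4 : (1 : ℝ) ≤ |(m : ℝ) - n| := by
      have : (1 : ℤ) ≤ |(m : ℤ) - n| := Int.one_le_abs (by omega)
      exact_mod_cast this
    rw [abs_mul, abs_of_pos (by positivity : 0 < 2 * ρ)] at h3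
    nlinarith
  have hF2 : Integrable (fun x => F x ^ 2) := hF.integrable_sq
  have hdF : MemLp (df v F) 2 (volume : Measure (Eu d)) := memLp_df hF v
  have hG2 : Integrable (fun x => df v F x ^ 2) := hdF.integrable_sq
  have t1 := tile (f := fun x => F x ^ 2) hTm (fun m => (m : ℝ) • v) N hF2.integrableOn hUm
    (fun _ => sq_nonneg _) hsub hdis
  have t2 := tile (f := fun x => df v F x ^ 2) hTm (fun m => (m : ℝ) • v) N hG2.integrableOn hUm
    (fun _ => sq_nonneg _) hsub hdis
  have ia : ∀ m : ℕ, IntegrableOn (fun x => F (x + (m : ℝ) • v) ^ 2) T := fun m =>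
    (memLp_shift hF _).integrable_sq.integrableOn
  have ib : ∀ m : ℕ, IntegrableOn (fun x => df v F (x + (m : ℝ) • v) ^ 2) T := fun m =>
    (memLp_shift hdF _).integrable_sq.integrableOn
  have iA : IntegrableOn (fun x => 2 * ∑ m ∈ Finset.range N, F (x + (m : ℝ) • v) ^ 2) T :=
    (integrable_finsetSum _ fun m _ => ia m).const_mul 2
  have iB : IntegrableOn (fun x => 2 * N ^ 2 *
      ∑ m ∈ Finset.range N, df v F (x + (m : ℝ) • v) ^ 2) T :=
    (integrable_finsetSum _ fun m _ => ib m).const_mul _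
  have key : ∫ x in T, (N : ℝ) * F x ^ 2 ≤
      ∫ x in T, (2 * ∑ m ∈ Finset.range N, F (x + (m : ℝ) • v) ^ 2
        + 2 * N ^ 2 * ∑ m ∈ Finset.range N, df v F (x + (m : ℝ) • v) ^ 2) :=
    integral_mono (hF2.integrableOn.const_mul _) (iA.add iB) fun x => gain_pt F v x N
  rw [integral_const_mul, integral_add iA iB, integral_const_mul, integral_const_mul,
    integral_finsetSum _ (fun m _ => ia m), integral_finsetSum _ (fun m _ => ib m)] at key
  set X := ∫ x in T, F x ^ 2
  set P := ∫ x in U, F x ^ 2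
  set Q := ∫ x in U, (df v F x) ^ 2
  have hP : 0 ≤ P := integral_nonneg fun _ => sq_nonneg _
  have hQ : 0 ≤ Q := integral_nonneg fun _ => sq_nonneg _
  have key2 : (N : ℝ) * X ≤ 2 * P + 2 * N ^ 2 * Q := by
    refine key.trans ?_
    gcongr
  have e1 : 2 * P ≤ N * (8 * ρ / D * P) := by
    have : 2 ≤ N * (8 * ρ / D) := by
      calc (2 : ℝ) = D / (2 * ρ) / 2 * (8 * ρ / D) := by field_simp; norm_num
        _ ≤ _ := by gcongr
    nlinarith
  have e2 : 2 * (N : ℝ) ^ 2 * Q ≤ N * (D / ρ * Q) := by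
    have : 2 * (N : ℝ) ≤ D / ρ := by
      calc 2 * (N : ℝ) ≤ 2 * (D / (2 * ρ)) := by gcongr
        _ = D / ρ := by field_simp
    have h2 := mul_le_mul_of_nonneg_right this (mul_nonneg hN0.le hQ)
    nlinarith
  have : (N : ℝ) * X ≤ N * (8 * ρ / D * P + D / ρ * Q) := by linarith
  exact le_of_mul_le_mul_left this hN0

end PSch

namespace PSch
variable {d : ℕ}

lemma sq_mono_set {F : Eu d → ℝ} (hF : MemLp F 2 (volume : Measure (Eu d))) {s t : Set (Eu d)}
    (h : s ⊆ t) : ∫ x in s, F x ^ 2 ≤ ∫ x in t, F x ^ 2 :=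
  setIntegral_mono_set hF.integrable_sq.integrableOn (Eventually.of_forall fun _ => sq_nonneg _)
    (LE.le.eventuallyLE h)

lemma slab_decay {ν : ℝ} (hν : 0 < ν) {l : Fin d}
    {F : (Fin d → Fin d → Eu d → ℝ) → (Eu d → ℝ) → (Fin d → Eu d → ℝ) → Eu d → ℝ}
    (hF : Good ν l F) (t : Finset (Fin d)) : l ∉ t → ∀ r r' : ℝ, 0 < r → r < r' →
    ∃ C, 0 < C ∧ ∃ ρ0, 0 < ρ0 ∧ ∀ ρ, 0 < ρ → ρ ≤ ρ0 → ∃ K, 0 < K ∧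
      ∀ A, Coef ν A → Inv l A → ∀ g G, Sol A g G r' →
        ∫ x in ball (0 : Eu d) r ∩ slab ρ (insert l t), F A g G x ^ 2
          ≤ C * ρ ^ (t.card + 1) * EN g r' + K * GN G := by
  induction t using Finset.induction_on with
  | empty =>
    intro _ r r' hr hrr
    set D := (r' - r) / 2 with hD
    have hD0 : 0 < D := by rw [hD]; linarith
    obtain ⟨Cb, hCb, hb⟩ := hF.bd
    obtain ⟨Cd, hCd, θ0, hθ0, hbad⟩ := hF.bad (r + D) r' (by linarith) (by linarith)
    refine ⟨8 / D * Cb + 4 * D * Cd, by positivity, min (D / 4) (θ0 / 2), by positivity, ?_⟩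
    intro ρ hρ hρ0
    have hρ1 : ρ ≤ D / 4 := hρ0.trans (min_le_left _ _)
    have hρ2 : ρ ≤ θ0 / 2 := hρ0.trans (min_le_right _ _)
    refine ⟨8 * ρ / D * Cb + D / ρ * Cd, by positivity, ?_⟩
    intro A hA hI g G hS
    have hm := hF.mem A hA g G r' hS
    have h1 := gain hm (i := l) (J := ∅) (by simp) (r := r) (r' := r + D) hρ (by linarith)
    have e : r + D - r = D := by ring
    rw [e] at h1
    have h2 : ∫ x in ball (0 : Eu d) (r + D) ∩ slab ρ ∅, F A g G x ^ 2 ≤ Cb * (EN g r' + GN G) :=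
      (sq_mono_set hm inter_subset_left).trans ((sq_mono_set hm
        (ball_subset_ball (by linarith))).trans (hb A hA g G r' hS))
    have h3 : ∫ x in ball (0 : Eu d) (r + D) ∩ slab ρ ∅, (df ((2 * ρ) • eb l) (F A g G) x) ^ 2
        ≤ Cd * ((2 * ρ) ^ 2 * EN g r' + GN G) :=
      (sq_mono_set (memLp_df hm _) inter_subset_left).trans
        (hbad A hA hI g G hS (2 * ρ) (by positivity) (by linarith))
    calc _ ≤ _ := h1
      _ ≤ 8 * ρ / D * (Cb * (EN g r' + GN G)) + D / ρ * (Cd * ((2 * ρ) ^ 2 * EN g r' + GN G)) := by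
          gcongr
      _ = _ := by
          simp only [Finset.card_empty]
          field_simp
          ring
  | insert i t hit ih =>
    intro hl r r' hr hrr
    have hil : i ≠ l := fun h => hl (by simp [h])
    have hlt : l ∉ t := fun h => hl (Finset.mem_insert_of_mem h)
    set D := (r' - r) / 3 with hD
    have hD0 : 0 < D := by rw [hD]; linarith
    obtain ⟨C, hC, ρ0, hρ0, H⟩ := ih hlt (r + D) (r + 2 * D) (by linarith) (by linarith)
    obtain ⟨C2, hC2, H2⟩ := den (d := d) hν l (r := r + 2 * D) (r' := r') (by linarith)
      (by linarith)
    refine ⟨8 / D * C + 4 * D * C * C2, by positivity, min (D / 4) ρ0, by positivity, ?_⟩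
    intro ρ hρ hρm
    have hρ1 : ρ ≤ D / 4 := hρm.trans (min_le_left _ _)
    obtain ⟨K, hK, HK⟩ := H ρ hρ (hρm.trans (min_le_right _ _))
    set k := t.card + 1 with hk
    refine ⟨8 * ρ / D * K + D / ρ * (C * ρ ^ k * C2 + 4 * K), by positivity, ?_⟩
    intro A hA hI g G hS
    have hm := hF.mem A hA g G r' hS
    have hiJ : i ∉ insert l t := by simp [hil, hit]
    have h1 := gain hm hiJ (r := r) (r' := r + D) hρ (by linarith)
    have e : r + D - r = D := by ring
    rw [e, Finset.insert_comm] at h1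
    set v : Eu d := (2 * ρ) • eb i with hv
    have hvl : v l = 0 := by simp [hv, eb_ne hil.symm]
    have hvn : ‖v‖ = 2 * ρ := by
      rw [hv, norm_smul, norm_eb, mul_one, Real.norm_of_nonneg (by positivity)]
    have hS2 : Sol A (df v g) (fun i => df v (G i)) (r + 2 * D) :=
      hS.df' hν hA hI hvl (by rw [hvn]; linarith)
    have h2 := HK A hA hI g G (hS.mono (by linarith))
    have h3 := HK A hA hI _ _ hS2
    rw [hF.dfe A hA hI g G r' hS v hvl] at h3
    have h4 := H2 A hA hI g G hS v hvl (by rw [hvn]; linarith)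
    rw [hvn] at h4
    have h5 := GN_df hS.gm v
    have h6 : EN g (r + 2 * D) ≤ EN g r' := EN_mono hS.cd (by linarith)
    rw [Finset.card_insert_of_notMem hit, ← hk]
    calc _ ≤ _ := h1
      _ ≤ 8 * ρ / D * (C * ρ ^ k * EN g (r + 2 * D) + K * GN G) +
          D / ρ * (C * ρ ^ k * EN (df v g) (r + 2 * D) + K * GN fun i => df v (G i)) := by
          gcongr
      _ ≤ 8 * ρ / D * (C * ρ ^ k * EN g r' + K * GN G) +
          D / ρ * (C * ρ ^ k * (C2 * ((2 * ρ) ^ 2 * EN g r' + GN G)) + K * (4 * GN G)) := by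
          gcongr
      _ = _ := by
          rw [pow_succ]
          field_simp
          ring

/-- The family of good fields. -/
def FF (l i : Fin d) (A : Fin d → Fin d → Eu d → ℝ) (g : Eu d → ℝ) (G : Fin d → Eu d → ℝ) :
    Eu d → ℝ := if i = l then flux A g G l else pd i g

lemma good_FF {ν : ℝ} (hν : 0 < ν) (l i : Fin d) : Good ν l (FF l i) := by
  by_cases h : i = l
  · have : FF l i = fun A g G => flux A g G l := by
      funext A g G; simp [FF, h]
    rw [this]; exact good_flux hν l
  · have : FF l i = fun _ g _ => pd i g := by
      funext A g G; simp [FF, h]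
    rw [this]; exact good_pd hν h

lemma FF_pt {ν : ℝ} (hν : 0 < ν) (l : Fin d) {A : Fin d → Fin d → Eu d → ℝ} (hA : Coef ν A)
    (g : Eu d → ℝ) (G : Fin d → Eu d → ℝ) (x : Eu d) :
    ∑ i, pd i g x ^ 2 ≤ (1 + ν⁻¹ ^ 2 * (3 + 3 * ν⁻¹ ^ 2)) *
      (∑ i, FF l i A g G x ^ 2 + ∑ i, G i x ^ 2) := by
  classical
  set S := ∑ i ∈ Finset.univ.erase l, pd i g x ^ 2 with hS
  have hS0 : 0 ≤ S := Finset.sum_nonneg fun _ _ => sq_nonneg _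
  have e1 : ∑ i, pd i g x ^ 2 = pd l g x ^ 2 + S :=
    (Finset.add_sum_erase _ _ (Finset.mem_univ l)).symm
  have e2 : ∑ i, FF l i A g G x ^ 2 = flux A g G l x ^ 2 + S := by
    rw [← Finset.add_sum_erase _ _ (Finset.mem_univ l)]
    congr 1
    · simp [FF]
    · refine Finset.sum_congr rfl fun i hi => ?_
      simp [FF, Finset.ne_of_mem_erase hi]
  set W := ∑ j ∈ Finset.univ.erase l, A l j x * pd j g x with hW
  have e3 : A l l x * pd l g x = flux A g G l x + G l x - W := by
    have : ∑ j, A l j x * pd j g x = A l l x * pd l g x + W :=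
      (Finset.add_sum_erase _ _ (Finset.mem_univ l)).symm
    rw [flux, this]; ring
  have hW2 : W ^ 2 ≤ ν⁻¹ ^ 2 * S := by
    refine (Finset.sum_mul_sq_le_sq_mul_sq _ _ _).trans ?_
    refine mul_le_mul_of_nonneg_right ?_ hS0
    refine le_trans ?_ (hA.bdd x)
    refine le_trans ?_ (Finset.single_le_sum (f := fun i => ∑ j, A i j x ^ 2)
      (fun i _ => Finset.sum_nonneg fun _ _ => sq_nonneg _) (Finset.mem_univ l))
    exact Finset.sum_le_sum_of_subset_of_nonneg (Finset.subset_univ _) fun _ _ _ => sq_nonneg _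
  have hll : ν ≤ A l l x := by
    have := hA.ell x (fun i => if i = l then 1 else 0)
    simpa using this
  have hG : G l x ^ 2 ≤ ∑ i, G i x ^ 2 :=
    Finset.single_le_sum (f := fun i => G i x ^ 2) (fun _ _ => sq_nonneg _) (Finset.mem_univ l)
  set V := flux A g G l x
  set Gl := G l x
  set GG := ∑ i, G i x ^ 2
  set p := pd l g x
  have h1 : (A l l x * p) ^ 2 ≤ 3 * V ^ 2 + 3 * Gl ^ 2 + 3 * W ^ 2 := by
    rw [e3]; nlinarith [sq_nonneg (V - Gl), sq_nonneg (V + W), sq_nonneg (Gl + W)]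
  have h2 : ν ^ 2 * p ^ 2 ≤ (A l l x * p) ^ 2 := by
    rw [mul_pow]; gcongr
  have h3 : p ^ 2 ≤ ν⁻¹ ^ 2 * (3 * V ^ 2 + 3 * GG + 3 * (ν⁻¹ ^ 2 * S)) := by
    calc p ^ 2 = ν⁻¹ ^ 2 * (ν ^ 2 * p ^ 2) := by field_simp
      _ ≤ _ := by gcongr; linarith
  rw [e1, e2]
  have hGG : 0 ≤ GG := Finset.sum_nonneg fun _ _ => sq_nonneg _
  set n := ν⁻¹ ^ 2
  have hn : 0 ≤ n := by positivity
  have hV : 0 ≤ V ^ 2 := sq_nonneg _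
  nlinarith [mul_nonneg hn hV, mul_nonneg hn hGG, mul_nonneg hn hS0,
    mul_nonneg (mul_nonneg hn hn) hV, mul_nonneg (mul_nonneg hn hn) hGG]

lemma propD {ν : ℝ} (hν : 0 < ν) (l : Fin d) {r' : ℝ} (hr : 0 < r') :
    ∃ C, 0 < C ∧ ∃ ρ0, 0 < ρ0 ∧ ∀ ρ, 0 < ρ → ρ ≤ ρ0 → ∃ K, 0 < K ∧
      ∀ A : Fin d → Fin d → Eu d → ℝ, Coef ν A → Inv l A → ∀ g G, Sol A g G r' →
        EN g ρ ≤ C * ρ ^ d * EN g r' + K * GN G := by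
  classical
  have hcard : (Finset.univ.erase l).card + 1 = d := by
    rw [Finset.card_erase_of_mem (Finset.mem_univ l), Finset.card_univ, Fintype.card_fin]
    have := l.2
    omega
  have hins : insert l (Finset.univ.erase l) = (Finset.univ : Finset (Fin d)) :=
    Finset.insert_erase (Finset.mem_univ l)
  have H := fun i => slab_decay hν (good_FF hν l i) (Finset.univ.erase l) (by simp) (r' / 2) r'
    (by linarith) (by linarith)
  rw [hcard, hins] at H
  choose C hC ρ0 hρ0 H using H
  set K0 := 1 + ν⁻¹ ^ 2 * (3 + 3 * ν⁻¹ ^ 2) with hK0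
  have hK00 : 0 < K0 := by positivity
  have hne : (Finset.univ : Finset (Fin d)).Nonempty := ⟨l, Finset.mem_univ l⟩
  refine ⟨K0 * ∑ i, C i, mul_pos hK00 (Finset.sum_pos (fun i _ => hC i) hne),
    min (r' / 2) (Finset.univ.inf' hne ρ0), ?_, ?_⟩
  · refine lt_min (by linarith) ?_
    rw [Finset.lt_inf'_iff]
    exact fun i _ => hρ0 i
  intro ρ hρ hρm
  have hρi : ∀ i, ρ ≤ ρ0 i := fun i =>
    (hρm.trans (min_le_right _ _)).trans (Finset.inf'_le _ (Finset.mem_univ i))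
  choose K hK H using fun i => H i ρ hρ (hρi i)
  refine ⟨K0 * (∑ i, K i + 1), mul_pos hK00 (by
    have := Finset.sum_pos (fun i (_ : i ∈ Finset.univ) => hK i) hne
    linarith), ?_⟩
  intro A hA hI g G hS
  have hm := fun i => (good_FF hν l i).mem A hA g G r' hS
  have hi : ∀ i, IntegrableOn (fun x => FF l i A g G x ^ 2) (ball (0 : Eu d) ρ) := fun i =>
    (hm i).integrable_sq.integrableOn
  have hsub : ball (0 : Eu d) ρ ⊆ ball (0 : Eu d) (r' / 2) ∩ slab ρ Finset.univ := by
    refine subset_inter (ball_subset_ball (hρm.trans (min_le_left _ _))) ?_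
    intro x hx j _
    have : ‖x‖ < ρ := by simpa using hx
    exact (abs_coord_le x j).trans_lt this
  have h1 : ∀ i, ∫ x in ball (0 : Eu d) ρ, FF l i A g G x ^ 2
      ≤ C i * ρ ^ d * EN g r' + K i * GN G := fun i =>
    (sq_mono_set (hm i) hsub).trans (H i A hA hI g G hS)
  have is : IntegrableOn (fun x => ∑ i, FF l i A g G x ^ 2) (ball (0 : Eu d) ρ) :=
    integrable_finsetSum _ fun i _ => hi i
  have ig : IntegrableOn (fun x => ∑ i, G i x ^ 2) (ball (0 : Eu d) ρ) :=
    (GN_int hS.gm).integrableOn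
  have h2 : EN g ρ ≤ ∫ x in ball (0 : Eu d) ρ, K0 *
      (∑ i, FF l i A g G x ^ 2 + ∑ i, G i x ^ 2) :=
    integral_mono (EN_int hS.cd ρ) ((is.add ig).const_mul K0) fun x => FF_pt hν l hA g G x
  rw [integral_const_mul, integral_add is ig, integral_finsetSum _ fun i _ => hi i] at h2
  calc _ ≤ _ := h2
    _ ≤ K0 * (∑ i, (C i * ρ ^ d * EN g r' + K i * GN G) + GN G) := by
        gcongr
        · exact h1 _
        · exact setInt_le_GN hS.gm _
    _ = _ := by
        rw [Finset.sum_add_distrib, ← Finset.sum_mul, ← Finset.sum_mul, ← Finset.sum_mul]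
        ring

end PSch

namespace PSch
variable {d : ℕ}

lemma vol_ball (x : Eu d) {r : ℝ} (hr : 0 < r) :
    (volume : Measure (Eu d)).real (ball x r) = r ^ d * volume.real (ball (0 : Eu d) 1) := by
  have := Measure.addHaar_ball_of_pos (volume : Measure (Eu d)) x hr
  rw [measureReal_def, this, ENNReal.toReal_mul, ENNReal.toReal_ofReal (by positivity),
    measureReal_def]
  simp

lemma vol_pos : 0 < (volume : Measure (Eu d)).real (ball (0 : Eu d) 1) := by
  refine ENNReal.toReal_pos (measure_ball_pos _ _ one_pos).ne' measure_ball_lt_top.ne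

lemma poinc {g : Eu d → ℝ} (hg : ContDiff ℝ 1 g) (hc : HasCompactSupport g) {ρ : ℝ} (hρ : 0 < ρ) :
    ∃ c, ∫ x in ball (0 : Eu d) ρ, (g x - c) ^ 2 ≤ 2 ^ d * 4 * ρ ^ 2 * EN g (3 * ρ) := by
  set M := (2 * ρ) ^ 2 * EN g (3 * ρ) with hM
  have hM0 : 0 ≤ M := mul_nonneg (sq_nonneg _) (EN_nonneg _ _)
  obtain ⟨L, hL0, hL⟩ := bound_cs hg.continuous hc
  set B := ball (0 : Eu d) ρ with hB
  set B2 := ball (0 : Eu d) (2 * ρ) with hB2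
  have : IsFiniteMeasure ((volume : Measure (Eu d)).restrict B) :=
    ⟨by rw [Measure.restrict_apply_univ]; exact measure_ball_lt_top⟩
  have : IsFiniteMeasure ((volume : Measure (Eu d)).restrict B2) :=
    ⟨by rw [Measure.restrict_apply_univ]; exact measure_ball_lt_top⟩
  have bd : ∀ y x, ‖(g y - g x) ^ 2‖ ≤ (2 * L) ^ 2 := by
    intro y x
    rw [Real.norm_of_nonneg (sq_nonneg _)]
    have h1 := abs_le.1 (hL y)
    have h2 := abs_le.1 (hL x)
    exact sq_le_sq' (by linarith) (by linarith)
  have hgc := hg.continuous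
  have i1 : Integrable (Function.uncurry fun y x => (g y - g x) ^ 2)
      (((volume : Measure (Eu d)).restrict B).prod (volume.restrict B)) :=
    Integrable.of_bound (C := (2 * L) ^ 2) (Continuous.aestronglyMeasurable (by
      unfold Function.uncurry; fun_prop)) (Eventually.of_forall fun z => bd _ _)
  have i2 : Integrable (Function.uncurry fun x v => (g (x + v) - g x) ^ 2)
      (((volume : Measure (Eu d)).restrict B).prod (volume.restrict B2)) :=
    Integrable.of_bound (C := (2 * L) ^ 2) (Continuous.aestronglyMeasurable (by
      unfold Function.uncurry; fun_prop)) (Eventually.of_forall fun z => bd _ _)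
  have s1 : ∫ y in B, ∫ x in B, (g y - g x) ^ 2 = ∫ x in B, ∫ y in B, (g y - g x) ^ 2 :=
    integral_integral_swap i1
  have s2 : ∫ x in B, ∫ v in B2, (g (x + v) - g x) ^ 2
      = ∫ v in B2, ∫ x in B, (g (x + v) - g x) ^ 2 := integral_integral_swap i2
  have h1 : ∫ x in B, ∫ y in B, (g y - g x) ^ 2 ≤ ∫ x in B, ∫ v in B2, (g (x + v) - g x) ^ 2 := by
    refine setIntegral_mono_on ?_ i2.integral_prod_left measurableSet_ball fun x hx => ?_
    · exact i1.integral_prod_right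
    have e := shift_set (fun y => (g y - g x) ^ 2) ((fun y => y + x) ⁻¹' B) x
    have e' : (fun y => y - x) ⁻¹' ((fun y => y + x) ⁻¹' B) = B := by ext; simp
    rw [e'] at e
    rw [← e]
    simp only [add_comm _ x]
    refine setIntegral_mono_set ?_ (Eventually.of_forall fun _ => sq_nonneg _)
      (LE.le.eventuallyLE ?_)
    · exact intB (f := fun v => (g (x + v) - g x) ^ 2) (by fun_prop) _ _
    · intro y hy
      simp only [hB, hB2, mem_preimage, mem_ball, dist_zero_right] at hy hx ⊢
      calc ‖y‖ = ‖(x + y) - x‖ := by simp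
        _ ≤ ‖x + y‖ + ‖x‖ := norm_sub_le _ _
        _ < 2 * ρ := by linarith
  have h2 : ∫ v in B2, ∫ x in B, (g (x + v) - g x) ^ 2 ≤ ∫ v in B2, M := by
    refine setIntegral_mono_on i2.integral_prod_right (integrable_const M) measurableSet_ball fun v hv => ?_
    have hv' : ‖v‖ < 2 * ρ := by simpa [hB2] using hv
    have := L1 hg ρ v
    refine this.trans ?_
    have h3 : EN g (ρ + ‖v‖) ≤ EN g (3 * ρ) := EN_mono hg (by linarith)
    have := EN_nonneg g (ρ + ‖v‖)
    rw [hM]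
    gcongr
  rw [setIntegral_const, smul_eq_mul] at h2
  have hvB : 0 < (volume : Measure (Eu d)).real B := by
    rw [hB, vol_ball _ hρ]; exact mul_pos (by positivity) vol_pos
  have hB0 : (volume : Measure (Eu d)) B ≠ 0 := (measure_ball_pos _ _ hρ).ne'
  obtain ⟨y, -, hy⟩ := exists_le_setAverage (f := fun y => ∫ x in B, (g y - g x) ^ 2) hB0
    measure_ball_lt_top.ne i1.integral_prod_left
  refine ⟨g y, ?_⟩
  rw [setAverage_eq, smul_eq_mul, s1] at hy
  have e : ∀ x, (g x - g y) ^ 2 = (g y - g x) ^ 2 := fun x => by ring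
  simp only [e]
  refine hy.trans ?_
  rw [inv_mul_le_iff₀ hvB]
  refine h1.trans (s2.le.trans (h2.trans (le_of_eq ?_)))
  rw [hB, hB2, vol_ball _ hρ, vol_ball _ (by positivity), hM]
  ring

end PSch

namespace PSch
variable {d : ℕ}

lemma divFree_congr {V W : Fin d → Eu d → ℝ} {s : Set (Eu d)} (h : ∀ i, ∀ x ∈ s, V i x = W i x)
    (hV : DivFree V s) : DivFree W s := by
  intro φ hφ hc hs
  rw [← hV φ hφ hc hs]
  congr 1
  ext x
  refine Finset.sum_congr rfl fun i _ => ?_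
  by_cases hx : x ∈ tsupport φ
  · rw [h i x (hs hx)]
  · simp [pd_zero_of_notMem hx]

lemma integrable_VD' {V : Fin d → Eu d → ℝ} (hV : ∀ i, Integrable (V i))
    {φ : Eu d → ℝ} (hφ : ContDiff ℝ 1 φ) (hc : HasCompactSupport φ) :
    Integrable (fun x => ∑ i, V i x * pd i φ x) := by
  refine integrable_finsetSum _ fun i _ => ?_
  obtain ⟨L, hL0, hL⟩ := bound_cs (continuous_pd hφ i) (pd_compact hc i)
  exact (hV i).mul_bdd (c := L) (continuous_pd hφ i).aestronglyMeasurable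
    (Eventually.of_forall fun x => hL x)

lemma divFree_sub' {V W : Fin d → Eu d → ℝ} {s : Set (Eu d)}
    (hV : ∀ i, Integrable (V i)) (hW : ∀ i, Integrable (W i))
    (h1 : DivFree V s) (h2 : DivFree W s) : DivFree (fun i x => V i x - W i x) s := by
  intro φ hφ hc hs
  simp only [sub_mul, Finset.sum_sub_distrib]
  rw [integral_sub (integrable_VD' hV hφ hc) (integrable_VD' hW hφ hc), h1 φ hφ hc hs,
    h2 φ hφ hc hs, sub_zero]

lemma integrable_flux {ν : ℝ} (hν : 0 < ν) {a : Fin d → Fin d → Eu d → ℝ} (ha : Coef ν a)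
    {u : Eu d → ℝ} (hu : ContDiff ℝ 1 u) (hc : HasCompactSupport u) {f : Fin d → Eu d → ℝ}
    (hf : ∀ i, Integrable (f i)) (i : Fin d) : Integrable (flux a u f i) := by
  unfold flux
  refine Integrable.sub (integrable_finsetSum _ fun j _ => ?_) (hf i)
  exact ((continuous_pd hu j).integrable_of_hasCompactSupport (pd_compact hc j)).bdd_mul (c := ν⁻¹)
    (ha.meas i j).aestronglyMeasurable (Eventually.of_forall fun x => coef_le hν ha i j x)

lemma diffSol {ν : ℝ} (hν : 0 < ν) {a : Fin d → Fin d → Eu d → ℝ} (ha : Coef ν a)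
    {u : Eu d → ℝ} (hu : ContDiff ℝ 1 u) (hc : HasCompactSupport u) {f : Fin d → Eu d → ℝ}
    (hf : ∀ i, Integrable (f i)) (hd : DivFree (flux a u f) (ball 0 1)) {κf κa : ℝ} {v : Eu d}
    (hκf : 0 ≤ κf)
    (hfv : ∀ i, ∀ x ∈ ball (0 : Eu d) 1, x + v ∈ ball (0 : Eu d) 1 → |f i (x + v) - f i x| ≤ κf)
    (hav : ∀ i j, ∀ x ∈ ball (0 : Eu d) 1, x + v ∈ ball (0 : Eu d) 1 →
      |a i j (x + v) - a i j x| ≤ κa)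
    (hv : ‖v‖ ≤ 1 / 16) :
    ∃ G, Sol a (df v u) G (15 / 16) ∧
      GN G ≤ (2 * d * volume.real (ball (0 : Eu d) 1) + 2 * d ^ 2) * (κf ^ 2 + κa ^ 2 * EN u 1) := by
  set B := ball (0 : Eu d) (15 / 16) with hB
  have hBm : MeasurableSet B := measurableSet_ball
  have hB1 : B ⊆ ball (0 : Eu d) 1 := ball_subset_ball (by norm_num)
  have hBv : ∀ x ∈ B, x + v ∈ ball (0 : Eu d) 1 := by
    intro x hx
    simp only [hB, mem_ball, dist_zero_right] at hx ⊢
    have := norm_add_le x v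
    linarith
  set P : Fin d → Eu d → ℝ := fun i x => ∑ j, (a i j (x + v) - a i j x) * pd j u (x + v) with hP
  have hPm : ∀ i, MemLp (P i) 2 (volume : Measure (Eu d)) := by
    intro i
    refine memLp_finsetSum _ fun j _ => ?_
    refine ((memLp_shift (memLp_pd hu hc j) v).const_mul (2 * ν⁻¹)).mono ?_ ?_
    · refine AEStronglyMeasurable.mul ?_ ?_
      · exact (((ha.meas i j).comp (measurable_id.add_const v)).sub (ha.meas i j)).aestronglyMeasurable
      · exact ((continuous_pd hu j).comp (by fun_prop)).aestronglyMeasurable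
    · refine Eventually.of_forall fun x => ?_
      simp only [norm_mul, Real.norm_eq_abs]
      rw [abs_of_pos (by positivity : 0 < ν⁻¹), abs_two]
      refine mul_le_mul_of_nonneg_right ?_ (abs_nonneg _)
      have h1 := abs_le.1 (coef_le hν ha i j (x + v))
      have h2 := abs_le.1 (coef_le hν ha i j x)
      exact abs_le.2 ⟨by linarith, by linarith⟩
  have hfm : ∀ i, MemLp (B.indicator (df v (f i))) 2 (volume : Measure (Eu d)) := by
    intro i
    rw [memLp_indicator_iff_restrict hBm]
    have : IsFiniteMeasure ((volume : Measure (Eu d)).restrict B) :=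
      ⟨by rw [Measure.restrict_apply_univ]; exact measure_ball_lt_top⟩
    refine MemLp.of_bound (C := κf) ?_ ?_
    · exact (((hf i).comp_add_right v).sub (hf i)).aestronglyMeasurable.restrict
    · exact (ae_restrict_iff' hBm).2 (Eventually.of_forall fun x hx => hfv i x (hB1 hx) (hBv x hx))
  refine ⟨fun i x => B.indicator (df v (f i)) x - B.indicator (P i) x, ?_, ?_⟩
  · refine ⟨df_cd hu v, df_cs hc v, fun i => (hfm i).sub ((hPm i).indicator hBm), ?_⟩
    have i1 := integrable_flux hν ha hu hc hf
    have h1 := divFree_sub' (fun i => (i1 i).comp_add_right v) i1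
      (divFree_shift hd (r := 15 / 16) (v := v) (by linarith)) (divFree_mono hd hB1)
    refine divFree_congr ?_ h1
    intro i x hx
    simp only [flux, indicator_of_mem (show x ∈ B from hx), hP, pd_df hu]
    rw [show df v (f i) x = f i (x + v) - f i x from rfl]
    simp only [mul_sub, sub_mul, Finset.sum_sub_distrib]
    ring
  · have hpt : ∀ x, ∑ i, (B.indicator (df v (f i)) x - B.indicator (P i) x) ^ 2
        ≤ B.indicator (fun x => 2 * d * κf ^ 2 + 2 * d ^ 2 * κa ^ 2 * ∑ j, pd j u (x + v) ^ 2) x := by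
      intro x
      by_cases hx : x ∈ B
      · simp only [indicator_of_mem hx]
        set S := ∑ j, pd j u (x + v) ^ 2 with hS
        have h1 : ∀ i, (df v (f i) x - P i x) ^ 2 ≤ 2 * κf ^ 2 + 2 * d * κa ^ 2 * S := by
          intro i
          have h2 : (df v (f i) x) ^ 2 ≤ κf ^ 2 := sq_le_sq'
            (abs_le.1 (hfv i x (hB1 hx) (hBv x hx))).1 (abs_le.1 (hfv i x (hB1 hx) (hBv x hx))).2
          have h3 : (P i x) ^ 2 ≤ d * κa ^ 2 * S := by
            refine (Finset.sum_mul_sq_le_sq_mul_sq _ _ _).trans ?_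
            refine mul_le_mul_of_nonneg_right ?_ (Finset.sum_nonneg fun _ _ => sq_nonneg _)
            calc _ ≤ ∑ j : Fin d, κa ^ 2 := Finset.sum_le_sum fun j _ => sq_le_sq'
                  (abs_le.1 (hav i j x (hB1 hx) (hBv x hx))).1
                  (abs_le.1 (hav i j x (hB1 hx) (hBv x hx))).2
              _ = _ := by simp
          nlinarith [sq_nonneg (df v (f i) x + P i x)]
        calc _ ≤ ∑ i : Fin d, (2 * κf ^ 2 + 2 * d * κa ^ 2 * S) :=
              Finset.sum_le_sum fun i _ => h1 i
          _ = _ := by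
              rw [Finset.sum_const, Finset.card_univ, Fintype.card_fin, nsmul_eq_mul]; ring
      · simp [indicator_of_notMem hx]
    have iu : IntegrableOn (fun x => ∑ j, pd j u (x + v) ^ 2) B :=
      shift_int (f := fun x => ∑ j, pd j u x ^ 2) (by linarith) (EN_int hu 1)
    have ik : IntegrableOn (fun _ : Eu d => 2 * d * κf ^ 2) B :=
      integrableOn_const measure_ball_lt_top.ne
    have iu' : IntegrableOn (fun x => 2 * d ^ 2 * κa ^ 2 * ∑ j, pd j u (x + v) ^ 2) B :=
      iu.const_mul _
    have h1 : GN (fun i x => B.indicator (df v (f i)) x - B.indicator (P i) x) ≤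
        ∫ x in B, (2 * d * κf ^ 2 + 2 * d ^ 2 * κa ^ 2 * ∑ j, pd j u (x + v) ^ 2) := by
      rw [← integral_indicator hBm]
      refine integral_mono (GN_int fun i => (hfm i).sub ((hPm i).indicator hBm)) ?_ hpt
      rw [integrable_indicator_iff hBm]
      exact ik.add iu'
    rw [integral_add ik iu', setIntegral_const, integral_const_mul, smul_eq_mul] at h1
    have h2 : ∫ x in B, ∑ j, pd j u (x + v) ^ 2 ≤ EN u 1 :=
      shift_le (f := fun x => ∑ j, pd j u x ^ 2) (by linarith) (EN_int hu 1)
        fun _ => Finset.sum_nonneg fun _ _ => sq_nonneg _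
    have h3 : volume.real B ≤ volume.real (ball (0 : Eu d) 1) :=
      measureReal_mono hB1 measure_ball_lt_top.ne
    have hE := EN_nonneg u 1
    set vol := volume.real (ball (0 : Eu d) 1)
    have hvol : 0 ≤ vol := measureReal_nonneg
    calc _ ≤ _ := h1
      _ ≤ vol * (2 * d * κf ^ 2) + 2 * d ^ 2 * κa ^ 2 * EN u 1 := by gcongr
      _ ≤ _ := by
          have : 0 ≤ 2 * d * vol * (κa ^ 2 * EN u 1) + 2 * (d : ℝ) ^ 2 * κf ^ 2 := by positivity
          nlinarith

lemma freeze {ν : ℝ} (hν : 0 < ν) (l : Fin d) {a : Fin d → Fin d → Eu d → ℝ} (ha : Coef ν a)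
    {η : ℝ} (hη : ∀ i j, ∀ x ∈ ball (0 : Eu d) 1, ∀ y ∈ ball (0 : Eu d) 1, x l = y l →
      |a i j x - a i j y| ≤ η) {g : Eu d → ℝ} {G : Fin d → Eu d → ℝ} {r : ℝ} (hr : r ≤ 1)
    (hS : Sol a g G r) :
    ∃ A G', Coef ν A ∧ Inv l A ∧ Sol A g G' r ∧ GN G' ≤ 2 * GN G + 2 * d ^ 2 * η ^ 2 * EN g r := by
  set π : Eu d → Eu d := fun x => x l • eb l with hπ
  have hπm : Measurable π := by
    have : Continuous π := by fun_prop
    exact this.measurable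
  have hπl : ∀ x, (π x) l = x l := fun x => by simp [hπ, eb_same]
  have hπn : ∀ x, ‖π x‖ ≤ ‖x‖ := fun x => by
    rw [hπ]; simp only [norm_smul, norm_eb, mul_one]; exact abs_coord_le x l
  set A : Fin d → Fin d → Eu d → ℝ := fun i j x => a i j (π x) with hA
  have hAc : Coef ν A := ⟨fun i j => (ha.meas i j).comp hπm, fun x => ha.ell (π x),
    fun x => ha.bdd (π x)⟩
  have hAI : Inv l A := fun i j x y h => by simp only [hA, hπ, h]
  set B := ball (0 : Eu d) r with hB
  have hBm : MeasurableSet B := measurableSet_ball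
  set P : Fin d → Eu d → ℝ := fun i x => ∑ j, (A i j x - a i j x) * pd j g x with hP
  have hPm : ∀ i, MemLp (P i) 2 (volume : Measure (Eu d)) := by
    intro i
    refine memLp_finsetSum _ fun j _ => ?_
    refine ((memLp_pd hS.cd hS.cs j).const_mul (2 * ν⁻¹)).mono ?_ ?_
    · refine AEStronglyMeasurable.mul ?_ ?_
      · exact ((hAc.meas i j).sub (ha.meas i j)).aestronglyMeasurable
      · exact (continuous_pd hS.cd j).aestronglyMeasurable
    · refine Eventually.of_forall fun x => ?_
      simp only [norm_mul, Real.norm_eq_abs]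
      rw [abs_of_pos (by positivity : 0 < ν⁻¹), abs_two]
      refine mul_le_mul_of_nonneg_right ?_ (abs_nonneg _)
      have h1 := abs_le.1 (coef_le hν hAc i j x)
      have h2 := abs_le.1 (coef_le hν ha i j x)
      exact abs_le.2 ⟨by linarith, by linarith⟩
  have hG'm : ∀ i, MemLp (fun x => G i x + B.indicator (P i) x) 2 (volume : Measure (Eu d)) :=
    fun i => (hS.gm i).add ((hPm i).indicator hBm)
  refine ⟨A, fun i x => G i x + B.indicator (P i) x, hAc, hAI, ⟨hS.cd, hS.cs, hG'm, ?_⟩, ?_⟩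
  · refine divFree_congr ?_ hS.df
    intro i x hx
    simp only [flux, indicator_of_mem (show x ∈ B from hx), hP]
    simp only [sub_mul, Finset.sum_sub_distrib]
    ring
  · have hpt : ∀ x, ∑ i, (G i x + B.indicator (P i) x) ^ 2
        ≤ 2 * ∑ i, G i x ^ 2 +
          B.indicator (fun x => 2 * d ^ 2 * η ^ 2 * ∑ j, pd j g x ^ 2) x := by
      intro x
      by_cases hx : x ∈ B
      · simp only [indicator_of_mem hx]
        set S := ∑ j, pd j g x ^ 2 with hS
        have hx1 : x ∈ ball (0 : Eu d) 1 := ball_subset_ball hr hx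
        have hx2 : π x ∈ ball (0 : Eu d) 1 := by
          have := hπn x
          simp only [mem_ball, dist_zero_right] at hx1 ⊢
          linarith
        have h1 : ∀ i, (G i x + P i x) ^ 2 ≤ 2 * G i x ^ 2 + 2 * d * η ^ 2 * S := by
          intro i
          have h3 : (P i x) ^ 2 ≤ d * η ^ 2 * S := by
            refine (Finset.sum_mul_sq_le_sq_mul_sq _ _ _).trans ?_
            refine mul_le_mul_of_nonneg_right ?_ (Finset.sum_nonneg fun _ _ => sq_nonneg _)
            calc _ ≤ ∑ j : Fin d, η ^ 2 := Finset.sum_le_sum fun j _ => by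
                  have := abs_le.1 (hη i j (π x) hx2 x hx1 (hπl x))
                  exact sq_le_sq' this.1 this.2
              _ = _ := by simp
          nlinarith [sq_nonneg (G i x - P i x)]
        calc _ ≤ ∑ i : Fin d, (2 * G i x ^ 2 + 2 * d * η ^ 2 * S) :=
              Finset.sum_le_sum fun i _ => h1 i
          _ = _ := by
              rw [Finset.sum_add_distrib, Finset.sum_const, Finset.card_univ, Fintype.card_fin,
                nsmul_eq_mul, ← Finset.mul_sum]; ring
      · simp only [indicator_of_notMem hx, add_zero]
        have : 0 ≤ ∑ i, G i x ^ 2 := Finset.sum_nonneg fun _ _ => sq_nonneg _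
        linarith
    have iG : Integrable (fun x => 2 * ∑ i, G i x ^ 2) := (GN_int hS.gm).const_mul 2
    have iE : Integrable (B.indicator (fun x => 2 * d ^ 2 * η ^ 2 * ∑ j, pd j g x ^ 2)) := by
      rw [integrable_indicator_iff hBm]
      exact (EN_int hS.cd r).const_mul _
    have h1 := integral_mono (GN_int hG'm) (iG.add iE) hpt
    have e : ∫ x, (2 * ∑ i, G i x ^ 2 +
          B.indicator (fun x => 2 * d ^ 2 * η ^ 2 * ∑ j, pd j g x ^ 2) x)
          = 2 * GN G + 2 * d ^ 2 * η ^ 2 * EN g r := by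
      rw [integral_add iG iE, integral_indicator hBm, integral_const_mul, integral_const_mul]
      rfl
    exact h1.trans e.le

end PSch

namespace PSch
variable {d : ℕ}

lemma oneStep_aux {γ : ℝ} (hγ1 : γ < 1) (d : ℕ) {C3 ρ0 : ℝ} (hC3 : 0 < C3) (hρ0 : 0 < ρ0) :
    ∃ ρ, 0 < ρ ∧ ρ ≤ ρ0 ∧ ρ ≤ 1 / 4 ∧ C3 * ρ ^ (d + 2) ≤ (1 / 6) * (ρ ^ d * ρ ^ (2 * γ)) := by
  have hlim : Tendsto (fun ρ : ℝ => C3 * ρ ^ (2 - 2 * γ)) (nhdsWithin 0 (Ioi 0)) (nhds 0) := by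
    have h1 : ContinuousAt (fun ρ : ℝ => C3 * ρ ^ (2 - 2 * γ)) 0 :=
      continuousAt_const.mul (Real.continuousAt_rpow_const 0 _ (Or.inr (by linarith)))
    have h2 : C3 * (0 : ℝ) ^ (2 - 2 * γ) = 0 := by
      rw [Real.zero_rpow (by linarith), mul_zero]
    have h3 := h1.tendsto
    rw [h2] at h3
    exact h3.mono_left nhdsWithin_le_nhds
  have hev := hlim.eventually (gt_mem_nhds (show (0 : ℝ) < 1 / 6 by norm_num))
  have hev2 : ∀ᶠ ρ : ℝ in nhdsWithin 0 (Ioi 0), ρ ∈ Ioo 0 (min ρ0 (1 / 4)) :=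
    Ioo_mem_nhdsGT (by positivity)
  obtain ⟨ρ, h1, h2, h3⟩ := (hev.and hev2).exists
  refine ⟨ρ, h2, h3.le.trans (min_le_left _ _), h3.le.trans (min_le_right _ _), ?_⟩
  have e : ρ ^ (d + 2) = ρ ^ d * (ρ ^ (2 * γ) * ρ ^ (2 - 2 * γ)) := by
    rw [← Real.rpow_add h2, pow_add]
    congr 1
    rw [show 2 * γ + (2 - 2 * γ) = (2 : ℕ) by push_cast; ring, Real.rpow_natCast]
  rw [e]
  have h4 : 0 < ρ ^ d * ρ ^ (2 * γ) := by positivity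
  nlinarith

lemma small_sq {X Y : ℝ} (hX : 0 ≤ X) (hY : 0 < Y) : ∃ h, 0 < h ∧ h ≤ 1 / 16 ∧ X * h ^ 2 ≤ Y := by
  refine ⟨min (1 / 16) (Y / (X + 1)), by positivity, min_le_left _ _, ?_⟩
  set h := min (1 / 16) (Y / (X + 1)) with hh
  have h0 : 0 < h := by positivity
  have h1 : h ≤ 1 / 16 := min_le_left _ _
  have h2 : h ≤ Y / (X + 1) := min_le_right _ _
  rw [le_div_iff₀ (by positivity)] at h2
  have : X * h ^ 2 ≤ X * h := by
    refine mul_le_mul_of_nonneg_left ?_ hX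
    nlinarith
  nlinarith

lemma sq_aux (p g c : ℝ) : (p - c) ^ 2 ≤ 2 * (g - p) ^ 2 + 2 * (g - c) ^ 2 := by
  nlinarith [sq_nonneg ((g - p) + (g - c))]

set_option maxHeartbeats 2000000 in
lemma oneStep {ν γ : ℝ} (hν : 0 < ν) (hγ1 : γ < 1) {l k : Fin d} (hk : k ≠ l) :
    ∃ ρ, 0 < ρ ∧ ρ ≤ 1 / 4 ∧ ∃ η, 0 < η ∧ ∃ C, 0 < C ∧
      ∀ a : Fin d → Fin d → Eu d → ℝ, Coef ν a →
      (∀ i j, ∀ x ∈ ball (0 : Eu d) 1, ∀ y ∈ ball (0 : Eu d) 1, x l = y l →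
        |a i j x - a i j y| ≤ η) →
      ∀ u : Eu d → ℝ, ContDiff ℝ 1 u → HasCompactSupport u → ∀ f : Fin d → Eu d → ℝ,
      (∀ i, Integrable (f i)) → DivFree (flux a u f) (ball 0 1) → ∀ κf κa : ℝ, 0 ≤ κf →
      (∀ s : ℝ, 0 ≤ s → s ≤ 1 → ∀ i, ∀ x ∈ ball (0 : Eu d) 1, x + s • eb k ∈ ball (0 : Eu d) 1 →
        |f i (x + s • eb k) - f i x| ≤ κf) →
      (∀ s : ℝ, 0 ≤ s → s ≤ 1 → ∀ i j, ∀ x ∈ ball (0 : Eu d) 1, x + s • eb k ∈ ball (0 : Eu d) 1 →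
        |a i j (x + s • eb k) - a i j x| ≤ κa) →
      ∀ c, ∃ c', ∫ x in ball (0 : Eu d) ρ, (pd k u x - c') ^ 2 ≤
        (1 / 2) * (ρ ^ d * ρ ^ (2 * γ)) * (∫ x in ball (0 : Eu d) 1, (pd k u x - c) ^ 2)
          + C * (κf ^ 2 + κa ^ 2 * EN u 1) := by
  obtain ⟨C1, hC1, hcacc⟩ := cacc (d := d) hν (r := 3 / 4) (r' := 7 / 8) (by norm_num) (by norm_num)
  obtain ⟨C2, hC2, ρ0, hρ0, hD⟩ := propD (d := d) hν l (r' := 3 / 4) (by norm_num)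
  set Cg : ℝ := 2 * d * volume.real (ball (0 : Eu d) 1) + 2 * d ^ 2 with hCg
  have hCg0 : 0 ≤ Cg := by
    have : 0 ≤ volume.real (ball (0 : Eu d) 1) := measureReal_nonneg
    positivity
  set P : ℝ := 2 * (2 ^ d * 4) with hP
  have hP0 : 0 < P := by positivity
  obtain ⟨ρ, hρ, hρ1, hρ4, hρ3⟩ := oneStep_aux hγ1 d (C3 := P * C2 * 3 ^ d * C1) (ρ0 := ρ0 / 3)
    (by positivity) (by positivity)
  obtain ⟨K, hK, hDK⟩ := hD (3 * ρ) (by positivity) (by linarith)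
  set T := ρ ^ d * ρ ^ (2 * γ) with hT
  have hT0 : 0 < T := by positivity
  obtain ⟨h, hh0, hh1, hh2⟩ := small_sq (X := 2 * C1) (Y := (1 / 6) * T) (by positivity) (by positivity)
  obtain ⟨η, hη0, hη1, hη2⟩ := small_sq (X := P * ρ ^ 2 * K * 2 * d ^ 2 * C1) (Y := (1 / 6) * T)
    (by positivity) (by positivity)
  refine ⟨ρ, hρ, hρ4, η, hη0, (h ^ 2)⁻¹ * (T * Cg + P * ρ ^ 2 * K * 2 * Cg) + 1, by positivity, ?_⟩
  intro a ha hηa u hu hc f hf hdf κf κa hκf hff hfa c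
  set Q := κf ^ 2 + κa ^ 2 * EN u 1 with hQ
  have hQ0 : 0 ≤ Q := by have := EN_nonneg u 1; positivity
  set Φ := ∫ x in ball (0 : Eu d) 1, (pd k u x - c) ^ 2 with hΦ
  have hΦ0 : 0 ≤ Φ := integral_nonneg fun _ => sq_nonneg _
  have hpc : Continuous fun x => pd k u x - c := (continuous_pd hu k).sub continuous_const
  have hns : ∀ s : ℝ, 0 ≤ s → ‖s • (eb k : Eu d)‖ = s := fun s hs => by
    rw [norm_smul, norm_eb, mul_one, Real.norm_of_nonneg hs]
  have hsol : ∀ s : ℝ, 0 ≤ s → s ≤ 1 / 16 → ∃ G, Sol a (df (s • eb k) u) G (15 / 16) ∧ GN G ≤ Cg * Q := by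
    intro s hs0 hs1
    exact diffSol hν ha hu hc hf hdf hκf (hff s hs0 (by linarith)) (hfa s hs0 (by linarith))
      (by rw [hns s hs0]; exact hs1)
  have hE : ∀ s : ℝ, 0 ≤ s → s ≤ 1 / 16 → EN (df (s • eb k) u) (3 / 4) ≤ C1 * (s ^ 2 * Φ + Cg * Q) := by
    intro s hs0 hs1
    obtain ⟨G, hG, hGN⟩ := hsol s hs0 hs1
    have h1 := hcacc a ha _ G (hG.mono (by norm_num)) (s * c)
    have h2 := L1k hu (7 / 8) s c k
    have h3 : ∫ x in ball (0 : Eu d) (7 / 8 + |s|), (pd k u x - c) ^ 2 ≤ Φ :=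
      setIntegral_mono_set (intB (hpc.pow 2) _ _) (Eventually.of_forall fun _ => sq_nonneg _)
        (LE.le.eventuallyLE (ball_subset_ball (by rw [abs_of_nonneg hs0]; linarith)))
    refine h1.trans ?_
    gcongr
    exact h2.trans (by gcongr)
  set E := C1 * (h ^ 2 * Φ + Cg * Q) with hEdef
  have hE0 : 0 ≤ E := by positivity
  set g := df (h • eb k) u with hg
  have hEg : EN g (3 / 4) ≤ E := hE h hh0.le hh1
  have hcmp : ∫ x in ball (0 : Eu d) (3 / 4), (g x - h * pd k u x) ^ 2 ≤ h ^ 2 * E := by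
    refine L1d hu hh0.le k fun t ht => ?_
    refine (EN_single (df_cd hu _) _ k).trans ((hE t ht.1 (ht.2.trans hh1)).trans ?_)
    have := ht.1
    have := ht.2
    rw [hEdef]
    gcongr
  obtain ⟨G, hG, hGN⟩ := hsol h hh0.le hh1
  obtain ⟨A, G', hA, hI, hS', hG'⟩ := freeze hν l ha hηa (r := 3 / 4) (by norm_num)
    (hG.mono (by norm_num))
  have hEd := hDK A hA hI g G' hS'
  obtain ⟨c'', hc''⟩ := poinc (df_cd hu (h • eb k)) (df_cs hc (h • eb k)) hρ
  refine ⟨c'' / h, ?_⟩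
  have hgc : Continuous g := (df_cd hu _).continuous
  have hpk := continuous_pd hu k
  have i1 : IntegrableOn (fun x => 2 * (g x - h * pd k u x) ^ 2) (ball (0 : Eu d) ρ) :=
    intB (by fun_prop) _ _
  have i2 : IntegrableOn (fun x => 2 * (g x - c'') ^ 2) (ball (0 : Eu d) ρ) :=
    intB (by fun_prop) _ _
  have key : ∫ x in ball (0 : Eu d) ρ, h ^ 2 * (pd k u x - c'' / h) ^ 2 ≤
      ∫ x in ball (0 : Eu d) ρ, (2 * (g x - h * pd k u x) ^ 2 + 2 * (g x - c'') ^ 2) := by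
    refine integral_mono (intB (by fun_prop) _ _) (i1.add i2) fun x => ?_
    have e : h ^ 2 * (pd k u x - c'' / h) ^ 2 = (h * pd k u x - c'') ^ 2 := by
      field_simp
    show h ^ 2 * (pd k u x - c'' / h) ^ 2 ≤ 2 * (g x - h * pd k u x) ^ 2 + 2 * (g x - c'') ^ 2
    rw [e]
    exact sq_aux _ _ _
  rw [integral_const_mul, integral_add i1 i2, integral_const_mul, integral_const_mul] at key
  have hcmp2 : ∫ x in ball (0 : Eu d) ρ, (g x - h * pd k u x) ^ 2 ≤ h ^ 2 * E :=
    (setIntegral_mono_set (intB (by fun_prop) _ _) (Eventually.of_forall fun _ => sq_nonneg _)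
      (LE.le.eventuallyLE (ball_subset_ball (by linarith)))).trans hcmp
  set I := ∫ x in ball (0 : Eu d) ρ, (pd k u x - c'' / h) ^ 2 with hIdef
  have hh20 : 0 < h ^ 2 := by positivity
  have k1 : h ^ 2 * I ≤ 2 * (h ^ 2 * E) + P * ρ ^ 2 *
      (C2 * (3 * ρ) ^ d * E + K * (2 * (Cg * Q) + 2 * d ^ 2 * η ^ 2 * E)) := by
    calc _ ≤ _ := key
      _ ≤ 2 * (h ^ 2 * E) + 2 * (2 ^ d * 4 * ρ ^ 2 * EN g (3 * ρ)) := by gcongr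
      _ = 2 * (h ^ 2 * E) + P * ρ ^ 2 * EN g (3 * ρ) := by rw [hP]; ring
      _ ≤ 2 * (h ^ 2 * E) + P * ρ ^ 2 * (C2 * (3 * ρ) ^ d * EN g (3 / 4) + K * GN G') := by
          gcongr
      _ ≤ 2 * (h ^ 2 * E) + P * ρ ^ 2 * (C2 * (3 * ρ) ^ d * E + K * (2 * (Cg * Q) +
            2 * d ^ 2 * η ^ 2 * E)) := by
          gcongr
          refine hG'.trans ?_
          gcongr
  have k2 : h ^ 2 * I ≤ (1 / 2) * T * (h ^ 2 * Φ + Cg * Q) + P * ρ ^ 2 * K * 2 * (Cg * Q) := by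
    have hW : 0 ≤ h ^ 2 * Φ + Cg * Q := by positivity
    set W := h ^ 2 * Φ + Cg * Q
    have e : 2 * (h ^ 2 * E) + P * ρ ^ 2 *
        (C2 * (3 * ρ) ^ d * E + K * (2 * (Cg * Q) + 2 * d ^ 2 * η ^ 2 * E))
        = (2 * C1 * h ^ 2 + P * C2 * 3 ^ d * C1 * ρ ^ (d + 2)
          + P * ρ ^ 2 * K * 2 * d ^ 2 * C1 * η ^ 2) * W + P * ρ ^ 2 * K * 2 * (Cg * Q) := by
      rw [hEdef, mul_pow]; ring
    rw [e] at k1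
    refine k1.trans ?_
    gcongr
    linarith
  have k3 : I ≤ (h ^ 2)⁻¹ * ((1 / 2) * T * (h ^ 2 * Φ + Cg * Q) + P * ρ ^ 2 * K * 2 * (Cg * Q)) := by
    rw [le_inv_mul_iff₀ hh20]; exact k2
  refine k3.trans ?_
  have e : (h ^ 2)⁻¹ * ((1 / 2) * T * (h ^ 2 * Φ + Cg * Q) + P * ρ ^ 2 * K * 2 * (Cg * Q))
      = 1 / 2 * T * Φ + (h ^ 2)⁻¹ * ((1 / 2) * T * Cg + P * ρ ^ 2 * K * 2 * Cg) * Q := by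
    field_simp
    ring
  rw [e]
  have : (h ^ 2)⁻¹ * ((1 / 2) * T * Cg + P * ρ ^ 2 * K * 2 * Cg) ≤
      (h ^ 2)⁻¹ * (T * Cg + P * ρ ^ 2 * K * 2 * Cg) + 1 := by
    have : (h ^ 2)⁻¹ * ((1 / 2) * T * Cg + P * ρ ^ 2 * K * 2 * Cg) ≤
      (h ^ 2)⁻¹ * (T * Cg + P * ρ ^ 2 * K * 2 * Cg) := by
      gcongr
      nlinarith [mul_nonneg hT0.le hCg0]
    linarith
  gcongr

end PSch

namespace PSch
variable {d : ℕ}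

/-- affine rescaling -/
def sc (x0 : Eu d) (R : ℝ) (x : Eu d) : Eu d := R • x + x0

lemma sc_int (x0 : Eu d) {R : ℝ} (hR : 0 < R) (H : Eu d → ℝ) :
    ∫ x, H (sc x0 R x) = (R ^ d)⁻¹ * ∫ y, H y := by
  have h1 := Measure.integral_comp_smul_of_nonneg (volume : Measure (Eu d)) (fun y => H (y + x0)) R
    (hR := hR.le)
  simp only [finrank_euclideanSpace, Fintype.card_fin, smul_eq_mul] at h1
  rw [integral_add_right_eq_self] at h1
  exact h1

lemma sc_mem {x0 : Eu d} {R r : ℝ} (hR : 0 < R) {x : Eu d} :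
    sc x0 R x ∈ ball x0 (R * r) ↔ x ∈ ball (0 : Eu d) r := by
  rw [mem_ball_iff_norm, mem_ball_zero_iff, sc, add_sub_cancel_right, norm_smul,
    Real.norm_of_nonneg hR.le, mul_lt_mul_iff_right₀ hR]

lemma sc_setInt (x0 : Eu d) {R : ℝ} (hR : 0 < R) (r : ℝ) (H : Eu d → ℝ) :
    ∫ x in ball (0 : Eu d) r, H (sc x0 R x) = (R ^ d)⁻¹ * ∫ y in ball x0 (R * r), H y := by
  rw [← integral_indicator measurableSet_ball, ← integral_indicator measurableSet_ball,
    ← sc_int x0 hR]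
  congr 1
  ext x
  by_cases hx : x ∈ ball (0 : Eu d) r
  · rw [indicator_of_mem hx, indicator_of_mem ((sc_mem hR).2 hx)]
  · rw [indicator_of_notMem hx, indicator_of_notMem (fun h => hx ((sc_mem hR).1 h))]

lemma sc_cd (x0 : Eu d) (R : ℝ) : ContDiff ℝ 1 (sc x0 R) := by
  unfold sc; fun_prop

lemma pd_sc {g : Eu d → ℝ} (hg : ContDiff ℝ 1 g) (x0 : Eu d) (R : ℝ) (i : Fin d) (x : Eu d) :
    pd i (fun y => g (sc x0 R y)) x = R * pd i g (sc x0 R x) := by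
  have h2 : HasFDerivAt (sc x0 R) (R • ContinuousLinearMap.id ℝ (Eu d)) x :=
    ((hasFDerivAt_id x).const_smul R).add_const x0
  have h := (differentiableAt_of_cd hg (sc x0 R x)).hasFDerivAt.comp x h2
  rw [pd_def, pd_def]
  have e : fderiv ℝ (fun y => g (sc x0 R y)) x = _ := h.fderiv
  rw [e]
  simp

/-- scaling as a homeomorphism -/
def scH (x0 : Eu d) {R : ℝ} (hR : 0 < R) : Eu d ≃ₜ Eu d :=
  (Homeomorph.smulOfNeZero R hR.ne').trans (Homeomorph.addRight x0)

lemma scH_apply (x0 : Eu d) {R : ℝ} (hR : 0 < R) (x : Eu d) : scH x0 hR x = sc x0 R x := rfl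

lemma sc_cs {g : Eu d → ℝ} (hg : HasCompactSupport g) (x0 : Eu d) {R : ℝ} (hR : 0 < R) :
    HasCompactSupport fun y => g (sc x0 R y) :=
  hg.comp_homeomorph (scH x0 hR)

lemma sc_inv (x0 : Eu d) {R : ℝ} (hR : 0 < R) (y : Eu d) :
    sc (-(R⁻¹ • x0)) R⁻¹ (sc x0 R y) = y := by
  simp [sc, smul_smul, hR.ne']

lemma sc_inv' (x0 : Eu d) {R : ℝ} (hR : 0 < R) (y : Eu d) :
    sc x0 R (sc (-(R⁻¹ • x0)) R⁻¹ y) = y := by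
  simp [sc, smul_smul, hR.ne']

lemma sc_tsupport {g : Eu d → ℝ} {s : Set (Eu d)} (x0 : Eu d) {R : ℝ} (h : tsupport g ⊆ s) :
    tsupport (fun y => g (sc x0 R y)) ⊆ sc x0 R ⁻¹' s :=
  (tsupport_comp_subset_preimage g (sc_cd x0 R).continuous).trans (preimage_mono h)

lemma step {ν γ : ℝ} (hν : 0 < ν) (hγ1 : γ < 1) {l k : Fin d} (hk : k ≠ l) :
    ∃ ρ, 0 < ρ ∧ ρ ≤ 1 / 4 ∧ ∃ η, 0 < η ∧ ∃ C, 0 < C ∧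
      ∀ a : Fin d → Fin d → Eu d → ℝ, Coef ν a →
      ∀ (x0 : Eu d) (R : ℝ), 0 < R →
      (∀ i j, ∀ x ∈ ball x0 R, ∀ y ∈ ball x0 R, x l = y l → |a i j x - a i j y| ≤ η) →
      ∀ u : Eu d → ℝ, ContDiff ℝ 1 u → HasCompactSupport u → ∀ f : Fin d → Eu d → ℝ,
      (∀ i, Integrable (f i)) → DivFree (flux a u f) (ball x0 R) → ∀ κf κa : ℝ, 0 ≤ κf →
      (∀ s : ℝ, 0 ≤ s → s ≤ R → ∀ i, ∀ x ∈ ball x0 R, x + s • eb k ∈ ball x0 R →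
        |f i (x + s • eb k) - f i x| ≤ κf) →
      (∀ s : ℝ, 0 ≤ s → s ≤ R → ∀ i j, ∀ x ∈ ball x0 R, x + s • eb k ∈ ball x0 R →
        |a i j (x + s • eb k) - a i j x| ≤ κa) →
      ∀ c, ∃ c', ∫ x in ball x0 (R * ρ), (pd k u x - c') ^ 2 ≤
        (1 / 2) * (ρ ^ d * ρ ^ (2 * γ)) * (∫ x in ball x0 R, (pd k u x - c) ^ 2)
          + C * (R ^ d * κf ^ 2 + κa ^ 2 * ∫ x in ball x0 R, ∑ i, pd i u x ^ 2) := by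
  obtain ⟨ρ, hρ, hρ4, η, hη, C, hC, H⟩ := oneStep (d := d) hν hγ1 hk
  refine ⟨ρ, hρ, hρ4, η, hη, C, hC, ?_⟩
  intro a ha x0 R hR hηa u hu hc f hf hdf κf κa hκf hff hfa c
  have hmem : ∀ x : Eu d, x ∈ ball (0 : Eu d) 1 → sc x0 R x ∈ ball x0 R := fun x hx => by
    have := (sc_mem (x0 := x0) hR).2 hx
    rwa [mul_one] at this
  have hshift : ∀ (s : ℝ) (x : Eu d), sc x0 R (x + s • eb k) = sc x0 R x + (R * s) • eb k := by
    intro s x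
    simp only [sc, smul_add, smul_smul]
    abel
  set u' : Eu d → ℝ := fun x => R⁻¹ * u (sc x0 R x) with hu'
  have husc : ContDiff ℝ 1 fun x => u (sc x0 R x) := hu.comp (sc_cd x0 R)
  have hpd : ∀ i x, pd i u' x = pd i u (sc x0 R x) := by
    intro i x
    rw [hu', pd_const_mul _ _ (differentiableAt_of_cd husc x), pd_sc hu, ← mul_assoc,
      inv_mul_cancel₀ hR.ne', one_mul]
  have hinj : ∀ x y : Eu d, x l = y l → sc x0 R x l = sc x0 R y l := by
    intro x y h
    simp [sc, h]
  have hd : DivFree (flux (fun i j x => a i j (sc x0 R x)) u' (fun i x => f i (sc x0 R x)))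
      (ball 0 1) := by
    intro φ hφ hφc hφs
    have hψ : ContDiff ℝ 1 fun y => φ (sc (-(R⁻¹ • x0)) R⁻¹ y) := hφ.comp (sc_cd _ _)
    have h0 := hdf (fun y => φ (sc (-(R⁻¹ • x0)) R⁻¹ y)) hψ (sc_cs hφc _ (inv_pos.2 hR)) (by
      refine (sc_tsupport _ hφs).trans ?_
      intro y hy
      have := hmem _ hy
      rwa [sc_inv' x0 hR] at this)
    have h1 := sc_int x0 hR (fun y => ∑ i, flux a u f i y * pd i (fun y => φ (sc (-(R⁻¹ • x0)) R⁻¹ y)) y)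
    rw [h0, mul_zero] at h1
    have e : ∀ x, ∑ i, flux a u f i (sc x0 R x) *
        pd i (fun y => φ (sc (-(R⁻¹ • x0)) R⁻¹ y)) (sc x0 R x) = R⁻¹ *
        ∑ i, flux (fun i j x => a i j (sc x0 R x)) u' (fun i x => f i (sc x0 R x)) i x * pd i φ x := by
      intro x
      rw [Finset.mul_sum]
      refine Finset.sum_congr rfl fun i _ => ?_
      rw [pd_sc hφ, sc_inv x0 hR]
      simp only [flux, hpd]
      ring
    simp only [e] at h1
    rw [integral_const_mul] at h1
    exact (mul_eq_zero.1 h1).resolve_left (inv_ne_zero hR.ne')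
  obtain ⟨c', hc'⟩ := H (fun i j x => a i j (sc x0 R x))
    ⟨fun i j => (ha.meas i j).comp (sc_cd x0 R).continuous.measurable,
      fun x ξ => ha.ell _ ξ, fun x => ha.bdd _⟩
    (fun i j x hx y hy h => hηa i j _ (hmem x hx) _ (hmem y hy) (hinj x y h))
    u' (contDiff_const.mul husc) ((sc_cs hc x0 hR).mul_left (f := fun _ => R⁻¹))
    (fun i x => f i (sc x0 R x))
    (fun i => by
      have := ((hf i).comp_add_right x0).comp_smul hR.ne'
      exact this)
    hd κf κa hκf
    (fun s hs0 hs1 i x hx hx' => by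
      have := hmem _ hx'
      rw [hshift] at this ⊢
      exact hff (R * s) (by positivity) (by nlinarith) i _ (hmem x hx) this)
    (fun s hs0 hs1 i j x hx hx' => by
      have := hmem _ hx'
      rw [hshift] at this ⊢
      exact hfa (R * s) (by positivity) (by nlinarith) i j _ (hmem x hx) this) c
  refine ⟨c', ?_⟩
  simp only [EN, hpd] at hc'
  rw [sc_setInt x0 hR ρ (fun y => (pd k u y - c') ^ 2), sc_setInt x0 hR 1 (fun y => (pd k u y - c) ^ 2),
    sc_setInt x0 hR 1 (fun y => ∑ i, pd i u y ^ 2), mul_one] at hc'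
  have hRd : 0 < R ^ d := by positivity
  have := mul_le_mul_of_nonneg_left hc' hRd.le
  rw [mul_inv_cancel_left₀ hRd.ne'] at this
  refine this.trans (le_of_eq ?_)
  field_simp

end PSch

namespace PSch
variable {d : ℕ}

lemma avg_diff {v : Eu d → ℝ} (hv : Continuous v) {x y z : Eu d} {r R1 R2 c c' X Y : ℝ} (hr : 0 < r)
    (h1 : ball z r ⊆ ball x R1) (h2 : ball z r ⊆ ball y R2)
    (hX : ∫ w in ball x R1, (v w - c) ^ 2 ≤ X) (hY : ∫ w in ball y R2, (v w - c') ^ 2 ≤ Y) :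
    (c - c') ^ 2 * (r ^ d * volume.real (ball (0 : Eu d) 1)) ≤ 2 * (X + Y) := by
  have m1 : ∫ w in ball z r, (v w - c) ^ 2 ≤ X :=
    (setIntegral_mono_set (intB (by fun_prop) _ _) (Eventually.of_forall fun _ => sq_nonneg _)
      (LE.le.eventuallyLE h1)).trans hX
  have m2 : ∫ w in ball z r, (v w - c') ^ 2 ≤ Y :=
    (setIntegral_mono_set (intB (by fun_prop) _ _) (Eventually.of_forall fun _ => sq_nonneg _)
      (LE.le.eventuallyLE h2)).trans hY
  have i1 : IntegrableOn (fun w => 2 * (v w - c) ^ 2) (ball z r) := intB (by fun_prop) _ _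
  have i2 : IntegrableOn (fun w => 2 * (v w - c') ^ 2) (ball z r) := intB (by fun_prop) _ _
  have key : ∫ w in ball z r, (c - c') ^ 2 ≤
      ∫ w in ball z r, (2 * (v w - c) ^ 2 + 2 * (v w - c') ^ 2) := by
    refine integral_mono (intB (by fun_prop) _ _) (i1.add i2) fun w => ?_
    exact sq_aux _ _ _
  rw [integral_add i1 i2, setIntegral_const, integral_const_mul, integral_const_mul, vol_ball z hr,
    smul_eq_mul] at key
  nlinarith

lemma int_small {v : Eu d → ℝ} (hv : Continuous v) (x : Eu d) {ε : ℝ} (hε : 0 < ε) :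
    ∃ r0, 0 < r0 ∧ ∀ r, 0 < r → r ≤ r0 → ∫ w in ball x r, (v w - v x) ^ 2 ≤
      ε ^ 2 * (r ^ d * volume.real (ball (0 : Eu d) 1)) := by
  obtain ⟨r0, hr0, h⟩ := Metric.continuous_iff.1 hv x ε hε
  refine ⟨r0, hr0, fun r hr hrr => ?_⟩
  have key : ∫ w in ball x r, (v w - v x) ^ 2 ≤ ∫ w in ball x r, ε ^ 2 := by
    refine setIntegral_mono_on (intB (by fun_prop) _ _) (intB (by fun_prop) _ _)
      measurableSet_ball fun w hw => ?_
    have := h w (lt_of_lt_of_le hw hrr)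
    rw [Real.dist_eq] at this
    exact sq_le_sq' (by linarith [neg_abs_le (v w - v x)]) (by linarith [le_abs_self (v w - v x)])
  rw [setIntegral_const, vol_ball x hr, smul_eq_mul] at key
  linarith

/-- pointwise closeness -/
lemma camp_pt {γ ρ R0 : ℝ} (hγ : 0 < γ) (hρ : 0 < ρ) (hρ1 : ρ < 1) (hR0 : 0 < R0) :
    ∃ K, 0 < K ∧ ∀ v : Eu d → ℝ, Continuous v → ∀ A, 0 ≤ A → ∀ x : Eu d, ∀ c : ℕ → ℝ,
      (∀ j, ∫ w in ball x (R0 * ρ ^ j), (v w - c j) ^ 2 ≤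
        A ^ 2 * ((R0 * ρ ^ j) ^ d * ((R0 * ρ ^ j) ^ γ) ^ 2)) →
      ∀ j, |c j - v x| ≤ K * A * (R0 * ρ ^ j) ^ γ := by
  set V := volume.real (ball (0 : Eu d) 1) with hV
  have hV0 : 0 < V := vol_pos
  set τ := ρ ^ γ with hτ
  have hτ0 : 0 < τ := by positivity
  have hτ1 : τ < 1 := Real.rpow_lt_one hρ.le hρ1 hγ
  set L := Real.sqrt (4 / (ρ ^ d * V)) with hL
  have hL0 : 0 < L := Real.sqrt_pos.2 (by positivity)
  have hL2 : L ^ 2 * (ρ ^ d * V) = 4 := by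
    rw [hL, Real.sq_sqrt (by positivity)]; field_simp
  have hRj : ∀ j : ℕ, (R0 * ρ ^ j) ^ γ = R0 ^ γ * τ ^ j := by
    intro j
    rw [Real.mul_rpow hR0.le (by positivity), hτ, ← Real.rpow_natCast, ← Real.rpow_natCast,
      ← Real.rpow_mul hρ.le, ← Real.rpow_mul hρ.le, mul_comm γ]
  refine ⟨L / (1 - τ), div_pos hL0 (by linarith), ?_⟩
  intro v hv A hA x c hc j
  have hstep : ∀ n, dist (c n) (c (n + 1)) ≤ L * A * R0 ^ γ * τ ^ n := by
    intro n
    have hn : 0 < R0 * ρ ^ n := by positivity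
    have hn1 : 0 < R0 * ρ ^ (n + 1) := by positivity
    have hle : R0 * ρ ^ (n + 1) ≤ R0 * ρ ^ n := by
      rw [pow_succ]; nlinarith [mul_pos hR0 (pow_pos hρ n)]
    have hlg : (R0 * ρ ^ (n + 1)) ^ γ ≤ (R0 * ρ ^ n) ^ γ :=
      Real.rpow_le_rpow hn1.le hle hγ.le
    have h := avg_diff hv hn1 (ball_subset_ball hle) (Subset.refl _) (hc n) (hc (n + 1))
    rw [Real.dist_eq]
    refine abs_le_of_sq_le_sq ?_ (by positivity)
    have h2 : 2 * (A ^ 2 * ((R0 * ρ ^ n) ^ d * ((R0 * ρ ^ n) ^ γ) ^ 2) +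
        A ^ 2 * ((R0 * ρ ^ (n + 1)) ^ d * ((R0 * ρ ^ (n + 1)) ^ γ) ^ 2)) ≤
        2 * (A ^ 2 * ((R0 * ρ ^ n) ^ d * ((R0 * ρ ^ n) ^ γ) ^ 2) +
        A ^ 2 * ((R0 * ρ ^ n) ^ d * ((R0 * ρ ^ n) ^ γ) ^ 2)) := by
      gcongr
    have h3 := h.trans h2
    have hX : 0 < (R0 * ρ ^ n) ^ d := by positivity
    have e1 : (R0 * ρ ^ (n + 1)) ^ d = (R0 * ρ ^ n) ^ d * ρ ^ d := by
      rw [← mul_pow, pow_succ, mul_assoc]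
    rw [e1] at h3
    have h4 : (R0 * ρ ^ n) ^ d * ((c n - c (n + 1)) ^ 2 * (ρ ^ d * V)) ≤
        (R0 * ρ ^ n) ^ d * (L ^ 2 * A ^ 2 * ((R0 * ρ ^ n) ^ γ) ^ 2 * (ρ ^ d * V)) := by
      have : L ^ 2 * A ^ 2 * ((R0 * ρ ^ n) ^ γ) ^ 2 * (ρ ^ d * V) =
          4 * (A ^ 2 * ((R0 * ρ ^ n) ^ γ) ^ 2) := by rw [← hL2]; ring
      rw [this]
      linarith
    have h5 := le_of_mul_le_mul_left h4 hX
    have h6 := le_of_mul_le_mul_right h5 (by positivity)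
    refine h6.trans (le_of_eq ?_)
    rw [hRj]; ring
  have hR0g : 0 < R0 ^ γ := by positivity
  have htend : Tendsto c atTop (nhds (v x)) := by
    rw [Metric.tendsto_atTop]
    intro ε hε
    obtain ⟨r0, hr0, hr⟩ := int_small hv x (ε := ε / 4) (by positivity)
    have t1 : Tendsto (fun n : ℕ => R0 * ρ ^ n) atTop (nhds 0) := by
      have := (tendsto_pow_atTop_nhds_zero_of_lt_one hρ.le hρ1).const_mul R0
      rwa [mul_zero] at this
    have t2 : Tendsto (fun n : ℕ => A * (R0 ^ γ * τ ^ n)) atTop (nhds 0) := by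
      have := ((tendsto_pow_atTop_nhds_zero_of_lt_one hτ0.le hτ1).const_mul (R0 ^ γ)).const_mul A
      rwa [mul_zero, mul_zero] at this
    set ε' := ε / 4 * Real.sqrt V with hε'
    have hε'0 : 0 < ε' := by have := Real.sqrt_pos.2 hV0; positivity
    obtain ⟨N, hN⟩ := eventually_atTop.1 ((t1.eventually (gt_mem_nhds hr0)).and
      (t2.eventually (gt_mem_nhds hε'0)))
    refine ⟨N, fun n hn => ?_⟩
    obtain ⟨g1, g2⟩ := hN n hn
    have hn0 : 0 < R0 * ρ ^ n := by positivity
    have h := avg_diff hv hn0 (Subset.refl _) (Subset.refl _) (hc n) (hr _ hn0 g1.le)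
    rw [Real.dist_eq]
    refine abs_lt_of_sq_lt_sq ?_ hε.le
    rw [← hV, hRj] at h
    have g3 : (A * (R0 ^ γ * τ ^ n)) ^ 2 ≤ ε' ^ 2 := by
      gcongr
    have e2 : ε' ^ 2 = (ε / 4) ^ 2 * V := by rw [hε', mul_pow, Real.sq_sqrt hV0.le]
    have hX : 0 < (R0 * ρ ^ n) ^ d := by positivity
    have h4 : (R0 * ρ ^ n) ^ d * ((c n - v x) ^ 2 * V) ≤
        (R0 * ρ ^ n) ^ d * (2 * (A * (R0 ^ γ * τ ^ n)) ^ 2 + 2 * ((ε / 4) ^ 2 * V)) := by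
      linarith
    have h5 := le_of_mul_le_mul_left h4 hX
    have h6 : (c n - v x) ^ 2 * V ≤ (4 * (ε / 4) ^ 2) * V := by linarith
    have h7 := le_of_mul_le_mul_right h6 hV0
    nlinarith
  have := dist_le_of_le_geometric_of_tendsto τ _ hτ1 hstep htend j
  rw [Real.dist_eq] at this
  refine this.trans (le_of_eq ?_)
  rw [hRj]; ring

lemma camp {γ ρ R0 : ℝ} (hγ : 0 < γ) (hρ : 0 < ρ) (hρ1 : ρ < 1) (hR0 : 0 < R0) :
    ∃ N, 0 < N ∧ ∀ v : Eu d → ℝ, Continuous v → ∀ A, 0 ≤ A → ∀ Ω : Set (Eu d),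
      (∀ x ∈ Ω, ∃ c : ℕ → ℝ, c 0 = 0 ∧ ∀ j, ∫ w in ball x (R0 * ρ ^ j), (v w - c j) ^ 2 ≤
        A ^ 2 * ((R0 * ρ ^ j) ^ d * ((R0 * ρ ^ j) ^ γ) ^ 2)) →
      ∀ x ∈ Ω, ∀ y ∈ Ω, |v x - v y| ≤ N * A * dist x y ^ γ := by
  obtain ⟨K, hK, hpt⟩ := camp_pt (d := d) hγ hρ hρ1 hR0
  set V := volume.real (ball (0 : Eu d) 1) with hV
  have hV0 : 0 < V := vol_pos
  set L := Real.sqrt (4 * 2 ^ d / V) with hL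
  have hL0 : 0 < L := Real.sqrt_pos.2 (by positivity)
  have hL2 : L ^ 2 * V = 4 * 2 ^ d := by
    rw [hL, Real.sq_sqrt (by positivity)]; field_simp
  set Q := (2 / ρ) ^ γ with hQ
  have hQ0 : 0 < Q := by positivity
  refine ⟨(2 * K + L) * Q, by positivity, ?_⟩
  intro v hv A hA Ω hΩ x hx y hy
  obtain ⟨c, hc0, hc⟩ := hΩ x hx
  obtain ⟨c', hc0', hc'⟩ := hΩ y hy
  have p1 := hpt v hv A hA x c hc
  have p2 := hpt v hv A hA y c' hc'
  rcases eq_or_ne x y with rfl | hne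
  · simp only [sub_self, abs_zero]; positivity
  have hD : 0 < dist x y := dist_pos.2 hne
  suffices h : ∃ j, R0 * ρ ^ j ≤ 2 / ρ * dist x y ∧ |c j - c' j| ≤ L * A * (R0 * ρ ^ j) ^ γ by
    obtain ⟨j, h1, h2⟩ := h
    have h3 : (R0 * ρ ^ j) ^ γ ≤ Q * dist x y ^ γ := by
      rw [hQ, ← Real.mul_rpow (by positivity) hD.le]
      exact Real.rpow_le_rpow (by positivity) h1 hγ.le
    have a1 := p1 j
    have a2 := p2 j
    have : |v x - v y| ≤ (2 * K + L) * A * (R0 * ρ ^ j) ^ γ := by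
      rw [abs_le] at a1 a2 h2 ⊢
      constructor <;> linarith [a1.1, a1.2, a2.1, a2.2, h2.1, h2.2]
    refine this.trans ?_
    calc _ ≤ (2 * K + L) * A * (Q * dist x y ^ γ) := by gcongr
      _ = _ := by ring
  by_cases hfar : R0 / 2 ≤ dist x y
  · refine ⟨0, ?_, ?_⟩
    · rw [pow_zero, mul_one, div_mul_eq_mul_div, le_div_iff₀ hρ]
      nlinarith
    · rw [hc0, hc0', sub_self, abs_zero]; positivity
  · push Not at hfar
    obtain ⟨j, hj1, hj2⟩ := exists_nat_pow_near_of_lt_one (x := dist x y / (R0 / 2)) (y := ρ)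
      (by positivity) (by rw [div_le_one (by positivity)]; exact hfar.le) hρ hρ1
    rw [lt_div_iff₀ (by positivity)] at hj1
    rw [div_le_iff₀ (by positivity)] at hj2
    refine ⟨j, ?_, ?_⟩
    · rw [div_mul_eq_mul_div, le_div_iff₀ hρ]
      rw [pow_succ] at hj1
      linarith
    · have hr : 0 < R0 * ρ ^ j := by positivity
      have h := avg_diff hv (half_pos hr) (ball_subset_ball (half_le_self hr.le))
        (ball_subset_ball' (by linarith)) (hc j) (hc' j)
      refine abs_le_of_sq_le_sq ?_ (by positivity)
      rw [div_pow, ← hV] at h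
      have hX : 0 < (R0 * ρ ^ j) ^ d := by positivity
      have h2d : (0 : ℝ) < 2 ^ d := by positivity
      have h1 : (c j - c' j) ^ 2 * ((R0 * ρ ^ j) ^ d / 2 ^ d * V) * 2 ^ d =
         (R0 * ρ ^ j) ^ d * ((c j - c' j) ^ 2 * V) := by field_simp
      have h4 : (R0 * ρ ^ j) ^ d * ((c j - c' j) ^ 2 * V) ≤
          (R0 * ρ ^ j) ^ d * ((L * A * (R0 * ρ ^ j) ^ γ) ^ 2 * V) := by
        have : (L * A * (R0 * ρ ^ j) ^ γ) ^ 2 * V =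
            4 * 2 ^ d * (A ^ 2 * ((R0 * ρ ^ j) ^ γ) ^ 2) := by rw [← hL2]; ring
        rw [this, ← h1]
        have := mul_le_mul_of_nonneg_right h h2d.le
        linarith
      exact le_of_mul_le_mul_right (le_of_mul_le_mul_left h4 hX) hV0

end PSch

namespace PSch
variable {d : ℕ}

lemma seq_ex {P : ℕ → ℝ → Prop} (h0 : P 0 0) (hs : ∀ j c, P j c → ∃ c', P (j + 1) c') :
    ∃ c : ℕ → ℝ, c 0 = 0 ∧ ∀ j, P j (c j) := by
  have h : ∀ j, ∃ c, P j c := by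
    intro j
    induction j with
    | zero => exact ⟨0, h0⟩
    | succ n ih => obtain ⟨c, hc⟩ := ih; exact hs n c hc
  choose c hc using h
  refine ⟨fun j => if j = 0 then 0 else c j, by simp, fun j => ?_⟩
  by_cases hj : j = 0
  · subst hj; simpa using h0
  · simpa [hj] using hc j

lemma iter {ν γ δ : ℝ} (hν : 0 < ν) (hγ : 0 < γ) (hγ1 : γ < 1) (hδ : 0 < δ) {l k : Fin d} (hk : k ≠ l) :
    ∃ η, 0 < η ∧ ∀ R0, 0 < R0 → ∀ C1, 0 < C1 → ∃ N, 0 < N ∧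
      ∀ a : Fin d → Fin d → Eu d → ℝ, Coef ν a →
      ∀ u : Eu d → ℝ, ContDiff ℝ 1 u → HasCompactSupport u → ∀ f : Fin d → Eu d → ℝ,
      (∀ i, Integrable (f i)) → ∀ Ω : Set (Eu d), ∀ Kf Ka S : ℝ, 0 ≤ Kf → 0 ≤ Ka → 0 ≤ S →
      (∀ x0 ∈ Ω, DivFree (flux a u f) (ball x0 R0) ∧
        (∀ i j, ∀ x ∈ ball x0 R0, ∀ y ∈ ball x0 R0, x l = y l → |a i j x - a i j y| ≤ η) ∧
        (∀ s : ℝ, 0 ≤ s → ∀ i, ∀ x ∈ ball x0 R0, x + s • eb k ∈ ball x0 R0 →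
          |f i (x + s • eb k) - f i x| ≤ Kf * s ^ γ) ∧
        (∀ s : ℝ, 0 ≤ s → ∀ i j, ∀ x ∈ ball x0 R0, x + s • eb k ∈ ball x0 R0 →
          |a i j (x + s • eb k) - a i j x| ≤ Ka * s ^ δ) ∧
        (∀ R : ℝ, 0 < R → R ≤ R0 → (R ^ δ) ^ 2 * (∫ x in ball x0 R, ∑ i, pd i u x ^ 2) ≤
          C1 * (R ^ d * (R ^ γ) ^ 2) * S ^ 2)) →
      ∀ x ∈ Ω, ∀ y ∈ Ω, |pd k u x - pd k u y| ≤ N * (Kf + (1 + Ka) * S) * dist x y ^ γ := by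
  obtain ⟨ρ, hρ, hρ4, η, hη, C, hC, H⟩ := step (d := d) hν hγ1 hk
  refine ⟨η, hη, fun R0 hR0 C1 hC1 => ?_⟩
  obtain ⟨N, hN, hcamp⟩ := camp (d := d) hγ hρ (by linarith) hR0
  set θ := ρ ^ d * ρ ^ (2 * γ) with hθ
  have hθ0 : 0 < θ := by positivity
  set B := Real.sqrt (C1 / (R0 ^ δ) ^ 2 + 2 * C * (1 + C1) / θ) with hB
  have hB0 : 0 < B := Real.sqrt_pos.2 (by positivity)
  have hB2 : B ^ 2 = C1 / (R0 ^ δ) ^ 2 + 2 * C * (1 + C1) / θ := Real.sq_sqrt (by positivity)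
  refine ⟨N * B, by positivity, ?_⟩
  intro a ha u hu hc f hf Ω Kf Ka S hKf hKa hS hyp
  set M := Kf + (1 + Ka) * S with hM
  have hM0 : 0 ≤ M := by positivity
  have main := hcamp (pd k u) (continuous_pd hu k) (B * M) (by positivity) Ω ?_
  · intro x hx y hy
    refine (main x hx y hy).trans (le_of_eq (by ring))
  intro x0 hx0
  obtain ⟨hdf, hosc, hff, hfa, hE⟩ := hyp x0 hx0
  have hSM : S ^ 2 ≤ M ^ 2 := by
    have : S ≤ M := by rw [hM]; nlinarith [mul_nonneg hKa hS]
    gcongr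
  have hKM : Kf ^ 2 ≤ M ^ 2 := by
    have : Kf ≤ M := by rw [hM]; nlinarith [mul_nonneg hKa hS]
    gcongr
  have hKaM : Ka ^ 2 * S ^ 2 ≤ M ^ 2 := by
    rw [← mul_pow]
    have : Ka * S ≤ M := by rw [hM]; nlinarith [mul_nonneg hKa hS]
    gcongr
  refine seq_ex (P := fun j c => ∫ w in ball x0 (R0 * ρ ^ j), (pd k u w - c) ^ 2 ≤
        (B * M) ^ 2 * ((R0 * ρ ^ j) ^ d * ((R0 * ρ ^ j) ^ γ) ^ 2)) ?_ ?_
  · simp only [pow_zero, mul_one, sub_zero]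
    have h1 : ∫ x in ball x0 R0, (pd k u x) ^ 2 ≤ ∫ x in ball x0 R0, ∑ i, pd i u x ^ 2 := by
      refine integral_mono (intB ((continuous_pd hu k).pow 2) _ _)
        (intB (continuous_finsetSum _ fun i _ => (continuous_pd hu i).pow 2) _ _) fun x => ?_
      exact Finset.single_le_sum (f := fun i => pd i u x ^ 2) (fun i _ => sq_nonneg _)
        (Finset.mem_univ k)
    have h2 := hE R0 hR0 le_rfl
    have hD : 0 < (R0 ^ δ) ^ 2 := by positivity
    have h3 : ∫ x in ball x0 R0, (pd k u x) ^ 2 ≤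
        C1 / (R0 ^ δ) ^ 2 * (R0 ^ d * (R0 ^ γ) ^ 2) * S ^ 2 := by
      refine h1.trans ?_
      rw [div_mul_eq_mul_div, div_mul_eq_mul_div, le_div_iff₀ hD]
      linarith
    refine h3.trans ?_
    rw [mul_pow, hB2]
    have h4 : C1 / (R0 ^ δ) ^ 2 ≤ C1 / (R0 ^ δ) ^ 2 + 2 * C * (1 + C1) / θ := by
      have : 0 < 2 * C * (1 + C1) / θ := by positivity
      linarith
    calc C1 / (R0 ^ δ) ^ 2 * (R0 ^ d * (R0 ^ γ) ^ 2) * S ^ 2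
        ≤ (C1 / (R0 ^ δ) ^ 2 + 2 * C * (1 + C1) / θ) * (R0 ^ d * (R0 ^ γ) ^ 2) * M ^ 2 := by gcongr
      _ = _ := by ring
  · intro j c hcj
    set R := R0 * ρ ^ j with hR
    have hR0' : 0 < R := by positivity
    have hRR : R ≤ R0 := by
      have : ρ ^ j ≤ 1 := pow_le_one₀ hρ.le (by linarith)
      rw [hR]; nlinarith
    have hsub : ball x0 R ⊆ ball x0 R0 := ball_subset_ball hRR
    obtain ⟨c', hc'⟩ := H a ha x0 R hR0' (fun i j x hx y hy => hosc i j x (hsub hx) y (hsub hy))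
      u hu hc f hf (divFree_mono hdf hsub) (Kf * R ^ γ) (Ka * R ^ δ) (by positivity)
      (fun s hs0 hs1 i x hx hx' => (hff s hs0 i x (hsub hx) (hsub hx')).trans (by gcongr))
      (fun s hs0 hs1 i j x hx hx' => (hfa s hs0 i j x (hsub hx) (hsub hx')).trans (by gcongr)) c
    refine ⟨c', ?_⟩
    have e1 : R0 * ρ ^ (j + 1) = R * ρ := by rw [hR, pow_succ]; ring
    rw [e1]
    have e2 : (R * ρ) ^ d * ((R * ρ) ^ γ) ^ 2 = (R ^ d * (R ^ γ) ^ 2) * θ := by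
      rw [Real.mul_rpow hR0'.le hρ.le, mul_pow, mul_pow, hθ, mul_comm 2 γ, Real.rpow_mul hρ.le,
        Real.rpow_two]
      ring
    rw [e2]
    set W := R ^ d * (R ^ γ) ^ 2 with hW
    have hW0 : 0 < W := by positivity
    have hEn := hE R hR0' hRR
    rw [← hW] at hEn
    have h5 : R ^ d * (Kf * R ^ γ) ^ 2 + (Ka * R ^ δ) ^ 2 * (∫ x in ball x0 R, ∑ i, pd i u x ^ 2) ≤
        (1 + C1) * M ^ 2 * W := by
      have h51 : R ^ d * (Kf * R ^ γ) ^ 2 ≤ M ^ 2 * W := by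
        calc R ^ d * (Kf * R ^ γ) ^ 2 = Kf ^ 2 * W := by rw [hW]; ring
          _ ≤ _ := by gcongr
      have h52 : (Ka * R ^ δ) ^ 2 * (∫ x in ball x0 R, ∑ i, pd i u x ^ 2) ≤ C1 * M ^ 2 * W := by
        calc (Ka * R ^ δ) ^ 2 * (∫ x in ball x0 R, ∑ i, pd i u x ^ 2)
            = Ka ^ 2 * ((R ^ δ) ^ 2 * (∫ x in ball x0 R, ∑ i, pd i u x ^ 2)) := by ring
          _ ≤ Ka ^ 2 * (C1 * W * S ^ 2) := by gcongr
          _ = C1 * W * (Ka ^ 2 * S ^ 2) := by ring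
          _ ≤ C1 * W * M ^ 2 := by gcongr
          _ = _ := by ring
      linarith
    have h6 : ∫ x in ball x0 (R * ρ), (pd k u x - c') ^ 2 ≤
        (1 / 2) * θ * ((B * M) ^ 2 * W) + C * ((1 + C1) * M ^ 2 * W) :=
      hc'.trans (by gcongr)
    refine h6.trans ?_
    have h7 : C * (1 + C1) ≤ (1 / 2) * θ * B ^ 2 := by
      have h8 : 2 * C * (1 + C1) / θ ≤ B ^ 2 := by
        rw [hB2]
        have : 0 < C1 / (R0 ^ δ) ^ 2 := by positivity
        linarith
      rw [div_le_iff₀ hθ0] at h8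
      linarith
    calc (1 / 2) * θ * ((B * M) ^ 2 * W) + C * ((1 + C1) * M ^ 2 * W)
        = (1 / 2) * θ * ((B * M) ^ 2 * W) + C * (1 + C1) * (M ^ 2 * W) := by ring
      _ ≤ (1 / 2) * θ * ((B * M) ^ 2 * W) + (1 / 2) * θ * B ^ 2 * (M ^ 2 * W) := by gcongr
      _ = _ := by ring

end PSch

namespace PSch
variable {d : ℕ}

open scoped Convolution in
lemma moll {φ : Eu d → ℝ} (hφ : ContDiff ℝ 1 φ) (hc : HasCompactSupport φ) {r : ℝ}
    (hs : tsupport φ ⊆ ball 0 r) {ε : ℝ} (hε : 0 < ε) :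
    ∃ ψ : Eu d → ℝ, ContDiff ℝ (⊤ : ℕ∞) ψ ∧ HasCompactSupport ψ ∧ tsupport ψ ⊆ ball 0 r ∧
      ∀ i x, |pd i ψ x - pd i φ x| ≤ ε := by
  have hcd : Continuous (fderiv ℝ φ) := hφ.continuous_fderiv (by norm_num)
  have huc : UniformContinuous (fderiv ℝ φ) :=
    (hc.fderiv (𝕜 := ℝ)).uniformContinuous_of_continuous hcd
  obtain ⟨τ, hτ, hu⟩ := Metric.uniformContinuous_iff.1 huc ε hε
  obtain ⟨σ, hσ, hσs⟩ := hc.isCompact.exists_cthickening_subset_open isOpen_ball hs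
  set t := min τ σ with ht
  have ht0 : 0 < t := by positivity
  let b : ContDiffBump (0 : Eu d) := ⟨t / 4, t / 2, by positivity, by linarith⟩
  have hb : b.rOut = t / 2 := rfl
  have hbs : HasCompactSupport (b.normed (volume : Measure (Eu d))) := b.hasCompactSupport_normed
  have hbc : ContDiff ℝ (⊤ : ℕ∞) (b.normed (volume : Measure (Eu d))) := b.contDiff_normed
  have hli : LocallyIntegrable φ (volume : Measure (Eu d)) := hφ.continuous.locallyIntegrable
  set ψ : Eu d → ℝ := (b.normed volume) ⋆[ContinuousLinearMap.lsmul ℝ ℝ, volume] φ with hψ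
  refine ⟨ψ, ?_, ?_, ?_, ?_⟩
  · exact hbs.contDiff_convolution_left _ hbc hli
  · exact hbs.convolution _ hc
  · refine Subset.trans ?_ hσs
    have h1 : tsupport ψ ⊆ cthickening (t / 2) (tsupport φ) := by
      refine closure_minimal ?_ isClosed_cthickening
      refine (support_convolution_subset (ContinuousLinearMap.lsmul ℝ ℝ)).trans ?_
      rintro x ⟨y, hy, z, hz, rfl⟩
      rw [b.support_normed_eq] at hy
      refine mem_cthickening_of_dist_le _ z _ _ (subset_tsupport _ hz) ?_
      rw [mem_ball_zero_iff] at hy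
      simp only [dist_eq_norm, add_sub_cancel_right]
      exact hy.le
    refine h1.trans (cthickening_mono ?_ _)
    have : t ≤ σ := min_le_right _ _
    linarith
  · intro i x
    have hd := hc.hasFDerivAt_convolution_right (ContinuousLinearMap.lsmul ℝ ℝ)
      (μ := (volume : Measure (Eu d))) (f := b.normed volume)
      b.continuous_normed.locallyIntegrable hφ x
    have hd2 : fderiv ℝ ψ x = _ := hd.fderiv
    have hL : ((ContinuousLinearMap.lsmul ℝ ℝ : ℝ →L[ℝ] ℝ →L[ℝ] ℝ).precompR (Eu d)) =
        (ContinuousLinearMap.lsmul ℝ ℝ : ℝ →L[ℝ] (Eu d →L[ℝ] ℝ) →L[ℝ] (Eu d →L[ℝ] ℝ)) := by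
      ext; rfl
    rw [hL] at hd2
    have h3 := b.dist_normed_convolution_le (μ := (volume : Measure (Eu d))) (g := fderiv ℝ φ)
      (x₀ := x) (ε := ε) hcd.aestronglyMeasurable (fun y hy => by
        refine (hu ?_).le
        have : t ≤ τ := min_le_left _ _
        rw [hb, mem_ball] at hy
        linarith)
    rw [← hd2, dist_eq_norm] at h3
    rw [pd_def, pd_def, ← ContinuousLinearMap.sub_apply, ← Real.norm_eq_abs]
    refine (ContinuousLinearMap.le_opNorm _ _).trans ?_
    rw [norm_eb, mul_one]
    exact h3

lemma divFree_of_smooth {V : Fin d → Eu d → ℝ} (hV : ∀ i, Integrable (V i)) {r : ℝ}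
    (h : ∀ φ : Eu d → ℝ, ContDiff ℝ (⊤ : ℕ∞) φ → HasCompactSupport φ → tsupport φ ⊆ ball 0 r →
      ∫ x, ∑ i, V i x * pd i φ x = 0) : DivFree V (ball 0 r) := by
  intro φ hφ hc hs
  set I := ∫ x, ∑ i, V i x * pd i φ x with hI
  set T := ∫ x, ∑ i, |V i x| with hT
  have hT0 : 0 ≤ T := integral_nonneg fun x => Finset.sum_nonneg fun i _ => abs_nonneg _
  have key : ∀ ε, 0 < ε → |I| ≤ ε * T := by
    intro ε hε
    obtain ⟨ψ, h1, h2, h3, h4⟩ := moll hφ hc hs hε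
    have h1' : ContDiff ℝ 1 ψ := h1.of_le (by exact_mod_cast le_top)
    have j1 : Integrable fun x => ∑ i, V i x * pd i φ x := integrable_VD' hV hφ hc
    have j2 : Integrable fun x => ∑ i, V i x * pd i ψ x := integrable_VD' hV h1' h2
    have e : I = ∫ x, (∑ i, V i x * pd i φ x - ∑ i, V i x * pd i ψ x) := by
      rw [integral_sub j1 j2, h ψ h1 h2 h3, sub_zero]
    rw [e, hT, ← integral_const_mul, ← Real.norm_eq_abs]
    refine norm_integral_le_of_norm_le ?_ (Eventually.of_forall fun x => ?_)
    · exact (integrable_finsetSum _ fun i _ => (hV i).abs).const_mul ε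
    · rw [← Finset.sum_sub_distrib, Finset.mul_sum, Real.norm_eq_abs]
      refine (Finset.abs_sum_le_sum_abs _ _).trans (Finset.sum_le_sum fun i _ => ?_)
      rw [← mul_sub, abs_mul, abs_sub_comm, mul_comm]
      exact mul_le_mul_of_nonneg_right (h4 i x) (abs_nonneg _)
  by_contra hne
  have hpos : 0 < |I| := abs_pos.2 hne
  have := key (|I| / (2 * (T + 1))) (by positivity)
  rw [div_mul_eq_mul_div, le_div_iff₀ (by positivity)] at this
  nlinarith

end PSch

namespace PSch
variable {d : ℕ}

lemma energy {p : ℝ} (hp2 : 2 < p) {w : Eu d → ℝ} (hw : ContDiff ℝ 1 w) (hc : HasCompactSupport w)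
    (x0 : Eu d) {R I : ℝ} (hR : 0 < R)
    (hI : ∫ x in ball x0 R, gradNorm w x ^ p ≤ I) :
    ∫ x in ball x0 R, ∑ i, pd i w x ^ 2 ≤
      (I ^ (1 / p)) ^ 2 * (R ^ d * volume.real (ball (0 : Eu d) 1)) ^ (1 - 2 / p) := by
  have hp0 : 0 < p := by linarith
  set V := volume.real (ball (0 : Eu d) 1) with hV
  set g : Eu d → ℝ := fun x => ∑ i, pd i w x ^ 2 with hg
  have hg0 : ∀ x, 0 ≤ g x := fun x => Finset.sum_nonneg fun i _ => sq_nonneg _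
  have hgc : Continuous g := continuous_finsetSum _ fun i _ => (continuous_pd hw i).pow 2
  have hgs : HasCompactSupport g := by
    refine HasCompactSupport.intro hc.isCompact fun x hx => ?_
    refine Finset.sum_eq_zero fun i _ => ?_
    rw [pd_zero_of_notMem hx]; norm_num
  have hgp : ∀ x, g x ^ (p / 2) = gradNorm w x ^ p := by
    intro x
    rw [gradNorm, Real.sqrt_eq_rpow, ← Real.rpow_mul (hg0 x)]
    congr 1; ring
  set q := p / (p - 2) with hq
  have hpq : (p / 2).HolderConjugate q := by
    rw [Real.holderConjugate_iff]
    refine ⟨by linarith, ?_⟩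
    have : p - 2 ≠ 0 := by linarith
    rw [hq]; field_simp; ring
  have hfin : IsFiniteMeasure ((volume : Measure (Eu d)).restrict (ball x0 R)) :=
    ⟨by rw [Measure.restrict_apply_univ]; exact measure_ball_lt_top⟩
  have h := integral_mul_le_Lp_mul_Lq_of_nonneg (μ := (volume : Measure (Eu d)).restrict (ball x0 R))
    hpq (f := g) (g := fun _ => (1 : ℝ)) (Eventually.of_forall hg0)
    (Eventually.of_forall fun _ => zero_le_one)
    ((hgc.memLp_of_hasCompactSupport hgs).restrict _) (memLp_const 1)
  simp only [mul_one, Real.one_rpow, hgp] at h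
  rw [setIntegral_const, vol_ball x0 hR, smul_eq_mul, mul_one, ← hV] at h
  refine h.trans ?_
  have hI0 : 0 ≤ ∫ x in ball x0 R, gradNorm w x ^ p :=
    integral_nonneg fun x => Real.rpow_nonneg (Real.sqrt_nonneg _) _
  have e1 : 1 / q = 1 - 2 / p := by
    have : p - 2 ≠ 0 := by linarith
    rw [hq]; field_simp
  have e2 : (I ^ (1 / p)) ^ 2 = I ^ (1 / (p / 2)) := by
    rw [← Real.rpow_two, ← Real.rpow_mul (hI0.trans hI)]
    congr 1; field_simp
  rw [e1, e2]
  have hV0 : 0 ≤ V := measureReal_nonneg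
  gcongr

lemma mainK (q : ℕ) (ν δ p : ℝ) (ω : ℝ → ℝ) (hd : 2 ≤ d)
    (hν : ν ∈ Ioc (0 : ℝ) 1) (hδ : δ ∈ Ioc (0 : ℝ) 1)
    (hp : (d : ℝ) < p) (hγ : 0 < δ - (d : ℝ) / p)
    (hωmono : MonotoneOn ω (Ici (0 : ℝ)))
    (hωlim : Tendsto ω (nhdsWithin 0 (Ioi (0 : ℝ))) (nhds 0)) (l k : Fin d) (hkl : k ≠ l)
    (hkq : (k : ℕ) < q) :
    ∃ N : ℝ, 0 < N ∧
      ∀ (a : Fin d → Fin d → Eu d → ℝ) (u : Eu d → ℝ) (fv : Fin d → Eu d → ℝ), Coef ν a →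
        (∀ (i j : Fin d) (x y : Eu d), x l = y l → |a i j x - a i j y| ≤ ω (dist x y)) →
        ∀ Ka : ℝ, 0 ≤ Ka →
        (∀ i j, PHolderX d q δ (ball (0 : Eu d) 1) (a i j) Ka) →
        ContDiffOn ℝ 1 u (ball (0 : Eu d) 1) →
        IntegrableOn (fun x => gradNorm u x ^ p) (ball (0 : Eu d) 1) →
        (∀ i, IntegrableOn (fv i) (ball (0 : Eu d) 1)) →
        (∀ φ : Eu d → ℝ, ContDiff ℝ (⊤ : ℕ∞) φ →
          HasCompactSupport φ → tsupport φ ⊆ ball (0 : Eu d) 1 →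
          ∫ x in ball (0 : Eu d) 1, ∑ i, ∑ j, a i j x * pd j u x * pd i φ x
            = ∫ x in ball (0 : Eu d) 1, ∑ i, fv i x * pd i φ x) →
        ∀ Kf : ℝ, 0 ≤ Kf →
          (∀ i, PHolderX d q (δ - (d : ℝ) / p) (ball (0 : Eu d) 1) (fv i) Kf) →
            HolderB (δ - (d : ℝ) / p) (ball (0 : Eu d) (1/2)) (pd k u)
              (N * (Kf + (1 + Ka) * (∫ x in ball (0 : Eu d) 1, gradNorm u x ^ p) ^ (1/p))) := by
  have hd2 : (2 : ℝ) ≤ d := by exact_mod_cast hd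
  have hp2 : 2 < p := by linarith
  have hp0 : 0 < p := by linarith
  have hν0 := hν.1
  set γ := δ - (d : ℝ) / p with hγdef
  have hγ1 : γ < 1 := by
    have : 0 < (d : ℝ) / p := by positivity
    have := hδ.2
    linarith
  obtain ⟨η, hη, H⟩ := iter (d := d) hν0 hγ hγ1 hδ.1 hkl
  obtain ⟨r1, hr1, hr14, hωr⟩ : ∃ r1, 0 < r1 ∧ r1 ≤ 1 / 2 ∧ ω r1 ≤ η := by
    have h1 := hωlim.eventually (gt_mem_nhds hη)
    have h2 : ∀ᶠ r : ℝ in nhdsWithin 0 (Ioi 0), r ∈ Ioo 0 (1 / 2 : ℝ) :=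
      Ioo_mem_nhdsGT (by norm_num)
    obtain ⟨r, h3, h4, h5⟩ := (h1.and h2).exists
    exact ⟨r, h4, h5.le, h3.le⟩
  set R0 := r1 / 2 with hR0def
  have hR0 : 0 < R0 := by positivity
  have hR04 : R0 ≤ 1 / 4 := by linarith
  set V := volume.real (ball (0 : Eu d) 1) with hV
  have hV0 : 0 < V := vol_pos
  obtain ⟨N, hN, HN⟩ := H R0 hR0 (V ^ (1 - 2 / p)) (by positivity)
  refine ⟨N, hN, ?_⟩
  intro a u fv ha hω Ka hKa haH hu hgi hfi hweak Kf hKf hfH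
  obtain ⟨ζ, hζ, hζc, hζs, hζ1, -, -⟩ := bump (d := d) (r := 3 / 4) (r' := 1) (by norm_num) (by norm_num)
  have hζ' : ContDiff ℝ 1 ζ := hζ.of_le (by exact_mod_cast le_top)
  set w : Eu d → ℝ := fun x => ζ x * u x with hw
  have hwts : tsupport w ⊆ tsupport ζ := tsupport_mul_subset_left
  have hwc : ContDiff ℝ 1 w := by
    refine contDiff_iff_contDiffAt.2 fun x => ?_
    by_cases hx : x ∈ tsupport w
    swap
    · have h0 : w =ᶠ[nhds x] fun _ => 0 := notMem_tsupport_iff_eventuallyEq.1 hx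
      exact contDiffAt_const.congr_of_eventuallyEq h0
    exact hζ'.contDiffAt.mul (hu.contDiffAt (isOpen_ball.mem_nhds (hζs (hwts hx))))
  have hws : HasCompactSupport w := hζc.mul_right
  have hpdw : ∀ i, ∀ x ∈ ball (0 : Eu d) (3 / 4), pd i w x = pd i u x := by
    intro i x hx
    have : w =ᶠ[nhds x] u := by
      filter_upwards [isOpen_ball.mem_nhds hx] with y hy
      simp [hw, hζ1 y hy]
    rw [pd_def, pd_def, this.fderiv_eq]
  set F : Fin d → Eu d → ℝ := fun i => indicator (ball (0 : Eu d) 1) (fv i) with hF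
  have hFi : ∀ i, Integrable (F i) := fun i => (hfi i).integrable_indicator measurableSet_ball
  have hFe : ∀ i, ∀ x ∈ ball (0 : Eu d) 1, F i x = fv i x := fun i x hx => indicator_of_mem hx _
  have hdf : DivFree (flux a w F) (ball 0 (3 / 4)) := by
    refine divFree_of_smooth (integrable_flux hν0 ha hwc hws hFi) fun φ hφ hφc hφs => ?_
    have hφ' : ContDiff ℝ 1 φ := hφ.of_le (by exact_mod_cast le_top)
    have hsub : ball (0 : Eu d) (3 / 4) ⊆ ball 0 1 := ball_subset_ball (by norm_num)
    have h0 := hweak φ hφ hφc (hφs.trans hsub)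
    have hz : ∀ x, x ∉ ball (0 : Eu d) 1 → ∀ i, pd i φ x = 0 := fun x hx i =>
      pd_zero_of_notMem fun h => hx (hsub (hφs h))
    have j1 : Integrable fun x => ∑ i, flux a w F i x * pd i φ x :=
      integrable_VD' (integrable_flux hν0 ha hwc hws hFi) hφ' hφc
    have j2 : Integrable fun x => ∑ i, F i x * pd i φ x := integrable_VD' hFi hφ' hφc
    have e1 : ∫ x in ball (0 : Eu d) 1, ∑ i, fv i x * pd i φ x = ∫ x, ∑ i, F i x * pd i φ x := by
      refine Eq.trans ?_ (setIntegral_eq_integral_of_forall_compl_eq_zero (s := ball (0 : Eu d) 1)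
        (fun x hx => Finset.sum_eq_zero fun i _ => by rw [hz x hx i, mul_zero]))
      refine setIntegral_congr_fun measurableSet_ball fun x hx => ?_
      exact Finset.sum_congr rfl fun i _ => by rw [hFe i x hx]
    have e2 : ∫ x in ball (0 : Eu d) 1, ∑ i, ∑ j, a i j x * pd j u x * pd i φ x =
        ∫ x, (∑ i, flux a w F i x * pd i φ x + ∑ i, F i x * pd i φ x) := by
      refine Eq.trans ?_ (setIntegral_eq_integral_of_forall_compl_eq_zero (s := ball (0 : Eu d) 1)
        (fun x hx => by simp [hz x hx]))
      refine setIntegral_congr_fun measurableSet_ball fun x hx => ?_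
      show ∑ i, ∑ j, a i j x * pd j u x * pd i φ x =
        ∑ i, flux a w F i x * pd i φ x + ∑ i, F i x * pd i φ x
      rw [← Finset.sum_add_distrib]
      refine Finset.sum_congr rfl fun i _ => ?_
      rw [← add_mul, flux, sub_add_cancel, Finset.sum_mul]
      refine Finset.sum_congr rfl fun j _ => ?_
      by_cases hx' : x ∈ tsupport φ
      · rw [hpdw j x (hφs hx')]
      · rw [pd_zero_of_notMem hx', mul_zero, mul_zero]
    rw [e1, e2, integral_add j1 j2] at h0
    linarith
  set S := (∫ x in ball (0 : Eu d) 1, gradNorm u x ^ p) ^ (1 / p) with hS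
  have hSnn : ∀ x, 0 ≤ gradNorm u x ^ p := fun x => Real.rpow_nonneg (Real.sqrt_nonneg _) _
  have hS0 : 0 ≤ S := Real.rpow_nonneg (integral_nonneg hSnn) _
  have hshift : ∀ (s : ℝ) (x : Eu d), ∀ i : Fin d, q ≤ (i : ℕ) → (x + s • eb k) i = x i := by
    intro s x i hi
    have : i ≠ k := by rintro rfl; omega
    simp [eb_ne this]
  have hdist : ∀ (s : ℝ) (x : Eu d), 0 ≤ s → dist (x + s • eb k) x = s := by
    intro s x hs
    rw [dist_eq_norm, add_sub_cancel_left, norm_smul, norm_eb, mul_one, Real.norm_of_nonneg hs]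
  have main := HN a ha w hwc hws F hFi (ball 0 (1 / 2)) Kf Ka S hKf hKa hS0 ?_
  · intro x hx y hy
    have hsub : ball (0 : Eu d) (1 / 2) ⊆ ball 0 (3 / 4) := ball_subset_ball (by norm_num)
    rw [← hpdw k x (hsub hx), ← hpdw k y (hsub hy)]
    exact main x hx y hy
  intro x0 hx0
  rw [mem_ball] at hx0
  have hs34 : ball x0 R0 ⊆ ball (0 : Eu d) (3 / 4) := ball_subset_ball' (by linarith)
  have hs1 : ball x0 R0 ⊆ ball (0 : Eu d) 1 := hs34.trans (ball_subset_ball (by norm_num))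
  refine ⟨divFree_mono hdf hs34, ?_, ?_, ?_, ?_⟩
  · intro i j x hx y hy hxy
    refine (hω i j x y hxy).trans (le_trans ?_ hωr)
    refine hωmono (dist_nonneg : (0 : ℝ) ≤ _) hr1.le ?_
    have := dist_triangle_right x y x0
    rw [mem_ball] at hx hy
    linarith
  · intro s hs i x hx hx'
    rw [hFe i _ (hs1 hx), hFe i _ (hs1 hx')]
    have := hfH i _ (hs1 hx') _ (hs1 hx) (hshift s x)
    rwa [hdist s x hs] at this
  · intro s hs i j x hx hx'
    have := haH i j _ (hs1 hx') _ (hs1 hx) (hshift s x)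
    rwa [hdist s x hs] at this
  · intro R hR hRR
    have hsR : ball x0 R ⊆ ball x0 R0 := ball_subset_ball hRR
    have hI : ∫ x in ball x0 R, gradNorm w x ^ p ≤ ∫ x in ball (0 : Eu d) 1, gradNorm u x ^ p := by
      have e : ∫ x in ball x0 R, gradNorm w x ^ p = ∫ x in ball x0 R, gradNorm u x ^ p := by
        refine setIntegral_congr_fun measurableSet_ball fun x hx => ?_
        simp only [gradNorm]
        congr 2
        exact Finset.sum_congr rfl fun i _ => by rw [hpdw i x (hs34 (hsR hx))]
      rw [e]
      exact setIntegral_mono_set hgi (Eventually.of_forall hSnn)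
        (LE.le.eventuallyLE (hsR.trans hs1))
    have hEn := energy hp2 hwc hws x0 hR hI
    rw [← hV, ← hS] at hEn
    have e3 : (R ^ δ) ^ 2 * (R ^ d) ^ (1 - 2 / p) = R ^ d * (R ^ γ) ^ 2 := by
      rw [← Real.rpow_natCast, ← Real.rpow_natCast, ← Real.rpow_natCast, ← Real.rpow_mul hR.le,
        ← Real.rpow_mul hR.le, ← Real.rpow_mul hR.le, ← Real.rpow_add hR, ← Real.rpow_add hR, hγdef]
      congr 1
      push_cast
      field_simp
      ring
    calc (R ^ δ) ^ 2 * (∫ x in ball x0 R, ∑ i, pd i w x ^ 2)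
        ≤ (R ^ δ) ^ 2 * (S ^ 2 * (R ^ d * V) ^ (1 - 2 / p)) := by gcongr
      _ = (R ^ δ) ^ 2 * (R ^ d) ^ (1 - 2 / p) * V ^ (1 - 2 / p) * S ^ 2 := by
          rw [Real.mul_rpow (by positivity) hV0.le]; ring
      _ = _ := by rw [e3]; ring

end PSch

/-- **Theorem 2.7 (ii)**: for divergence form elliptic equations with coefficients
uniformly continuous in `(x¹,…,x^{d-1})` (modulus `ω`), merely measurable in `x^d`, and
`δ`-Hölder in `x'`, the `x'` first derivatives of a weak solution are `γ`-Hölder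
continuous with `γ = δ - d/p`. -/
theorem partial_schauder_elliptic_div_one_bad_direction
    (d q : ℕ) (ν δ p : ℝ) (ω : ℝ → ℝ)
    (hd : 2 ≤ d) (hq1 : 1 ≤ q) (hqd : q < d)
    (hν : ν ∈ Ioc (0 : ℝ) 1) (hδ : δ ∈ Ioc (0 : ℝ) 1)
    (hp : (d : ℝ) < p) (hγ : 0 < δ - (d : ℝ) / p)
    (hω0 : ∀ r, 0 ≤ ω r) (hωmono : MonotoneOn ω (Ici (0 : ℝ)))
    (hωlim : Tendsto ω (nhdsWithin 0 (Ioi (0 : ℝ))) (nhds 0)) :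
    ∃ N : ℝ, 0 < N ∧
      ∀ (a : Fin d → Fin d → EuclideanSpace ℝ (Fin d) → ℝ)
        (u : EuclideanSpace ℝ (Fin d) → ℝ)
        (fv : Fin d → EuclideanSpace ℝ (Fin d) → ℝ),
        (∀ i j, Measurable (a i j)) →
        (∀ (x : EuclideanSpace ℝ (Fin d)) (ξ : Fin d → ℝ),
          ν * ∑ i, ξ i ^ 2 ≤ ∑ i, ∑ j, a i j x * ξ i * ξ j) →
        (∀ x : EuclideanSpace ℝ (Fin d), ∑ i, ∑ j, a i j x ^ 2 ≤ ν⁻¹ ^ 2) →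
        -- uniform continuity in `(x¹,…,x^{d-1})` with modulus `ω`
        (∀ (i j : Fin d) (x y : EuclideanSpace ℝ (Fin d)),
          x (⟨d - 1, by omega⟩ : Fin d) = y (⟨d - 1, by omega⟩ : Fin d) →
          |a i j x - a i j y| ≤ ω (dist x y)) →
        ∀ Ka : ℝ, 0 ≤ Ka →
        (∀ i j, PHolderX d q δ (ball (0 : EuclideanSpace ℝ (Fin d)) 1) (a i j) Ka) →
        ContDiffOn ℝ 1 u (ball (0 : EuclideanSpace ℝ (Fin d)) 1) →
        IntegrableOn (fun x => gradNorm u x ^ p)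
          (ball (0 : EuclideanSpace ℝ (Fin d)) 1) →
        (∀ i, IntegrableOn (fv i) (ball (0 : EuclideanSpace ℝ (Fin d)) 1)) →
        -- weak formulation of `D_i (a^{ij} D_j u) = div f⃗` in `B_1`
        (∀ φ : EuclideanSpace ℝ (Fin d) → ℝ, ContDiff ℝ (⊤ : ℕ∞) φ →
          HasCompactSupport φ → tsupport φ ⊆ ball (0 : EuclideanSpace ℝ (Fin d)) 1 →
          ∫ x in ball (0 : EuclideanSpace ℝ (Fin d)) 1,
              ∑ i, ∑ j, a i j x * pd j u x * pd i φ x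
            = ∫ x in ball (0 : EuclideanSpace ℝ (Fin d)) 1,
                ∑ i, fv i x * pd i φ x) →
        ∀ Kf : ℝ, 0 ≤ Kf →
          (∀ i, PHolderX d q (δ - (d : ℝ) / p)
            (ball (0 : EuclideanSpace ℝ (Fin d)) 1) (fv i) Kf) →
          ∀ i : Fin d, (i : ℕ) < q →
            HolderB (δ - (d : ℝ) / p) (ball (0 : EuclideanSpace ℝ (Fin d)) (1/2))
              (pd i u)
              (N * (Kf + (1 + Ka) *
                (∫ x in ball (0 : EuclideanSpace ℝ (Fin d)) 1,
                    gradNorm u x ^ p) ^ (1/p))) := by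
  have key : ∀ k : Fin d, ∃ N : ℝ, 0 < N ∧ ((k : ℕ) < q → ∀ (a : Fin d → Fin d → PSch.Eu d → ℝ)
      (u : PSch.Eu d → ℝ) (fv : Fin d → PSch.Eu d → ℝ), PSch.Coef ν a →
        (∀ (i j : Fin d) (x y : PSch.Eu d),
          x (⟨d - 1, by omega⟩ : Fin d) = y (⟨d - 1, by omega⟩ : Fin d) →
          |a i j x - a i j y| ≤ ω (dist x y)) →
        ∀ Ka : ℝ, 0 ≤ Ka →
        (∀ i j, PHolderX d q δ (ball (0 : PSch.Eu d) 1) (a i j) Ka) →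
        ContDiffOn ℝ 1 u (ball (0 : PSch.Eu d) 1) →
        IntegrableOn (fun x => gradNorm u x ^ p) (ball (0 : PSch.Eu d) 1) →
        (∀ i, IntegrableOn (fv i) (ball (0 : PSch.Eu d) 1)) →
        (∀ φ : PSch.Eu d → ℝ, ContDiff ℝ (⊤ : ℕ∞) φ →
          HasCompactSupport φ → tsupport φ ⊆ ball (0 : PSch.Eu d) 1 →
          ∫ x in ball (0 : PSch.Eu d) 1, ∑ i, ∑ j, a i j x * pd j u x * pd i φ x
            = ∫ x in ball (0 : PSch.Eu d) 1, ∑ i, fv i x * pd i φ x) →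
        ∀ Kf : ℝ, 0 ≤ Kf →
          (∀ i, PHolderX d q (δ - (d : ℝ) / p) (ball (0 : PSch.Eu d) 1) (fv i) Kf) →
            HolderB (δ - (d : ℝ) / p) (ball (0 : PSch.Eu d) (1/2)) (pd k u)
              (N * (Kf + (1 + Ka) *
                (∫ x in ball (0 : PSch.Eu d) 1, gradNorm u x ^ p) ^ (1/p)))) := by
    intro k
    by_cases hk : (k : ℕ) < q
    · obtain ⟨N, hN, h⟩ := PSch.mainK q ν δ p ω hd hν hδ hp hγ hωmono hωlim
        (⟨d - 1, by omega⟩ : Fin d) k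
        (by intro h; have := congrArg Fin.val h; simp only at this; omega) hk
      exact ⟨N, hN, fun _ => h⟩
    · exact ⟨1, one_pos, fun h => absurd h hk⟩
  choose N hN hkey using key
  refine ⟨∑ k, N k + 1, ?_, ?_⟩
  · have : 0 ≤ ∑ k, N k := Finset.sum_nonneg fun k _ => (hN k).le
    linarith
  intro a u fv hm hell hbdd hω Ka hKa haH hu hgi hfi hweak Kf hKf hfH i hi x hx y hy
  have h := hkey i hi a u fv ⟨hm, hell, hbdd⟩ hω Ka hKa haH hu hgi hfi hweak Kf hKf hfH x hx y hy
  have hle : N i ≤ ∑ k, N k + 1 := by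
    have := Finset.single_le_sum (f := N) (fun k _ => (hN k).le) (Finset.mem_univ i)
    linarith
  have hI : 0 ≤ ∫ x in ball (0 : EuclideanSpace ℝ (Fin d)) 1, gradNorm u x ^ p :=
    integral_nonneg fun x => Real.rpow_nonneg (Real.sqrt_nonneg _) _
  refine h.trans ?_
  gcongr
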